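/- Let α γ > 0 and let (u,v) be a regular decaying solution of the NLS–KdV system on ℝ⁺ × [0,T] with homogeneous boundary conditions u(0,t) = v(0,t) = 0 for all t ∈ [0,T]. If Q⁺(0) < 0, where Q⁺(0) = ∫₀^∞ ((α/γ) v(x,0)² + 2 Im(u(x,0)·conj(∂ₓu(x,0)))) dx, then for every t ∈ [0,T], ∫₀^∞ x|u(x,t)|² dx ≥ |Q⁺(0)|·t + ∫₀^∞ x|u(x,0)|² dx. -/

import Mathlib

open MeasureTheory Set Filter Topology

noncomputable section

/-- Partial derivative in the spatial variable. -/
def pdx {E : Type*} [NormedAddCommGroup E] [NormedSpace ℝ E] (f : ℝ → ℝ → E) (x t : ℝ) : E :=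
  deriv (fun y => f y t) x

/-- Partial derivative in the time variable. -/
def pdt {E : Type*} [NormedAddCommGroup E] [NormedSpace ℝ E] (f : ℝ → ℝ → E) (x t : ℝ) : E :=
  deriv (fun s => f x s) t

/-- The Schrödinger equation of the NLS-KdV system, pointwise. -/
def NLSeq (α β : ℝ) (u : ℝ → ℝ → ℂ) (v : ℝ → ℝ → ℝ) (x t : ℝ) : Prop :=
  Complex.I * pdt u x t + pdx (pdx u) x t
    = (α : ℂ) * u x t * (v x t : ℂ) + (β : ℂ) * u x t * (‖u x t‖ : ℂ) ^ 2

/-- The KdV equation of the NLS-KdV system, pointwise. -/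
def KdVeq (γ : ℝ) (u : ℝ → ℝ → ℂ) (v : ℝ → ℝ → ℝ) (x t : ℝ) : Prop :=
  pdt v x t + pdx (pdx (pdx v)) x t + v x t * pdx v x t
    = γ * deriv (fun y => ‖u y t‖ ^ 2) x

/-- Rapid decay as x → +∞, for every time in [0,T]. -/
def RapidDecayPos {E : Type*} [NormedAddCommGroup E] (f : ℝ → ℝ → E) (T : ℝ) : Prop :=
  ∀ n : ℕ, ∀ t ∈ Icc (0:ℝ) T, Tendsto (fun x : ℝ => |x| ^ n * ‖f x t‖) atTop (nhds 0)

/-- Rapid decay as x → +∞ of u, v and all their derivatives appearing. -/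
def DecayPos (u : ℝ → ℝ → ℂ) (v : ℝ → ℝ → ℝ) (T : ℝ) : Prop :=
  RapidDecayPos u T ∧ RapidDecayPos (pdx u) T ∧ RapidDecayPos (pdx (pdx u)) T ∧
    RapidDecayPos (pdt u) T ∧ RapidDecayPos v T ∧ RapidDecayPos (pdx v) T ∧
    RapidDecayPos (pdx (pdx v)) T ∧ RapidDecayPos (pdx (pdx (pdx v))) T ∧
    RapidDecayPos (pdt v) T



def Sm (f : ℝ → ℝ → ℝ) : Prop := ContDiff ℝ (⊤ : ℕ∞) (fun z : ℝ × ℝ => f z.1 z.2)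

theorem Sm.hx {f : ℝ → ℝ → ℝ} (hf : Sm f) (x t : ℝ) :
    HasDerivAt (fun y => f y t) (pdx f x t) x := by
  have h : ContDiff ℝ (⊤ : ℕ∞) (fun y => f y t) :=
    hf.comp (f := fun y : ℝ => (y, t)) (by fun_prop)
  exact ((h.differentiable (by simp)) x).hasDerivAt

theorem Sm.ht {f : ℝ → ℝ → ℝ} (hf : Sm f) (x t : ℝ) :
    HasDerivAt (fun s => f x s) (pdt f x t) t := by
  have h : ContDiff ℝ (⊤ : ℕ∞) (fun s => f x s) :=
    hf.comp (f := fun s : ℝ => (x, s)) (by fun_prop)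
  exact ((h.differentiable (by simp)) t).hasDerivAt

theorem Sm.pdx_eq {f : ℝ → ℝ → ℝ} (hf : Sm f) (x t : ℝ) :
    pdx f x t = fderiv ℝ (fun z : ℝ × ℝ => f z.1 z.2) (x, t) (1, 0) := by
  have h1 : HasFDerivAt (fun z : ℝ × ℝ => f z.1 z.2) _ (x, t) :=
    ((ContDiff.differentiable hf (by simp)) (x, t)).hasFDerivAt
  have h2 : HasDerivAt (fun y : ℝ => (y, t)) ((1 : ℝ), (0 : ℝ)) x :=
    (hasDerivAt_id x).prodMk (hasDerivAt_const x t)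
  exact (h1.comp_hasDerivAt x h2).deriv

theorem Sm.pdt_eq {f : ℝ → ℝ → ℝ} (hf : Sm f) (x t : ℝ) :
    pdt f x t = fderiv ℝ (fun z : ℝ × ℝ => f z.1 z.2) (x, t) (0, 1) := by
  have h1 : HasFDerivAt (fun z : ℝ × ℝ => f z.1 z.2) _ (x, t) :=
    ((ContDiff.differentiable hf (by simp)) (x, t)).hasFDerivAt
  have h2 : HasDerivAt (fun y : ℝ => (x, y)) ((0 : ℝ), (1 : ℝ)) t :=
    (hasDerivAt_const t x).prodMk (hasDerivAt_id t)
  exact (h1.comp_hasDerivAt t h2).deriv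

theorem Sm.fd {f : ℝ → ℝ → ℝ} (hf : Sm f) :
    ContDiff ℝ (⊤ : ℕ∞) (fderiv ℝ (fun z : ℝ × ℝ => f z.1 z.2)) :=
  ContDiff.fderiv_right hf (by simp)

theorem Sm.pdx {f : ℝ → ℝ → ℝ} (hf : Sm f) : Sm (pdx f) := by
  have : (fun z : ℝ × ℝ => _root_.pdx f z.1 z.2)
      = fun z => fderiv ℝ (fun z : ℝ × ℝ => f z.1 z.2) z (1, 0) := by
    funext z; exact hf.pdx_eq z.1 z.2
  unfold Sm; rw [this]
  exact hf.fd.clm_apply contDiff_const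

theorem Sm.pdt {f : ℝ → ℝ → ℝ} (hf : Sm f) : Sm (pdt f) := by
  have : (fun z : ℝ × ℝ => _root_.pdt f z.1 z.2)
      = fun z => fderiv ℝ (fun z : ℝ × ℝ => f z.1 z.2) z (0, 1) := by
    funext z; exact hf.pdt_eq z.1 z.2
  unfold Sm; rw [this]
  exact hf.fd.clm_apply contDiff_const

theorem Sm.comm {f : ℝ → ℝ → ℝ} (hf : Sm f) (x t : ℝ) :
    _root_.pdt (_root_.pdx f) x t = _root_.pdx (_root_.pdt f) x t := by
  have hd := (hf.fd.differentiable (by simp)) (x, t)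
  rw [hf.pdx.pdt_eq, hf.pdt.pdx_eq]
  have e1 : (fun z : ℝ × ℝ => _root_.pdx f z.1 z.2)
      = fun z => fderiv ℝ (fun z : ℝ × ℝ => f z.1 z.2) z (1, 0) := by
    funext z; exact hf.pdx_eq z.1 z.2
  have e2 : (fun z : ℝ × ℝ => _root_.pdt f z.1 z.2)
      = fun z => fderiv ℝ (fun z : ℝ × ℝ => f z.1 z.2) z (0, 1) := by
    funext z; exact hf.pdt_eq z.1 z.2
  rw [e1, e2]
  have k1 := (hd.hasFDerivAt.clm_apply (hasFDerivAt_const ((1:ℝ),(0:ℝ)) (x,t))).fderiv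
  have k2 := (hd.hasFDerivAt.clm_apply (hasFDerivAt_const ((0:ℝ),(1:ℝ)) (x,t))).fderiv
  rw [k1, k2]
  have hs : IsSymmSndFDerivAt ℝ (fun z : ℝ × ℝ => f z.1 z.2) (x, t) :=
    (ContDiff.contDiffAt hf).isSymmSndFDerivAt (by
      rw [minSmoothness_of_isRCLikeNormedField]; exact WithTop.coe_le_coe.2 (le_top : (2 : ℕ∞) ≤ ⊤))
  simpa using hs.eq (0,1) (1,0)

theorem Sm.cont {f : ℝ → ℝ → ℝ} (hf : Sm f) : Continuous (fun z : ℝ × ℝ => f z.1 z.2) :=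
  ContDiff.continuous hf
theorem Sm.cx {f : ℝ → ℝ → ℝ} (hf : Sm f) (t : ℝ) : Continuous (fun x => f x t) :=
  hf.cont.comp (f := fun x : ℝ => (x, t)) (by fun_prop)
theorem Sm.ct {f : ℝ → ℝ → ℝ} (hf : Sm f) (x : ℝ) : Continuous (fun t => f x t) :=
  hf.cont.comp (f := fun t : ℝ => (x, t)) (by fun_prop)

theorem Sm.add {f g : ℝ → ℝ → ℝ} (hf : Sm f) (hg : Sm g) : Sm (fun x t => f x t + g x t) :=
  ContDiff.add hf hg
theorem Sm.sub {f g : ℝ → ℝ → ℝ} (hf : Sm f) (hg : Sm g) : Sm (fun x t => f x t - g x t) :=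
  ContDiff.sub hf hg
theorem Sm.mul {f g : ℝ → ℝ → ℝ} (hf : Sm f) (hg : Sm g) : Sm (fun x t => f x t * g x t) :=
  ContDiff.mul hf hg
theorem Sm.neg {f : ℝ → ℝ → ℝ} (hf : Sm f) : Sm (fun x t => - f x t) :=
  ContDiff.neg hf
theorem Sm.pow {f : ℝ → ℝ → ℝ} (hf : Sm f) (n : ℕ) : Sm (fun x t => f x t ^ n) :=
  ContDiff.pow hf n
theorem Sm.const (c : ℝ) : Sm (fun _ _ => c) := contDiff_const
theorem Sm.fst : Sm (fun x _ => x) := contDiff_fst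
theorem Sm.cmul {f : ℝ → ℝ → ℝ} (c : ℝ) (hf : Sm f) : Sm (fun x t => c * f x t) :=
  (Sm.const c).mul hf
/-- time shift -/
theorem Sm.shift {f : ℝ → ℝ → ℝ} (hf : Sm f) (h : ℝ) : Sm (fun x t => f x (t + h)) :=
  ContDiff.comp hf (f := fun z : ℝ × ℝ => (z.1, z.2 + h)) (by fun_prop)
/-- frozen time -/
theorem Sm.freeze {f : ℝ → ℝ → ℝ} (hf : Sm f) (d : ℝ) : Sm (fun x _ => f x d) :=
  ContDiff.comp hf (f := fun z : ℝ × ℝ => (z.1, d)) (by fun_prop)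

/-- differentiation under a weighted compact integral -/
theorem Sm.hasDerivAt_int {f : ℝ → ℝ → ℝ} (hf : Sm f) (w : ℝ → ℝ) (R : ℝ) (hR : 0 ≤ R)
    (hw : ContinuousOn w (Icc 0 R)) (t : ℝ) :
    HasDerivAt (fun s => ∫ x in (0:ℝ)..R, w x * f x s) (∫ x in (0:ℝ)..R, w x * _root_.pdt f x t) t := by
  have hu : uIcc (0:ℝ) R = Icc 0 R := uIcc_of_le hR
  obtain ⟨M1, hM1⟩ := (isCompact_Icc (a := (0:ℝ)) (b := R)).exists_bound_of_continuousOn hw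
  obtain ⟨M2, hM2⟩ := ((isCompact_Icc (a := (0:ℝ)) (b := R)).prod
    (isCompact_Icc (a := t-1) (b := t+1))).exists_bound_of_continuousOn hf.pdt.cont.continuousOn
  have hgi : ∀ g : ℝ → ℝ, Continuous g → IntervalIntegrable (fun x => w x * g x) volume 0 R := by
    intro g hg
    apply ContinuousOn.intervalIntegrable
    rw [hu]; exact hw.mul hg.continuousOn
  refine (intervalIntegral.hasDerivAt_integral_of_dominated_loc_of_deriv_le
    (F := fun s x => w x * f x s) (F' := fun s x => w x * _root_.pdt f x s)
    (s := Icc (t-1) (t+1)) (bound := fun _ => M1 * M2)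
    (Icc_mem_nhds (by linarith) (by linarith)) ?_ (hgi _ (hf.cx t)) ?_ ?_ ?_ ?_).2
  · exact Eventually.of_forall fun s => (hgi _ (hf.cx s)).aestronglyMeasurable_restrict_uIoc
  · exact (hgi _ (hf.pdt.cx t)).aestronglyMeasurable_restrict_uIoc
  · refine Eventually.of_forall fun x hx s hs => ?_
    have hx' : x ∈ Icc 0 R := by rw [← hu]; exact uIoc_subset_uIcc hx
    rw [norm_mul]
    exact mul_le_mul (hM1 x hx') (hM2 (x,s) ⟨hx', hs⟩) (norm_nonneg _)
      ((norm_nonneg _).trans (hM1 x hx'))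
  · exact intervalIntegrable_const
  · exact Eventually.of_forall fun x hx s hs => (hf.ht x s).const_mul (w x)


/-- continuous and rapidly decaying at plus infinity -/
def RD (g : ℝ → ℝ) : Prop := Continuous g ∧ ∀ n : ℕ, Tendsto (fun x => x ^ n * g x) atTop (𝓝 0)

theorem RD.c {g : ℝ → ℝ} (h : RD g) : Continuous g := h.1
theorem RD.lim {g : ℝ → ℝ} (h : RD g) : Tendsto g atTop (𝓝 0) := by simpa using h.2 0
theorem RD.add {f g : ℝ → ℝ} (hf : RD f) (hg : RD g) : RD (fun x => f x + g x) :=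
  ⟨hf.1.add hg.1, fun n => by simpa [mul_add] using (hf.2 n).add (hg.2 n)⟩
theorem RD.mul {f g : ℝ → ℝ} (hf : RD f) (hg : RD g) : RD (fun x => f x * g x) :=
  ⟨hf.1.mul hg.1, fun n => by simpa [mul_assoc] using (hf.2 n).mul (hg.lim)⟩
theorem RD.cmul {f : ℝ → ℝ} (c : ℝ) (hf : RD f) : RD (fun x => c * f x) :=
  ⟨hf.1.const_mul c, fun n => by simpa [mul_left_comm] using (hf.2 n).const_mul c⟩
theorem RD.neg {f : ℝ → ℝ} (hf : RD f) : RD (fun x => - f x) := by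
  simpa using hf.cmul (-1)
theorem RD.sub {f g : ℝ → ℝ} (hf : RD f) (hg : RD g) : RD (fun x => f x - g x) := by
  simpa [sub_eq_add_neg] using hf.add hg.neg
theorem RD.sq {f : ℝ → ℝ} (hf : RD f) : RD (fun x => f x ^ 2) := by
  simpa [pow_two] using hf.mul hf
theorem RD.cube {f : ℝ → ℝ} (hf : RD f) : RD (fun x => f x ^ 3) := by
  simpa [pow_succ] using (hf.mul hf).mul hf
theorem RD.xmul {f : ℝ → ℝ} (hf : RD f) : RD (fun x => x * f x) :=
  ⟨continuous_id.mul hf.1, fun n => by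
    simpa [pow_succ, mul_assoc] using hf.2 (n+1)⟩
theorem RD.x2mul {f : ℝ → ℝ} (hf : RD f) : RD (fun x => x ^ 2 * f x) := by
  simpa [pow_two, mul_assoc] using hf.xmul.xmul

theorem RD.int {g : ℝ → ℝ} (h : RD g) : IntegrableOn g (Ioi 0) := by
  have h2 := (h.lim.add (h.2 2)).norm
  simp only [add_zero, norm_zero] at h2
  have hev := h2.eventually (gt_mem_nhds (show (0:ℝ) < 1 by norm_num))
  obtain ⟨N, hN⟩ := (hev.and (eventually_ge_atTop 1)).exists_forall_of_atTop
  have hN1 : 1 ≤ N := (hN N le_rfl).2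
  have e : Ioi (0:ℝ) = Ioc 0 N ∪ Ioi N := by rw [Ioc_union_Ioi_eq_Ioi]; linarith
  rw [e]
  refine IntegrableOn.union ?_ ?_
  · exact (h.c.integrableOn_Icc (a := 0) (b := N)).mono_set Ioc_subset_Icc_self
  · have hi : IntegrableOn (fun x : ℝ => (1 + x ^ 2)⁻¹) (Ioi N) :=
      integrable_inv_one_add_sq.integrableOn
    refine hi.mono' h.c.aestronglyMeasurable ?_
    refine (ae_restrict_iff' measurableSet_Ioi).2 (Eventually.of_forall fun x hx => ?_)
    have := (hN x (le_of_lt hx)).1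
    have e2 : g x + x ^ 2 * g x = (1 + x ^ 2) * g x := by ring
    rw [e2, norm_mul, Real.norm_of_nonneg (by positivity)] at this
    rw [inv_eq_one_div, le_div_iff₀ (by positivity)]
    nlinarith

/-- the weight ψ -/
def psi (x : ℝ) : ℝ := (1 + x)⁻¹

theorem psi_pos {x : ℝ} (hx : 0 ≤ x) : 0 < psi x := by unfold psi; positivity
theorem psi_le_one {x : ℝ} (hx : 0 ≤ x) : psi x ≤ 1 := by
  unfold psi; exact inv_le_one_of_one_le₀ (by linarith)
theorem psi_mul {x : ℝ} (hx : 0 ≤ x) : (1 + x) * psi x = 1 := by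
  unfold psi; field_simp
theorem psi_contOn : ContinuousOn psi (Ici 0) := by
  unfold psi
  refine ContinuousOn.inv₀ (by fun_prop) ?_
  intro x hx; have : (0:ℝ) ≤ x := hx; positivity
theorem psi_meas : Measurable psi := by unfold psi; fun_prop
theorem psi_hasDeriv {x : ℝ} (hx : 0 ≤ x) : HasDerivAt psi (-(psi x)^2) x := by
  have h : HasDerivAt (fun y : ℝ => 1 + y) 1 x := by simpa using (hasDerivAt_id x).const_add 1
  have := h.fun_inv (by positivity)
  refine this.congr_deriv ?_
  unfold psi; field_simp

theorem RD.psi_int {g : ℝ → ℝ} (h : RD g) : IntegrableOn (fun x => psi x * g x) (Ioi 0) := by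
  refine h.int.norm.mono' (psi_meas.aestronglyMeasurable.mul h.c.aestronglyMeasurable) ?_
  refine (ae_restrict_iff' measurableSet_Ioi).2 (Eventually.of_forall fun x hx => ?_)
  have hx' : (0:ℝ) ≤ x := le_of_lt hx
  rw [norm_mul, Real.norm_of_nonneg (psi_pos hx').le]
  exact mul_le_of_le_one_left (norm_nonneg _) (psi_le_one hx')

/-- monotonicity for Ioi integrals -/
theorem int_mono {f g : ℝ → ℝ} (hf : IntegrableOn f (Ioi 0)) (hg : IntegrableOn g (Ioi 0))
    (h : ∀ x, 0 ≤ x → f x ≤ g x) : ∫ x in Ioi (0:ℝ), f x ≤ ∫ x in Ioi (0:ℝ), g x :=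
  setIntegral_mono_on hf hg measurableSet_Ioi fun x hx => h x (le_of_lt hx)

theorem int_nn {f : ℝ → ℝ} (h : ∀ x, 0 ≤ x → 0 ≤ f x) : 0 ≤ ∫ x in Ioi (0:ℝ), f x :=
  setIntegral_nonneg measurableSet_Ioi fun x hx => h x (le_of_lt hx)

/-- truncated integral below the full one -/
theorem trunc_le {f g : ℝ → ℝ} {R : ℝ} (hR : 0 ≤ R) (hf : IntervalIntegrable f volume 0 R)
    (hg : IntegrableOn g (Ioi 0)) (hg0 : ∀ x, 0 ≤ x → 0 ≤ g x)
    (h : ∀ x ∈ Icc 0 R, f x ≤ g x) : ∫ x in (0:ℝ)..R, f x ≤ ∫ x in Ioi (0:ℝ), g x := by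
  have hg' : IntervalIntegrable g volume 0 R := by
    rw [intervalIntegrable_iff_integrableOn_Ioc_of_le hR]; exact hg.mono_set Ioc_subset_Ioi_self
  refine (intervalIntegral.integral_mono_on hR hf hg' h).trans ?_
  rw [intervalIntegral.integral_of_le hR]
  refine setIntegral_mono_set hg ?_ (Ioc_subset_Ioi_self.eventuallyLE)
  exact (ae_restrict_iff' measurableSet_Ioi).2 (Eventually.of_forall fun x hx => hg0 x (le_of_lt hx))

theorem full_le {g : ℝ → ℝ} {L : ℝ} (hg : IntegrableOn g (Ioi 0))
    (h : ∀ R, 0 ≤ R → ∫ x in (0:ℝ)..R, g x ≤ L) : ∫ x in Ioi (0:ℝ), g x ≤ L := by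
  have := intervalIntegral_tendsto_integral_Ioi 0 hg tendsto_id
  exact le_of_tendsto this ((eventually_ge_atTop 0).mono fun R hR => h R hR)

/-- weighted truncation, general form -/
theorem wt_tendsto {g : ℝ → ℝ} (hg : IntegrableOn g (Ioi 0)) (w : ℝ → ℝ → ℝ) (l : ℝ) (M : ℝ)
    (hwm : ∀ R, Measurable (w R))
    (hw : ∀ R, 1 ≤ R → ∀ x ∈ Icc 0 R, |w R x| ≤ M)
    (hl : ∀ x, 0 ≤ x → Tendsto (fun R => w R x) atTop (𝓝 l)) :
    Tendsto (fun R => ∫ x in (0:ℝ)..R, w R x * g x) atTop (𝓝 (l * ∫ x in Ioi (0:ℝ), g x)) := by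
  have hM : 0 ≤ M := (abs_nonneg _).trans (hw 1 le_rfl 0 (by simp))
  rw [← integral_const_mul]
  have key : Tendsto (fun R => ∫ x in Ioi (0:ℝ), (Ioc 0 R).indicator (fun x => w R x * g x) x) atTop
      (𝓝 (∫ x in Ioi (0:ℝ), l * g x)) := by
    refine tendsto_integral_filter_of_dominated_convergence (fun x => M * |g x|) ?_ ?_ ?_ ?_
    · exact Eventually.of_forall fun R =>
        (((hwm R).aestronglyMeasurable).mul hg.aestronglyMeasurable).indicator measurableSet_Ioc
    · filter_upwards [eventually_ge_atTop 1] with R hR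
      refine (ae_restrict_iff' measurableSet_Ioi).2 (Eventually.of_forall fun x hx => ?_)
      by_cases hxR : x ∈ Ioc 0 R
      · rw [indicator_of_mem hxR, norm_mul]
        exact mul_le_mul_of_nonneg_right (hw R hR x (Ioc_subset_Icc_self hxR)) (norm_nonneg _)
      · rw [indicator_of_notMem hxR]; simp only [norm_zero]; positivity
    · exact hg.norm.const_mul M
    · refine (ae_restrict_iff' measurableSet_Ioi).2 (Eventually.of_forall fun x hx => ?_)
      refine ((hl x (le_of_lt hx)).mul_const (g x)).congr' ?_
      filter_upwards [eventually_ge_atTop x] with R hR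
      rw [indicator_of_mem]; exact ⟨hx, hR⟩
  refine key.congr' ?_
  filter_upwards [eventually_ge_atTop 0] with R hR
  rw [integral_indicator measurableSet_Ioc, Measure.restrict_restrict measurableSet_Ioc,
    inter_eq_left.2 Ioc_subset_Ioi_self, intervalIntegral.integral_of_le hR]

theorem lin_tendsto {g : ℝ → ℝ} (hg : IntegrableOn g (Ioi 0)) (k : ℕ) :
    Tendsto (fun R => ∫ x in (0:ℝ)..R, (1 - x / R) ^ k * g x) atTop (𝓝 (∫ x in Ioi (0:ℝ), g x)) := by
  have := wt_tendsto hg (fun R x => (1 - x / R) ^ k) 1 1 (fun R => by fun_prop) ?_ ?_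
  · simpa using this
  · intro R hR x hx
    have h0 : 0 ≤ x / R := div_nonneg hx.1 (by linarith)
    have h1 : x / R ≤ 1 := div_le_one_of_le₀ hx.2 (by linarith)
    rw [abs_of_nonneg (pow_nonneg (by linarith) _)]
    exact pow_le_one₀ (by linarith) (by linarith)
  · intro x _
    have : Tendsto (fun R : ℝ => (1 - x / R) ^ k) atTop (𝓝 ((1 - 0) ^ k)) :=
      (tendsto_const_nhds.sub (tendsto_const_nhds.div_atTop tendsto_id)).pow k
    simpa using this

/-- Fatou on the half line -/
theorem fatou {f : ℕ → ℝ → ℝ} {g : ℝ → ℝ} {L : ℝ}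
    (hf : ∀ n, IntegrableOn (f n) (Ioi 0)) (hg : IntegrableOn g (Ioi 0))
    (hf0 : ∀ n x, 0 ≤ x → 0 ≤ f n x)
    (hlim : ∀ x, 0 ≤ x → Tendsto (fun n => f n x) atTop (𝓝 (g x)))
    (hL : ∀ n, ∫ x in Ioi (0:ℝ), f n x ≤ L) : ∫ x in Ioi (0:ℝ), g x ≤ L := by
  have hL0 : 0 ≤ L := (int_nn (hf0 0)).trans (hL 0)
  have hg0 : ∀ x, 0 ≤ x → 0 ≤ g x := fun x hx =>
    ge_of_tendsto' (hlim x hx) fun n => hf0 n x hx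
  have ae0 : ∀ {h : ℝ → ℝ}, (∀ x, 0 ≤ x → 0 ≤ h x) → 0 ≤ᵐ[volume.restrict (Ioi 0)] h := fun hh =>
    (ae_restrict_iff' measurableSet_Ioi).2 (Eventually.of_forall fun x hx => hh x (le_of_lt hx))
  have h1 : ∫⁻ x in Ioi (0:ℝ), ENNReal.ofReal (g x) ≤ ENNReal.ofReal L := by
    calc ∫⁻ x in Ioi (0:ℝ), ENNReal.ofReal (g x)
        = ∫⁻ x in Ioi (0:ℝ), liminf (fun n => ENNReal.ofReal (f n x)) atTop := by
          refine setLIntegral_congr_fun measurableSet_Ioi fun x hx => ?_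
          exact ((ENNReal.continuous_ofReal.tendsto _).comp (hlim x (le_of_lt hx))).liminf_eq.symm
      _ ≤ liminf (fun n => ∫⁻ x in Ioi (0:ℝ), ENNReal.ofReal (f n x)) atTop :=
          lintegral_liminf_le' fun n => (hf n).aestronglyMeasurable.aemeasurable.ennreal_ofReal
      _ ≤ ENNReal.ofReal L := by
          refine liminf_le_of_frequently_le' (Frequently.of_forall fun n => ?_)
          rw [← ofReal_integral_eq_lintegral_ofReal (hf n) (ae0 (hf0 n))]
          exact ENNReal.ofReal_le_ofReal (hL n)
  rw [← ofReal_integral_eq_lintegral_ofReal hg (ae0 hg0)] at h1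
  exact (ENNReal.ofReal_le_ofReal_iff hL0).1 h1

/-- backward Gronwall -/
theorem gron_back {f f' : ℝ → ℝ} {a b A C : ℝ} (hab : a ≤ b) (hA : 0 ≤ A) (hC : 0 ≤ C)
    (hf : ∀ t ∈ Icc a b, HasDerivAt f (f' t) t)
    (h : ∀ t ∈ Icc a b, - f' t ≤ A * f t + C) :
    f a ≤ Real.exp (A * (b - a)) * (f b + C * (b - a)) := by
  have hmono : MonotoneOn (fun t => Real.exp (A * t) * f t + C * Real.exp (A * b) * t) (Icc a b) := by
    have hd : ∀ t ∈ Icc a b, HasDerivAt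
        (fun t => Real.exp (A * t) * f t + C * Real.exp (A * b) * t)
        (Real.exp (A * t) * A * f t + Real.exp (A * t) * f' t + C * Real.exp (A * b)) t := by
      intro t ht
      have h1 : HasDerivAt (fun t : ℝ => Real.exp (A * t)) (Real.exp (A * t) * A) t := by
        simpa using ((hasDerivAt_id t).const_mul A).exp
      have h2 := (h1.fun_mul (hf t ht)).fun_add ((hasDerivAt_id t).const_mul (C * Real.exp (A * b)))
      simpa using h2
    refine monotoneOn_of_deriv_nonneg (convex_Icc a b)
      (fun t ht => (hd t ht).continuousAt.continuousWithinAt) ?_ ?_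
    · intro t ht; rw [interior_Icc] at ht
      exact (hd t (Ioo_subset_Icc_self ht)).differentiableAt.differentiableWithinAt
    · intro t ht; rw [interior_Icc] at ht
      have ht' := Ioo_subset_Icc_self ht
      rw [(hd t ht').deriv]
      have h1 := h t ht'
      have h2 : Real.exp (A * t) ≤ Real.exp (A * b) :=
        Real.exp_le_exp.2 (mul_le_mul_of_nonneg_left ht'.2 hA)
      have h3 := Real.exp_pos (A * t)
      nlinarith [mul_le_mul_of_nonneg_left h1 h3.le, mul_le_mul_of_nonneg_left h2 hC]
  have := hmono (left_mem_Icc.2 hab) (right_mem_Icc.2 hab) hab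
  simp only at this
  have e : Real.exp (A * (b - a)) = Real.exp (A * b) / Real.exp (A * a) := by
    rw [← Real.exp_sub]; ring_nf
  rw [e, div_mul_eq_mul_div, le_div_iff₀ (Real.exp_pos _)]
  nlinarith

/-- forward Gronwall -/
theorem gron_fwd {f f' : ℝ → ℝ} {a b A C : ℝ} (hab : a ≤ b) (hA : 0 ≤ A) (hC : 0 ≤ C)
    (hf : ∀ t ∈ Icc a b, HasDerivAt f (f' t) t)
    (h : ∀ t ∈ Icc a b, f' t ≤ A * f t + C) :
    f b ≤ Real.exp (A * (b - a)) * (f a + C * (b - a)) := by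
  have := gron_back (f := fun t => f (-t)) (f' := fun t => - f' (-t)) (a := -b) (b := -a)
    (A := A) (C := C) (by linarith) hA hC ?_ ?_
  · have e : -a - -b = b - a := by ring
    simpa [e] using this
  · intro t ht
    have := (hf (-t) ⟨by linarith [ht.2], by linarith [ht.1]⟩)
    have h2 := this.scomp t (hasDerivAt_neg t)
    simpa [Function.comp_def] using h2
  · intro t ht
    have := h (-t) ⟨by linarith [ht.2], by linarith [ht.1]⟩
    simpa using this


theorem abs_trunc_le {f g : ℝ → ℝ} {R : ℝ} (hR : 0 ≤ R) (hf : IntervalIntegrable f volume 0 R)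
    (hg : IntegrableOn g (Ioi 0)) (hg0 : ∀ x, 0 ≤ x → 0 ≤ g x)
    (h : ∀ x ∈ Icc 0 R, |f x| ≤ g x) : |∫ x in (0:ℝ)..R, f x| ≤ ∫ x in Ioi (0:ℝ), g x := by
  refine (intervalIntegral.abs_integral_le_integral_abs hR).trans ?_
  exact trunc_le hR hf.abs hg hg0 h

theorem CL {ρ Φ σ B : ℝ → ℝ → ℝ} (hρ : Sm ρ) (hΦ : Sm Φ) (hσ : Sm σ) {c d L : ℝ} (hcd : c ≤ d)
    (heq : ∀ x t, 0 ≤ x → t ∈ Icc c d → pdt ρ x t = pdx Φ x t + σ x t)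
    (hρi : ∀ t ∈ Icc c d, IntegrableOn (fun x => ρ x t) (Ioi 0))
    (hBi : ∀ t ∈ Icc c d, IntegrableOn (fun x => B x t) (Ioi 0))
    (hBL : ∀ t ∈ Icc c d, ∫ x in Ioi (0:ℝ), B x t ≤ L)
    (hΦB : ∀ x t, 0 ≤ x → t ∈ Icc c d → |Φ x t| ≤ (1 + x) * B x t)
    (hσB : ∀ x t, 0 ≤ x → t ∈ Icc c d → |σ x t| ≤ B x t) :
    IntervalIntegrable (fun t => (∫ x in Ioi (0:ℝ), σ x t) - Φ 0 t) volume c d ∧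
    (∫ x in Ioi (0:ℝ), ρ x d) - (∫ x in Ioi (0:ℝ), ρ x c)
      = ∫ t in c..d, ((∫ x in Ioi (0:ℝ), σ x t) - Φ 0 t) := by
  have hu : uIcc c d = Icc c d := uIcc_of_le hcd
  have hB0 : ∀ t ∈ Icc c d, ∀ x, 0 ≤ x → 0 ≤ B x t := fun t ht x hx =>
    (abs_nonneg _).trans (hσB x t hx ht)
  set D : ℝ → ℝ → ℝ := fun R t => ∫ x in (0:ℝ)..R, (1 - x / R) * pdt ρ x t with hD
  have hDc : ∀ R, Continuous (D R) := by
    intro R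
    apply intervalIntegral.continuous_parametric_intervalIntegral_of_continuous'
    have := hρ.pdt.cont
    exact (by fun_prop : Continuous fun z : ℝ × ℝ => (1 - z.2 / R)).mul
      (this.comp (f := fun z : ℝ × ℝ => (z.2, z.1)) (by fun_prop))
  have hDeq : ∀ R, 1 ≤ R → ∀ t ∈ Icc c d, D R t = - Φ 0 t + (∫ x in (0:ℝ)..R, ((1 + x) / R) * (psi x * Φ x t))
      + ∫ x in (0:ℝ)..R, (1 - x / R) ^ 1 * σ x t := by
    intro R hR t ht
    have hR0 : (0:ℝ) ≤ R := by linarith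
    have hft : ∫ x in (0:ℝ)..R, (-(1/R) * Φ x t + (1 - x / R) * pdx Φ x t) = - Φ 0 t := by
      have : ∀ x ∈ uIcc (0:ℝ) R, HasDerivAt (fun x => (1 - x / R) * Φ x t)
          (-(1/R) * Φ x t + (1 - x / R) * pdx Φ x t) x := by
        intro x _
        have h1 : HasDerivAt (fun x : ℝ => 1 - x / R) (-(1/R)) x := by
          simpa using ((hasDerivAt_id x).div_const R).const_sub 1
        exact h1.fun_mul (hΦ.hx x t)
      rw [intervalIntegral.integral_eq_sub_of_hasDerivAt this]
      · field_simp; ring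
      · apply Continuous.intervalIntegrable
        have := hΦ.cx t; have := hΦ.pdx.cx t
        fun_prop
    have e : D R t = ∫ x in (0:ℝ)..R, ((-(1/R) * Φ x t + (1 - x / R) * pdx Φ x t)
        + ((1 + x) / R) * (psi x * Φ x t) + (1 - x / R) ^ 1 * σ x t) := by
      refine intervalIntegral.integral_congr fun x hx => ?_
      rw [uIcc_of_le hR0] at hx
      have := psi_mul hx.1
      rw [heq x t hx.1 ht]
      have h2 : ((1 + x) / R) * (psi x * Φ x t) = (1 / R) * ((1 + x) * psi x) * Φ x t := by ring
      rw [h2, this]; ring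
    rw [e, intervalIntegral.integral_add, intervalIntegral.integral_add, hft]
    · apply Continuous.intervalIntegrable
      have := hΦ.cx t; have := hΦ.pdx.cx t
      fun_prop
    · apply ContinuousOn.intervalIntegrable
      rw [uIcc_of_le hR0]
      have := (hΦ.cx t).continuousOn (s := Icc 0 R)
      have := psi_contOn.mono (Icc_subset_Ici_self : Icc 0 R ⊆ Ici 0)
      fun_prop
    · apply ContinuousOn.intervalIntegrable
      rw [uIcc_of_le hR0]
      have := (hΦ.cx t).continuousOn (s := Icc 0 R)
      have := (hΦ.pdx.cx t).continuousOn (s := Icc 0 R)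
      have := psi_contOn.mono (Icc_subset_Ici_self : Icc 0 R ⊆ Ici 0)
      fun_prop
    · apply Continuous.intervalIntegrable
      have := hσ.cx t
      fun_prop
  have hψB : ∀ t ∈ Icc c d, ∀ x, 0 ≤ x → |psi x * Φ x t| ≤ B x t := by
    intro t ht x hx
    have h1 := hΦB x t hx ht
    rw [abs_mul, abs_of_pos (psi_pos hx)]
    calc psi x * |Φ x t| ≤ psi x * ((1 + x) * B x t) := mul_le_mul_of_nonneg_left h1 (psi_pos hx).le
      _ = ((1 + x) * psi x) * B x t := by ring
      _ = B x t := by rw [psi_mul hx, one_mul]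
  have hψi : ∀ t ∈ Icc c d, IntegrableOn (fun x => psi x * Φ x t) (Ioi 0) := by
    intro t ht
    refine (hBi t ht).mono' (psi_meas.aestronglyMeasurable.mul (hΦ.cx t).aestronglyMeasurable) ?_
    exact (ae_restrict_iff' measurableSet_Ioi).2 (Eventually.of_forall fun x hx => hψB t ht x (le_of_lt hx))
  have hσi : ∀ t ∈ Icc c d, IntegrableOn (fun x => σ x t) (Ioi 0) := by
    intro t ht
    refine (hBi t ht).mono' (hσ.cx t).aestronglyMeasurable ?_
    exact (ae_restrict_iff' measurableSet_Ioi).2 (Eventually.of_forall fun x hx => hσB x t (le_of_lt hx) ht)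
  have hDlim : ∀ t ∈ Icc c d, Tendsto (fun R => D R t) atTop (𝓝 ((∫ x in Ioi (0:ℝ), σ x t) - Φ 0 t)) := by
    intro t ht
    have h1 := wt_tendsto (hψi t ht) (fun R x => (1 + x) / R) 0 2 (fun R => by fun_prop) ?_ ?_
    · have h2 := (h1.const_add (- Φ 0 t)).add (lin_tendsto (hσi t ht) 1)
      have e : -Φ 0 t + 0 * (∫ x in Ioi (0:ℝ), psi x * Φ x t) + ∫ x in Ioi (0:ℝ), σ x t
        = (∫ x in Ioi (0:ℝ), σ x t) - Φ 0 t := by ring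
      rw [e] at h2
      refine h2.congr' ?_
      filter_upwards [eventually_ge_atTop 1] with R hR
      rw [hDeq R hR t ht]
    · intro R hR x hx
      have : 0 ≤ x := hx.1
      rw [abs_of_nonneg (by positivity), div_le_iff₀ (by linarith)]
      linarith [hx.2]
    · intro x _
      exact tendsto_const_nhds.div_atTop tendsto_id
  obtain ⟨M0, hM0⟩ := (isCompact_Icc (a := c) (b := d)).exists_bound_of_continuousOn
    (hΦ.ct 0).continuousOn
  have hDb : ∀ R, 1 ≤ R → ∀ t ∈ Icc c d, |D R t| ≤ M0 + 2 * L + L := by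
    intro R hR t ht
    have hR0 : (0:ℝ) ≤ R := by linarith
    rw [hDeq R hR t ht]
    have hk1 : |∫ x in (0:ℝ)..R, ((1 + x) / R) * (psi x * Φ x t)| ≤ 2 * L := by
      have : |∫ x in (0:ℝ)..R, ((1 + x) / R) * (psi x * Φ x t)| ≤ ∫ x in Ioi (0:ℝ), 2 * B x t := by
        refine abs_trunc_le hR0 ?_ ((hBi t ht).const_mul 2) (fun x hx => by have := hB0 t ht x hx; positivity) ?_
        · apply ContinuousOn.intervalIntegrable
          rw [uIcc_of_le hR0]
          have := (hΦ.cx t).continuousOn (s := Icc 0 R)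
          have := psi_contOn.mono (Icc_subset_Ici_self : Icc 0 R ⊆ Ici 0)
          fun_prop
        · intro x hx
          rw [abs_mul]
          refine mul_le_mul ?_ (hψB t ht x hx.1) (abs_nonneg _) (by norm_num)
          have : 0 ≤ x := hx.1
          rw [abs_of_nonneg (by positivity), div_le_iff₀ (by linarith)]
          linarith [hx.2]
      rw [integral_const_mul] at this
      linarith [hBL t ht]
    have hk2 : |∫ x in (0:ℝ)..R, (1 - x / R) ^ 1 * σ x t| ≤ L := by
      refine (abs_trunc_le hR0 ?_ (hBi t ht) (hB0 t ht) ?_).trans (hBL t ht)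
      · apply Continuous.intervalIntegrable
        have := hσ.cx t
        fun_prop
      · intro x hx
        have h0 : 0 ≤ x / R := div_nonneg hx.1 (by linarith)
        have h1 : x / R ≤ 1 := div_le_one_of_le₀ hx.2 (by linarith)
        rw [abs_mul, pow_one, abs_of_nonneg (by linarith)]
        exact (mul_le_of_le_one_left (abs_nonneg _) (by linarith)).trans (hσB x t hx.1 ht)
    have hk3 : |Φ 0 t| ≤ M0 := hM0 t ht
    rw [abs_le] at *
    constructor <;> linarith
  have hFTC : ∀ R, 1 ≤ R → ∫ t in c..d, D R t = (∫ x in (0:ℝ)..R, (1 - x / R) ^ 1 * ρ x d)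
      - ∫ x in (0:ℝ)..R, (1 - x / R) ^ 1 * ρ x c := by
    intro R hR
    simp only [pow_one]
    refine intervalIntegral.integral_eq_sub_of_hasDerivAt
      (f := fun t => ∫ x in (0:ℝ)..R, (1 - x / R) * ρ x t) ?_ ((hDc R).intervalIntegrable _ _)
    intro t _
    exact hρ.hasDerivAt_int _ R (by linarith) (by fun_prop) t
  have hmem : ∀ t, t ∈ uIoc c d → t ∈ Icc c d := fun t ht => by
    rw [← hu]; exact uIoc_subset_uIcc ht
  have hlim1 : Tendsto (fun R => ∫ t in c..d, D R t) atTop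
      (𝓝 (∫ t in c..d, ((∫ x in Ioi (0:ℝ), σ x t) - Φ 0 t))) := by
    refine intervalIntegral.tendsto_integral_filter_of_dominated_convergence
      (fun _ => M0 + 2 * L + L) ?_ ?_ intervalIntegrable_const ?_
    · exact Eventually.of_forall fun R => (hDc R).aestronglyMeasurable
    · filter_upwards [eventually_ge_atTop 1] with R hR
      exact Eventually.of_forall fun t ht => hDb R hR t (hmem t ht)
    · exact Eventually.of_forall fun t ht => hDlim t (hmem t ht)
  have hlim2 : Tendsto (fun R => ∫ t in c..d, D R t) atTop
      (𝓝 ((∫ x in Ioi (0:ℝ), ρ x d) - (∫ x in Ioi (0:ℝ), ρ x c))) := by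
    refine ((lin_tendsto (hρi d (right_mem_Icc.2 hcd)) 1).sub
      (lin_tendsto (hρi c (left_mem_Icc.2 hcd)) 1)).congr' ?_
    filter_upwards [eventually_ge_atTop 1] with R hR
    rw [hFTC R hR]
  refine ⟨?_, tendsto_nhds_unique hlim2 hlim1⟩
  have hmeas : AEStronglyMeasurable (fun t => (∫ x in Ioi (0:ℝ), σ x t) - Φ 0 t)
      (volume.restrict (uIoc c d)) := by
    refine aestronglyMeasurable_of_tendsto_ae atTop (f := fun (n : ℝ) t => D n t)
      (fun R => (hDc R).aestronglyMeasurable) ?_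
    exact (ae_restrict_iff' measurableSet_uIoc).2 (Eventually.of_forall fun t ht => hDlim t (hmem t ht))
  refine (intervalIntegrable_const (c := M0 + 2 * L + L)).mono_fun hmeas ?_
  refine (ae_restrict_iff' measurableSet_uIoc).2 (Eventually.of_forall fun t ht => ?_)
  have h1 : |(∫ x in Ioi (0:ℝ), σ x t) - Φ 0 t| ≤ M0 + 2 * L + L :=
    le_of_tendsto (hDlim t (hmem t ht)).abs
      ((eventually_ge_atTop 1).mono fun R hR => hDb R hR t (hmem t ht))
  exact h1.trans (le_abs_self _)


theorem slice_est {F F' f g B : ℝ → ℝ} {R A : ℝ} (hR : 0 ≤ R)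
    (hF : ∀ x ∈ Icc 0 R, HasDerivAt F (F' x) x) (hF' : ContinuousOn F' (Icc 0 R))
    (hf : ContinuousOn f (Icc 0 R)) (hg : ContinuousOn g (Icc 0 R))
    (hB : IntegrableOn B (Ioi 0)) (hB0 : ∀ x, 0 ≤ x → 0 ≤ B x)
    (h : ∀ x ∈ Icc 0 R, f x ≤ F' x + A * g x + B x) :
    ∫ x in (0:ℝ)..R, f x ≤ F R - F 0 + A * (∫ x in (0:ℝ)..R, g x) + ∫ x in Ioi (0:ℝ), B x := by
  have hu : uIcc (0:ℝ) R = Icc 0 R := uIcc_of_le hR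
  have iF : IntervalIntegrable F' volume 0 R := ContinuousOn.intervalIntegrable (by rwa [hu])
  have ig : IntervalIntegrable g volume 0 R := ContinuousOn.intervalIntegrable (by rwa [hu])
  have jf : IntervalIntegrable f volume 0 R := ContinuousOn.intervalIntegrable (by rwa [hu])
  have e1 : ∫ x in (0:ℝ)..R, F' x = F R - F 0 :=
    intervalIntegral.integral_eq_sub_of_hasDerivAt (by rwa [hu]) iF
  have e2 : ∫ x in (0:ℝ)..R, (f x - (F' x + A * g x)) ≤ ∫ x in Ioi (0:ℝ), B x :=
    trunc_le hR (jf.sub (iF.add (ig.const_mul A))) hB hB0 fun x hx => by linarith [h x hx]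
  rw [intervalIntegral.integral_sub jf (iF.add (ig.const_mul A)),
    intervalIntegral.integral_add iF (ig.const_mul A), intervalIntegral.integral_const_mul, e1] at e2
  linarith

theorem ftc_le {F F' B : ℝ → ℝ} (hF : ∀ x, 0 ≤ x → HasDerivAt F (F' x) x)
    (hF' : ContinuousOn F' (Ici 0)) (hB : IntegrableOn B (Ioi 0)) (hB0 : ∀ x, 0 ≤ x → 0 ≤ B x)
    (h : ∀ x, 0 ≤ x → F' x ≤ B x) (x : ℝ) (hx : 0 ≤ x) :
    F x ≤ F 0 + ∫ x in Ioi (0:ℝ), B x := by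
  have hF'c : ContinuousOn F' (Icc 0 x) := hF'.mono Icc_subset_Ici_self
  have := slice_est (F := fun y => - F y) (F' := fun y => - F' y) (f := fun _ => 0) (g := fun _ => 0)
    (A := 0) hx
    (fun y hy => (hF y hy.1).neg) hF'c.neg continuousOn_const continuousOn_const hB hB0
    (fun y hy => by have := h y hy.1; linarith)
  simp at this
  linarith

/-- the real form of a decaying solution -/
structure Sol (α β γ T : ℝ) (p q v : ℝ → ℝ → ℝ) : Prop where
  sp : Sm p
  sq : Sm q
  sv : Sm v
  ep : ∀ x t, 0 ≤ x → t ∈ Icc 0 T → pdt p x t = - pdx (pdx q) x t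
    + (α * v x t + β * (p x t ^ 2 + q x t ^ 2)) * q x t
  eq : ∀ x t, 0 ≤ x → t ∈ Icc 0 T → pdt q x t = pdx (pdx p) x t
    - (α * v x t + β * (p x t ^ 2 + q x t ^ 2)) * p x t
  ev : ∀ x t, 0 ≤ x → t ∈ Icc 0 T → pdt v x t = - pdx (pdx (pdx v)) x t - v x t * pdx v x t
    + γ * (2 * p x t * pdx p x t + 2 * q x t * pdx q x t)
  p0 : ∀ t ∈ Icc 0 T, p 0 t = 0
  q0 : ∀ t ∈ Icc 0 T, q 0 t = 0
  v0 : ∀ t ∈ Icc 0 T, v 0 t = 0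
  rp : ∀ t ∈ Icc 0 T, RD fun x => p x t
  rp1 : ∀ t ∈ Icc 0 T, RD fun x => pdx p x t
  rpt : ∀ t ∈ Icc 0 T, RD fun x => pdt p x t
  rq : ∀ t ∈ Icc 0 T, RD fun x => q x t
  rq1 : ∀ t ∈ Icc 0 T, RD fun x => pdx q x t
  rqt : ∀ t ∈ Icc 0 T, RD fun x => pdt q x t
  rv : ∀ t ∈ Icc 0 T, RD fun x => v x t
  rv1 : ∀ t ∈ Icc 0 T, RD fun x => pdx v x t
  rv2 : ∀ t ∈ Icc 0 T, RD fun x => pdx (pdx v) x t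
  rv3 : ∀ t ∈ Icc 0 T, RD fun x => pdx (pdx (pdx v)) x t
  rvt : ∀ t ∈ Icc 0 T, RD fun x => pdt v x t

/-- energy density -/
def hd (p q v : ℝ → ℝ → ℝ) (x t : ℝ) : ℝ :=
  p x t ^ 2 + q x t ^ 2 + pdx p x t ^ 2 + pdx q x t ^ 2 + v x t ^ 2 + pdx v x t ^ 2
def H (p q v : ℝ → ℝ → ℝ) (t : ℝ) : ℝ := ∫ x in Ioi (0:ℝ), hd p q v x t

section
variable {α β γ T : ℝ} {p q v : ℝ → ℝ → ℝ}

theorem hd_nn (x t : ℝ) : 0 ≤ hd p q v x t := by unfold hd; positivity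
theorem H_nn (t : ℝ) : 0 ≤ H p q v t := int_nn fun x _ => hd_nn x t

theorem Sol.rhd (S : Sol α β γ T p q v) {t : ℝ} (ht : t ∈ Icc 0 T) : RD fun x => hd p q v x t :=
  (((((S.rp t ht).sq.add (S.rq t ht).sq).add (S.rp1 t ht).sq).add (S.rq1 t ht).sq).add
    (S.rv t ht).sq).add (S.rv1 t ht).sq

theorem Sol.n_le (S : Sol α β γ T p q v) {t : ℝ} (ht : t ∈ Icc 0 T) {x : ℝ} (hx : 0 ≤ x) :
    p x t ^ 2 + q x t ^ 2 ≤ H p q v t := by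
  have c1 := (S.rp t ht).c; have c2 := (S.rq t ht).c
  have c3 := (S.rp1 t ht).c; have c4 := (S.rq1 t ht).c
  have := ftc_le (F := fun x => p x t ^ 2 + q x t ^ 2)
    (F' := fun x => 2 * p x t * pdx p x t + 2 * q x t * pdx q x t)
    (B := fun x => hd p q v x t)
    (fun x _ => (((S.sp.hx x t).fun_pow 2).fun_add ((S.sq.hx x t).fun_pow 2)).congr_deriv (by
      simp)) (by fun_prop) (S.rhd ht).int (fun x _ => hd_nn x t)
    (fun x _ => by
      unfold hd
      nlinarith [sq_nonneg (p x t - pdx p x t), sq_nonneg (q x t - pdx q x t),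
        sq_nonneg (v x t), sq_nonneg (pdx v x t)]) x hx
  simpa [S.p0 t ht, S.q0 t ht, H] using this

theorem Sol.v_le (S : Sol α β γ T p q v) {t : ℝ} (ht : t ∈ Icc 0 T) {x : ℝ} (hx : 0 ≤ x) :
    v x t ^ 2 ≤ H p q v t := by
  have c1 := (S.rv t ht).c; have c2 := (S.rv1 t ht).c
  have := ftc_le (F := fun x => v x t ^ 2)
    (F' := fun x => 2 * v x t * pdx v x t)
    (B := fun x => hd p q v x t)
    (fun x _ => ((S.sv.hx x t).fun_pow 2).congr_deriv (by
      simp)) (by fun_prop) (S.rhd ht).int (fun x _ => hd_nn x t)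
    (fun x _ => by
      unfold hd
      nlinarith [sq_nonneg (v x t - pdx v x t),
        sq_nonneg (p x t), sq_nonneg (pdx p x t), sq_nonneg (q x t), sq_nonneg (pdx q x t)]) x hx
  simpa [S.v0 t ht, H] using this

/-- time derivative of n, as a flux -/
theorem Sol.nt (S : Sol α β γ T p q v) {x t : ℝ} (hx : 0 ≤ x) (ht : t ∈ Icc 0 T) :
    pdt (fun x t => p x t ^ 2 + q x t ^ 2) x t
      = 2 * (q x t * pdx (pdx p) x t - p x t * pdx (pdx q) x t) := by
  have h := (((S.sp.ht x t).fun_pow 2).fun_add ((S.sq.ht x t).fun_pow 2)).deriv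
  unfold pdt at h ⊢
  rw [h]
  have h1 := S.ep x t hx ht; have h2 := S.eq x t hx ht
  unfold pdt at h1 h2
  rw [h1, h2]; simp; ring

theorem Sol.n_sm (S : Sol α β γ T p q v) : Sm (fun x t => p x t ^ 2 + q x t ^ 2) :=
  (S.sp.pow 2).add (S.sq.pow 2)

theorem Sol.jx (S : Sol α β γ T p q v) (x t : ℝ) :
    HasDerivAt (fun x => q x t * pdx p x t - p x t * pdx q x t)
      (q x t * pdx (pdx p) x t - p x t * pdx (pdx q) x t) x :=
  (((S.sq.hx x t).fun_mul (S.sp.pdx.hx x t)).fun_sub ((S.sp.hx x t).fun_mul (S.sq.pdx.hx x t))).congr_deriv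
    (by ring)

theorem Sol.x2n (S : Sol α β γ T p q v) {c d K : ℝ} (hc : 0 ≤ c) (hd' : d ≤ T)
    (hK : ∀ t ∈ Icc c d, H p q v t ≤ K) :
    ∃ L, ∀ t ∈ Icc c d, ∫ x in Ioi (0:ℝ), x ^ 2 * (p x t ^ 2 + q x t ^ 2) ≤ L := by
  have hcT : ∀ t ∈ Icc c d, t ∈ Icc 0 T := fun t ht => ⟨hc.trans ht.1, ht.2.trans hd'⟩
  have hri : ∀ t ∈ Icc c d, RD fun x => x ^ 2 * (p x t ^ 2 + q x t ^ 2) := fun t ht =>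
    ((S.rp t (hcT t ht)).sq.add (S.rq t (hcT t ht)).sq).x2mul
  refine ⟨Real.exp (2 * (d - c)) * ((∫ x in Ioi (0:ℝ), x ^ 2 * (p x c ^ 2 + q x c ^ 2))
    + 2 * K * (d - c)), fun t1 ht1 => ?_⟩
  have hcd : c ≤ d := ht1.1.trans ht1.2
  have hK0 : 0 ≤ K := (H_nn t1).trans (hK t1 ht1)
  have hlim := lin_tendsto (hri t1 ht1).int 2
  refine le_of_tendsto hlim ?_
  filter_upwards [eventually_ge_atTop 1] with R hR
  have hR0 : (0:ℝ) ≤ R := by linarith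
  have key := gron_fwd (f := fun t => ∫ x in (0:ℝ)..R, (x * (1 - x / R)) ^ 2 * (p x t ^ 2 + q x t ^ 2))
    (f' := fun t => ∫ x in (0:ℝ)..R, (x * (1 - x / R)) ^ 2 * pdt (fun x t => p x t ^ 2 + q x t ^ 2) x t)
    (a := c) (b := t1) (A := 2) (C := 2 * K) ht1.1 (by norm_num) (by positivity)
    (fun t _ => S.n_sm.hasDerivAt_int _ R hR0 (by fun_prop) t) ?_
  · have e : ∀ x : ℝ, (1 - x / R) ^ 2 * (x ^ 2 * (p x t1 ^ 2 + q x t1 ^ 2))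
      = (x * (1 - x / R)) ^ 2 * (p x t1 ^ 2 + q x t1 ^ 2) := fun x => by ring
    simp only [e]
    refine key.trans ?_
    have h0 : ∫ x in (0:ℝ)..R, (x * (1 - x / R)) ^ 2 * (p x c ^ 2 + q x c ^ 2)
        ≤ ∫ x in Ioi (0:ℝ), x ^ 2 * (p x c ^ 2 + q x c ^ 2) := by
      have c1 := S.sp.cx c; have c2 := S.sq.cx c
      refine trunc_le hR0 (Continuous.intervalIntegrable (by fun_prop) _ _)
        (hri c ⟨le_rfl, hcd⟩).int (fun x _ => by positivity) fun x hx => ?_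
      have h0 : 0 ≤ x / R := div_nonneg hx.1 (by linarith)
      have h1 : x / R ≤ 1 := div_le_one_of_le₀ hx.2 (by linarith)
      refine mul_le_mul_of_nonneg_right ?_ (by positivity)
      rw [mul_pow]
      exact mul_le_of_le_one_right (by positivity) (pow_le_one₀ (by linarith) (by linarith))
    have h1 : (0:ℝ) ≤ ∫ x in Ioi (0:ℝ), x ^ 2 * (p x c ^ 2 + q x c ^ 2) :=
      int_nn fun x _ => by positivity
    have h2 : 0 ≤ t1 - c := by linarith [ht1.1]
    have h3 : t1 - c ≤ d - c := by linarith [ht1.2]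
    have h4 : (0:ℝ) ≤ ∫ x in (0:ℝ)..R, (x * (1 - x / R)) ^ 2 * (p x c ^ 2 + q x c ^ 2) :=
      intervalIntegral.integral_nonneg hR0 fun x _ => by positivity
    have h5 : 0 ≤ 2 * K * (t1 - c) := by positivity
    gcongr
  · intro t ht
    have htc : t ∈ Icc c d := ⟨ht.1, ht.2.trans ht1.2⟩
    have htT := hcT t htc
    have c1 := S.sp.cx t; have c2 := S.sq.cx t
    have c3 := S.sp.pdx.cx t; have c4 := S.sq.pdx.cx t
    have c5 := S.sp.pdx.pdx.cx t; have c6 := S.sq.pdx.pdx.cx t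
    have c7 := S.n_sm.pdt.cx t
    have := slice_est (F := fun x => (x * (1 - x / R)) ^ 2 * (2 * (q x t * pdx p x t - p x t * pdx q x t)))
      (F' := fun x => 2 * (x * (1 - x / R)) * (1 - 2 * (x / R)) * (2 * (q x t * pdx p x t - p x t * pdx q x t))
        + (x * (1 - x / R)) ^ 2 * (2 * (q x t * pdx (pdx p) x t - p x t * pdx (pdx q) x t)))
      (f := fun x => (x * (1 - x / R)) ^ 2 * pdt (fun x t => p x t ^ 2 + q x t ^ 2) x t)
      (g := fun x => (x * (1 - x / R)) ^ 2 * (p x t ^ 2 + q x t ^ 2))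
      (B := fun x => 2 * hd p q v x t) (A := 2) hR0 ?_ (by fun_prop) (by fun_prop) (by fun_prop)
      ((S.rhd htT).int.const_mul 2) (fun x _ => by have := hd_nn (p := p) (q := q) (v := v) x t; positivity) ?_
    · rw [integral_const_mul] at this
      have hh := hK t htc
      unfold H at hh
      simp only [div_self (show R ≠ 0 by linarith), sub_self, mul_zero] at this
      norm_num at this
      linarith
    · intro x _
      have h1 : HasDerivAt (fun x : ℝ => (x * (1 - x / R)) ^ 2) (2 * (x * (1 - x / R)) * (1 - 2 * (x / R))) x := by
        have ha : HasDerivAt (fun x : ℝ => 1 - x / R) (-(1/R)) x := by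
          simpa using ((hasDerivAt_id x).div_const R).const_sub 1
        refine (((hasDerivAt_id' x).fun_mul ha).fun_pow 2).congr_deriv ?_
        simp; ring_nf; simp
      exact h1.fun_mul ((S.jx x t).const_mul 2)
    · intro x hx
      have h0 : 0 ≤ x / R := div_nonneg hx.1 (by linarith)
      have h1 : x / R ≤ 1 := div_le_one_of_le₀ hx.2 (by linarith)
      rw [S.nt hx.1 htT]
      set y := x * (1 - x / R) with hy
      set z := 1 - 2 * (x / R) with hz
      have hz2 : z ^ 2 ≤ 1 := by nlinarith
      have hb : hd p q v x t ≥ pdx p x t ^ 2 + pdx q x t ^ 2 := by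
        unfold hd; nlinarith [sq_nonneg (p x t), sq_nonneg (q x t), sq_nonneg (v x t), sq_nonneg (pdx v x t)]
      have hs : z ^ 2 * (pdx p x t ^ 2 + pdx q x t ^ 2) ≤ (pdx p x t ^ 2 + pdx q x t ^ 2) :=
        mul_le_of_le_one_left (by positivity) hz2
      nlinarith [sq_nonneg (y * q x t + z * pdx p x t), sq_nonneg (y * p x t - z * pdx q x t)]

/-- weighted sup bound for u -/
theorem Sol.xn_le (S : Sol α β γ T p q v) {t : ℝ} (ht : t ∈ Icc 0 T) {L : ℝ}
    (hL : ∫ x in Ioi (0:ℝ), x ^ 2 * (p x t ^ 2 + q x t ^ 2) ≤ L) {x : ℝ} (hx : 0 ≤ x) :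
    (1 + x) * (p x t ^ 2 + q x t ^ 2) ≤ 3 * H p q v t + 2 * L := by
  have c1 := (S.rp t ht).c; have c2 := (S.rq t ht).c
  have c3 := (S.rp1 t ht).c; have c4 := (S.rq1 t ht).c
  have hr : RD fun x => x ^ 2 * (p x t ^ 2 + q x t ^ 2) := ((S.rp t ht).sq.add (S.rq t ht).sq).x2mul
  have := ftc_le (F := fun x => (1 + x) * (p x t ^ 2 + q x t ^ 2))
    (F' := fun x => (p x t ^ 2 + q x t ^ 2) + (1 + x) * (2 * p x t * pdx p x t + 2 * q x t * pdx q x t))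
    (B := fun x => 3 * hd p q v x t + 2 * (x ^ 2 * (p x t ^ 2 + q x t ^ 2)))
    (fun x _ => (((hasDerivAt_id' x).const_add 1).fun_mul
      (((S.sp.hx x t).fun_pow 2).fun_add ((S.sq.hx x t).fun_pow 2))).congr_deriv (by
      simp)) (by fun_prop) (((S.rhd ht).cmul 3).add (hr.cmul 2)).int
    (fun x _ => by have := hd_nn (p := p) (q := q) (v := v) x t; positivity)
    (fun x _ => by
      unfold hd
      nlinarith [sq_nonneg ((1 + x) * p x t - pdx p x t), sq_nonneg ((1 + x) * q x t - pdx q x t),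
        sq_nonneg (v x t), sq_nonneg (pdx v x t), sq_nonneg ((1 - x) * p x t), sq_nonneg ((1 - x) * q x t),
        sq_nonneg (pdx p x t), sq_nonneg (pdx q x t)]) x hx
  rw [integral_add ((S.rhd ht).int.const_mul 3) (hr.int.const_mul 2), integral_const_mul,
    integral_const_mul] at this
  simp only [S.p0 t ht, S.q0 t ht] at this
  unfold H
  linarith

theorem Sol.xv_le (S : Sol α β γ T p q v) {t : ℝ} (ht : t ∈ Icc 0 T) {L : ℝ}
    (hL : ∫ x in Ioi (0:ℝ), x ^ 2 * v x t ^ 2 ≤ L) {x : ℝ} (hx : 0 ≤ x) :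
    (1 + x) * v x t ^ 2 ≤ 3 * H p q v t + 2 * L := by
  have c1 := (S.rv t ht).c; have c2 := (S.rv1 t ht).c
  have hr : RD fun x => x ^ 2 * v x t ^ 2 := (S.rv t ht).sq.x2mul
  have := ftc_le (F := fun x => (1 + x) * v x t ^ 2)
    (F' := fun x => v x t ^ 2 + (1 + x) * (2 * v x t * pdx v x t))
    (B := fun x => 3 * hd p q v x t + 2 * (x ^ 2 * v x t ^ 2))
    (fun x _ => (((hasDerivAt_id' x).const_add 1).fun_mul
      ((S.sv.hx x t).fun_pow 2)).congr_deriv (by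
      simp)) (by fun_prop) (((S.rhd ht).cmul 3).add (hr.cmul 2)).int
    (fun x _ => by have := hd_nn (p := p) (q := q) (v := v) x t; positivity)
    (fun x _ => by
      unfold hd
      nlinarith [sq_nonneg ((1 + x) * v x t - pdx v x t),
        sq_nonneg (p x t), sq_nonneg (q x t), sq_nonneg ((1 - x) * v x t),
        sq_nonneg (pdx p x t), sq_nonneg (pdx q x t), sq_nonneg (pdx v x t)]) x hx
  rw [integral_add ((S.rhd ht).int.const_mul 3) (hr.int.const_mul 2), integral_const_mul,
    integral_const_mul] at this
  simp only [S.v0 t ht] at this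
  unfold H
  linarith
end


theorem lin_flux {W W1 W2 Z Z1 Z2 : ℝ → ℝ} {x W3 Z3 : ℝ}
    (h0 : HasDerivAt W (W1 x) x) (h1 : HasDerivAt W1 (W2 x) x) (h2 : HasDerivAt W2 W3 x)
    (k0 : HasDerivAt Z (Z1 x) x) (k1 : HasDerivAt Z1 (Z2 x) x) (k2 : HasDerivAt Z2 Z3 x) :
    HasDerivAt (fun x => -2 * (W x * (Z x * Z2 x)) + W x * Z1 x ^ 2 + 2 * (W1 x * (Z x * Z1 x))
      - W2 x * Z x ^ 2) (-2 * W x * Z x * Z3 + 3 * W1 x * Z1 x ^ 2 - W3 * Z x ^ 2) x := by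
  refine ((((h0.fun_mul (k0.fun_mul k2)).const_mul (-2)).fun_add (h0.fun_mul (k1.fun_pow 2))).fun_add
    ((h1.fun_mul (k0.fun_mul k1)).const_mul 2)).fun_sub (h2.fun_mul (k0.fun_pow 2)) |>.congr_deriv ?_
  simp; ring

theorem sq_hasDeriv {f : ℝ → ℝ} {x f' : ℝ} (h : HasDerivAt f f' x) :
    HasDerivAt (fun x => f x ^ 2) (2 * f x * f') x := (h.fun_pow 2).congr_deriv (by simp)

theorem kdv_flux {W W1 W2 Z Z1 Z2 P Q : ℝ → ℝ} {x W3 Z3 P1 Q1 γ : ℝ}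
    (h0 : HasDerivAt W (W1 x) x) (h1 : HasDerivAt W1 (W2 x) x) (h2 : HasDerivAt W2 W3 x)
    (k0 : HasDerivAt Z (Z1 x) x) (k1 : HasDerivAt Z1 (Z2 x) x) (k2 : HasDerivAt Z2 Z3 x)
    (hP : HasDerivAt P P1 x) (hQ : HasDerivAt Q Q1 x) :
    HasDerivAt (fun x => (-2 * (W x * (Z x * Z2 x)) + W x * Z1 x ^ 2 + 2 * (W1 x * (Z x * Z1 x))
      - W2 x * Z x ^ 2) - (2/3) * (W x * Z x ^ 3) + 2 * γ * (W x * (Z x * (P x ^ 2 + Q x ^ 2))))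
      ((-2 * W x * Z x * Z3 + 3 * W1 x * Z1 x ^ 2 - W3 * Z x ^ 2)
          - (2/3) * (W1 x * Z x ^ 3 + W x * (3 * Z x ^ 2 * Z1 x))
          + 2 * γ * (W1 x * (Z x * (P x ^ 2 + Q x ^ 2)) + W x * (Z1 x * (P x ^ 2 + Q x ^ 2)
            + Z x * (2 * P x * P1 + 2 * Q x * Q1)))) x := by
  have hz3 : HasDerivAt (fun x => Z x ^ 3) (3 * Z x ^ 2 * Z1 x) x :=
    (k0.fun_pow 3).congr_deriv (by simp)
  exact ((lin_flux h0 h1 h2 k0 k1 k2).fun_sub ((h0.fun_mul hz3).const_mul (2/3))).fun_add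
    ((h0.fun_mul (k0.fun_mul ((sq_hasDeriv hP).fun_add (sq_hasDeriv hQ)))).const_mul (2 * γ))

theorem tau_hasDeriv (R x : ℝ) : HasDerivAt (fun x : ℝ => 1 - x / R) (-(1/R)) x := by
  simpa using ((hasDerivAt_id x).div_const R).const_sub 1

set_option maxHeartbeats 1000000 in
/-- pointwise inequality for the weighted KdV estimate -/
theorem ptc {τ y s x w e v v1 n g V K S : ℝ} (hτ0 : 0 ≤ τ) (hτ1 : τ ≤ 1) (hy0 : 0 ≤ y)
    (hs0 : 0 ≤ s) (hs1 : s ≤ 1) (hx : 0 ≤ x) (hyx : y = x * s) (hw0 : 0 ≤ w) (hw1 : w ≤ 1)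
    (he0 : 0 ≤ e) (he1 : e ≤ 1) (hey : e * y ≤ 1) (hwy : w * y ≤ 1) (hwy2 : w * y ^ 2 ≤ 1)
    (hV : |v| ≤ V) (hn0 : 0 ≤ n) (hnK : n ≤ K) (hS : x * n ≤ S) :
    -3 * (-3 * w * τ ^ 2 * y ^ 2 + 2 * τ ^ 3 * y * s ^ 2) * v1 ^ 2
    + (-6 * w ^ 3 * y ^ 2 + 36 * w ^ 2 * τ * y * s ^ 2 - 18 * w * τ ^ 2 * (s ^ 4 - 2 * e * y * s ^ 3)
       + 2 * τ ^ 3 * (-6 * e * s ^ 5 + 6 * e ^ 2 * y * s ^ 4)) * v ^ 2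
    + (2/3) * (-3 * w * τ ^ 2 * y ^ 2 + 2 * τ ^ 3 * y * s ^ 2) * v ^ 3
    - 2 * g * ((-3 * w * τ ^ 2 * y ^ 2 + 2 * τ ^ 3 * y * s ^ 2) * v + τ ^ 3 * y ^ 2 * v1) * n
    ≤ (V + |g|) * (τ ^ 3 * y ^ 2 * v ^ 2)
      + (9 * v1 ^ 2 + (120 + 4 * V + 4 * |g|) * v ^ 2 + 4 * |g| * K * n + (|g| * K + g ^ 2 * S) * (x ^ 2 * n)) := by
  have hV0 : 0 ≤ V := (abs_nonneg _).trans hV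
  have hK0 : 0 ≤ K := hn0.trans hnK
  have hg0 : 0 ≤ |g| := abs_nonneg g
  have t2 : τ ^ 2 ≤ 1 := pow_le_one₀ hτ0 hτ1
  have t3 : τ ^ 3 ≤ 1 := pow_le_one₀ hτ0 hτ1
  have s2 : s ^ 2 ≤ 1 := pow_le_one₀ hs0 hs1
  have s3 : s ^ 3 ≤ 1 := pow_le_one₀ hs0 hs1
  have s4 : s ^ 4 ≤ 1 := pow_le_one₀ hs0 hs1
  have s5 : s ^ 5 ≤ 1 := pow_le_one₀ hs0 hs1
  have w2 : w ^ 2 ≤ 1 := pow_le_one₀ hw0 hw1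
  have hyx' : y ≤ x := by rw [hyx]; exact mul_le_of_le_one_right hx hs1
  set W := τ ^ 3 * y ^ 2 with hW
  have hW0 : 0 ≤ W := by positivity
  have hWx : W ≤ x ^ 2 := by
    calc W ≤ 1 * x ^ 2 := by rw [hW]; gcongr
      _ = x ^ 2 := one_mul _
  set W1 := -3 * w * τ ^ 2 * y ^ 2 + 2 * τ ^ 3 * y * s ^ 2 with hW1
  have a1 : w * τ ^ 2 * y ^ 2 ≤ 1 := by
    calc w * τ ^ 2 * y ^ 2 = τ ^ 2 * (w * y ^ 2) := by ring
      _ ≤ 1 * 1 := by gcongr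
      _ = 1 := by norm_num
  have a1' : 0 ≤ w * τ ^ 2 * y ^ 2 := by positivity
  have a2 : 2 * τ ^ 3 * y * s ^ 2 ≤ W + 1 := by
    have b1 : 2 * τ ^ 3 * y * s ^ 2 ≤ 2 * τ ^ 3 * y * 1 := by gcongr
    have b2 : 0 ≤ τ ^ 3 * (y - 1) ^ 2 := by positivity
    nlinarith
  have a2' : 0 ≤ 2 * τ ^ 3 * y * s ^ 2 := by positivity
  have aW1 : |W1| ≤ 4 + W := by rw [abs_le]; constructor <;> linarith
  have T1 : -3 * W1 * v1 ^ 2 ≤ 9 * v1 ^ 2 - 6 * (τ ^ 3 * y * s ^ 2) * v1 ^ 2 := by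
    have := mul_le_mul_of_nonneg_right a1 (sq_nonneg v1)
    rw [hW1]; linarith
  have T2 : (-6 * w ^ 3 * y ^ 2 + 36 * w ^ 2 * τ * y * s ^ 2 - 18 * w * τ ^ 2 * (s ^ 4 - 2 * e * y * s ^ 3)
       + 2 * τ ^ 3 * (-6 * e * s ^ 5 + 6 * e ^ 2 * y * s ^ 4)) * v ^ 2 ≤ 120 * v ^ 2 := by
    refine mul_le_mul_of_nonneg_right ?_ (sq_nonneg v)
    have b1 : 0 ≤ w ^ 3 * y ^ 2 := by positivity
    have b2 : w ^ 2 * τ * y * s ^ 2 ≤ 1 := by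
      calc w ^ 2 * τ * y * s ^ 2 = (w * y) * (w * τ * s ^ 2) := by ring
        _ ≤ 1 * (1 * 1 * 1) := by gcongr
        _ = 1 := by norm_num
    have b3 : 0 ≤ w * τ ^ 2 * s ^ 4 := by positivity
    have b4 : w * τ ^ 2 * (e * y) * s ^ 3 ≤ 1 := by
      calc w * τ ^ 2 * (e * y) * s ^ 3 ≤ 1 * 1 * 1 * 1 := by gcongr
        _ = 1 := by norm_num
    have b5 : 0 ≤ τ ^ 3 * e * s ^ 5 := by positivity
    have b6 : τ ^ 3 * (e * y) * e * s ^ 4 ≤ 1 := by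
      calc τ ^ 3 * (e * y) * e * s ^ 4 ≤ 1 * 1 * 1 * 1 := by gcongr
        _ = 1 := by norm_num
    linarith
  have T3 : (2/3) * W1 * v ^ 3 ≤ V * (4 + W) * v ^ 2 := by
    have b : W1 * v ≤ (4 + W) * V := by
      calc W1 * v ≤ |W1 * v| := le_abs_self _
        _ = |W1| * |v| := abs_mul _ _
        _ ≤ (4 + W) * V := by gcongr
    have b' : 0 ≤ (4 + W) * V := by positivity
    have := mul_le_mul_of_nonneg_right (show (2/3) * (W1 * v) ≤ V * (4 + W) by nlinarith) (sq_nonneg v)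
    linarith
  have T4 : -2 * g * (W1 * v) * n ≤ |g| * (4 + W) * v ^ 2 + 4 * |g| * K * n + |g| * K * (x ^ 2 * n) := by
    have b : -2 * g * (W1 * v) * n ≤ |g| * (4 + W) * (2 * (|v| * n)) := by
      calc -2 * g * (W1 * v) * n ≤ |-2 * g * (W1 * v) * n| := le_abs_self _
        _ = |g| * |W1| * (2 * (|v| * n)) := by
          simp only [abs_mul, abs_of_nonneg hn0]; norm_num; ring
        _ ≤ |g| * (4 + W) * (2 * (|v| * n)) := by gcongr
    have b2 : 2 * (|v| * n) ≤ v ^ 2 + n * K := by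
      have : v ^ 2 = |v| ^ 2 := (sq_abs v).symm
      rw [this]; nlinarith [sq_nonneg (|v| - n)]
    have b3 : |g| * (4 + W) * (2 * (|v| * n)) ≤ |g| * (4 + W) * (v ^ 2 + n * K) := by gcongr
    have b4 : |g| * W * (n * K) ≤ |g| * x ^ 2 * (n * K) := by gcongr
    linarith
  have T5 : -2 * g * (W * v1) * n ≤ 6 * (τ ^ 3 * y * s ^ 2) * v1 ^ 2 + g ^ 2 * S * (x ^ 2 * n) := by
    have b1 : -2 * g * (W * v1) * n = τ ^ 3 * (x * s) * (-2 * (s * v1) * (g * x * n)) := by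
      rw [hW, hyx]; ring
    have b2 : -2 * (s * v1) * (g * x * n) ≤ (s * v1) ^ 2 + (g * x * n) ^ 2 := by
      nlinarith [sq_nonneg (s * v1 + g * x * n)]
    have b3 : τ ^ 3 * (x * s) * (-2 * (s * v1) * (g * x * n)) ≤ τ ^ 3 * (x * s) * ((s * v1) ^ 2 + (g * x * n) ^ 2) := by
      gcongr
    have b4 : τ ^ 3 * (x * s) * (g * x * n) ^ 2 ≤ 1 * (x * 1) * (g * x * n) ^ 2 := by gcongr
    have b5 : 1 * (x * 1) * (g * x * n) ^ 2 = g ^ 2 * (x * n) * (x ^ 2 * n) := by ring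
    have b6 : g ^ 2 * (x * n) * (x ^ 2 * n) ≤ g ^ 2 * S * (x ^ 2 * n) := by gcongr
    have b7 : 0 ≤ τ ^ 3 * (x * s) * s ^ 2 * v1 ^ 2 := by positivity
    rw [b1, hyx]
    linarith
  linarith

section
variable {α β γ T : ℝ} {p q v : ℝ → ℝ → ℝ}

set_option maxHeartbeats 2000000 in
theorem Sol.x2v (S : Sol α β γ T p q v) {c d K : ℝ} (hc : 0 ≤ c) (hd' : d ≤ T)
    (hK : ∀ t ∈ Icc c d, H p q v t ≤ K) :
    ∃ L, ∀ t ∈ Icc c d, ∫ x in Ioi (0:ℝ), x ^ 2 * v x t ^ 2 ≤ L := by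
  obtain ⟨L0, hL0⟩ := S.x2n hc hd' hK
  have hcT : ∀ t ∈ Icc c d, t ∈ Icc 0 T := fun t ht => ⟨hc.trans ht.1, ht.2.trans hd'⟩
  have hri : ∀ t ∈ Icc c d, RD fun x => x ^ 2 * v x t ^ 2 := fun t ht =>
    (S.rv t (hcT t ht)).sq.x2mul
  have hrn : ∀ t ∈ Icc c d, RD fun x => x ^ 2 * (p x t ^ 2 + q x t ^ 2) := fun t ht =>
    ((S.rp t (hcT t ht)).sq.add (S.rq t (hcT t ht)).sq).x2mul
  set S0 := 3 * K + 2 * L0 with hS0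
  set C1 := 129 + 4 * (K + 1) + 4 * |γ| + 4 * |γ| * K with hC1
  set C2 := |γ| * K + γ ^ 2 * S0 with hC2
  set C := C1 * K + C2 * L0 with hC
  refine ⟨Real.exp (((K + 1) + |γ|) * (d - c)) * ((∫ x in Ioi (0:ℝ), x ^ 2 * v x c ^ 2)
    + C * (d - c)), fun t1 ht1 => ?_⟩
  have hcd : c ≤ d := ht1.1.trans ht1.2
  have hK0 : 0 ≤ K := (H_nn t1).trans (hK t1 ht1)
  have hL00 : 0 ≤ L0 := (int_nn fun x _ => by positivity).trans (hL0 t1 ht1)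
  have hS00 : 0 ≤ S0 := by positivity
  have hC10 : 0 ≤ C1 := by positivity
  have hC20 : 0 ≤ C2 := by positivity
  have hC0 : 0 ≤ C := by positivity
  have hlim := wt_tendsto (hri t1 ht1).int (fun R x => (1 - x / R) ^ 3 * ((1 + x / √R)⁻¹) ^ 2) 1 1
    (fun R => by fun_prop) ?_ ?_
  rotate_left
  · intro R hR x hx
    have h0 : 0 ≤ x / R := div_nonneg hx.1 (by linarith)
    have h1 : x / R ≤ 1 := div_le_one_of_le₀ hx.2 (by linarith)
    have h2 : 0 ≤ x / √R := div_nonneg hx.1 (Real.sqrt_nonneg _)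
    have h3 : (1 + x / √R)⁻¹ ≤ 1 := inv_le_one_of_one_le₀ (by linarith)
    have h4 : 0 ≤ (1 + x / √R)⁻¹ := by positivity
    have h5 : 0 ≤ 1 - x / R := by linarith
    rw [abs_of_nonneg (by positivity)]
    exact mul_le_one₀ (pow_le_one₀ h5 (by linarith)) (by positivity) (pow_le_one₀ h4 h3)
  · intro x _
    have h1 : Tendsto (fun R : ℝ => x / R) atTop (𝓝 0) := tendsto_const_nhds.div_atTop tendsto_id
    have h2 : Tendsto (fun R : ℝ => x / √R) atTop (𝓝 0) :=
      tendsto_const_nhds.div_atTop Real.tendsto_sqrt_atTop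
    have h3 := ((h1.const_sub 1).pow 3).mul (((h2.const_add 1).inv₀ (by norm_num)).pow 2)
    simpa using h3
  rw [one_mul] at hlim
  refine le_of_tendsto hlim ?_
  filter_upwards [eventually_ge_atTop 1] with R hR
  have hR0 : (0:ℝ) ≤ R := by linarith
  set r := √R with hr
  have hr1 : 1 ≤ r := by rw [hr]; exact Real.one_le_sqrt.2 hR
  have hrr : r * r = R := Real.mul_self_sqrt hR0
  set s : ℝ → ℝ := fun x => (1 + x / r)⁻¹ with hs
  set τ : ℝ → ℝ := fun x => 1 - x / R with hτ
  have hsd : ∀ x, 0 ≤ x → HasDerivAt s (-(1/r) * s x ^ 2) x := by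
    intro x hx
    have h : HasDerivAt (fun y : ℝ => 1 + y / r) (1/r) x := by
      simpa using ((hasDerivAt_id x).div_const r).const_add 1
    have hx' : 0 ≤ x / r := by positivity
    refine (h.fun_inv (by positivity)).congr_deriv ?_
    simp only [hs]; field_simp
  have hsx : ∀ x, 0 ≤ x → s x + (1/r) * (x * s x) = 1 := by
    intro x hx
    have hx' : 0 ≤ x / r := by positivity
    simp only [hs]; field_simp
  have hyd : ∀ x, 0 ≤ x → HasDerivAt (fun x => x * s x) (s x ^ 2) x := by
    intro x hx
    refine ((hasDerivAt_id' x).fun_mul (hsd x hx)).congr_deriv ?_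
    have := hsx x hx
    linear_combination (-s x) * this
  have hsc : ContinuousOn s (Icc 0 R) := fun x hx => (hsd x hx.1).continuousAt.continuousWithinAt
  have hτd : ∀ x, HasDerivAt τ (-(1/R)) x := fun x => tau_hasDeriv R x
  have hτc : ContinuousOn τ (Icc 0 R) := by simp only [hτ]; fun_prop
  set W : ℝ → ℝ := fun x => τ x ^ 3 * (x * s x) ^ 2 with hW
  set W1 : ℝ → ℝ := fun x => -3 * (1/R) * τ x ^ 2 * (x * s x) ^ 2 + 2 * τ x ^ 3 * (x * s x) * s x ^ 2 with hW1
  set W2 : ℝ → ℝ := fun x => 6 * (1/R) ^ 2 * τ x * (x * s x) ^ 2 - 12 * (1/R) * τ x ^ 2 * (x * s x) * s x ^ 2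
    + 2 * τ x ^ 3 * (s x ^ 4 - 2 * (1/r) * (x * s x) * s x ^ 3) with hW2
  set W3 : ℝ → ℝ := fun x => -6 * (1/R) ^ 3 * (x * s x) ^ 2 + 36 * (1/R) ^ 2 * τ x * (x * s x) * s x ^ 2
    - 18 * (1/R) * τ x ^ 2 * (s x ^ 4 - 2 * (1/r) * (x * s x) * s x ^ 3)
       + 2 * τ x ^ 3 * (-6 * (1/r) * s x ^ 5 + 6 * (1/r) ^ 2 * (x * s x) * s x ^ 4) with hW3
  have hWd : ∀ x, 0 ≤ x → HasDerivAt W (W1 x) x := by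
    intro x hx
    refine (((hτd x).fun_pow 3).fun_mul ((hyd x hx).fun_pow 2)).congr_deriv ?_
    simp [hW1]; ring
  have hW1d : ∀ x, 0 ≤ x → HasDerivAt W1 (W2 x) x := by
    intro x hx
    refine (((((hτd x).fun_pow 2).const_mul (-3 * (1/R))).fun_mul ((hyd x hx).fun_pow 2)).fun_add
      (((((hτd x).fun_pow 3).const_mul 2).fun_mul (hyd x hx)).fun_mul ((hsd x hx).fun_pow 2))).congr_deriv ?_
    simp [hW2]; ring
  have hW2d : ∀ x, 0 ≤ x → HasDerivAt W2 (W3 x) x := by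
    intro x hx
    refine ((((hτd x).const_mul (6 * (1/R) ^ 2)).fun_mul ((hyd x hx).fun_pow 2)).fun_sub
      (((((hτd x).fun_pow 2).const_mul (12 * (1/R))).fun_mul (hyd x hx)).fun_mul ((hsd x hx).fun_pow 2))
      |>.fun_add ((((hτd x).fun_pow 3).const_mul 2).fun_mul (((hsd x hx).fun_pow 4).fun_sub
        (((hyd x hx).const_mul (2 * (1/r))).fun_mul ((hsd x hx).fun_pow 3))))).congr_deriv ?_
    simp [hW3]; ring
  have key := gron_fwd (f := fun t => ∫ x in (0:ℝ)..R, W x * v x t ^ 2)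
    (f' := fun t => ∫ x in (0:ℝ)..R, W x * pdt (fun x t => v x t ^ 2) x t)
    (a := c) (b := t1) (A := (K + 1) + |γ|) (C := C) ht1.1 (by positivity) hC0
    (fun t _ => (S.sv.pow 2).hasDerivAt_int _ R hR0 (by fun_prop) t) ?_
  · have e : ∀ x : ℝ, (1 - x / R) ^ 3 * ((1 + x / r)⁻¹) ^ 2 * (x ^ 2 * v x t1 ^ 2)
      = W x * v x t1 ^ 2 := fun x => by simp only [hW, hτ, hs]; ring
    simp only [e]
    refine key.trans ?_
    have hWle : ∀ x ∈ Icc 0 R, 0 ≤ W x ∧ W x ≤ x ^ 2 := by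
      intro x hx
      have h0 : 0 ≤ x / R := div_nonneg hx.1 (by linarith)
      have h1 : x / R ≤ 1 := div_le_one_of_le₀ hx.2 (by linarith)
      have hx' : 0 ≤ x / r := div_nonneg hx.1 (by linarith)
      have h2 : 0 ≤ τ x := by simp only [hτ]; linarith
      have h3 : τ x ≤ 1 := by simp only [hτ]; linarith
      have h4 : s x ≤ 1 := inv_le_one_of_one_le₀ (by linarith)
      have h5 : 0 ≤ s x := by simp only [hs]; positivity
      refine ⟨by simp only [hW]; positivity, ?_⟩
      have hx0 := hx.1
      calc W x ≤ 1 * (x * 1) ^ 2 := by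
            simp only [hW]; gcongr; exact pow_le_one₀ h2 h3
        _ = x ^ 2 := by ring
    have h0 : ∫ x in (0:ℝ)..R, W x * v x c ^ 2
        ≤ ∫ x in Ioi (0:ℝ), x ^ 2 * v x c ^ 2 := by
      have c1 := (S.sv.cx c).continuousOn (s := Icc 0 R)
      refine trunc_le hR0 (ContinuousOn.intervalIntegrable (by rw [uIcc_of_le hR0]; fun_prop))
        (hri c ⟨le_rfl, hcd⟩).int (fun x _ => by positivity) fun x hx => ?_
      exact mul_le_mul_of_nonneg_right (hWle x hx).2 (by positivity)
    have h1 : (0:ℝ) ≤ ∫ x in Ioi (0:ℝ), x ^ 2 * v x c ^ 2 :=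
      int_nn fun x _ => by positivity
    have h2 : 0 ≤ t1 - c := by linarith [ht1.1]
    have h3 : t1 - c ≤ d - c := by linarith [ht1.2]
    have h4 : (0:ℝ) ≤ ∫ x in (0:ℝ)..R, W x * v x c ^ 2 :=
      intervalIntegral.integral_nonneg hR0 fun x hx => mul_nonneg (hWle x hx).1 (by positivity)
    have h5 : 0 ≤ C * (t1 - c) := by positivity
    gcongr
  · intro t ht
    have htc : t ∈ Icc c d := ⟨ht.1, ht.2.trans ht1.2⟩
    have htT := hcT t htc
    have c1 := S.sp.cx t; have c2 := S.sq.cx t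
    have c3 := S.sp.pdx.cx t; have c4 := S.sq.pdx.cx t
    have c5 := S.sv.cx t; have c6 := S.sv.pdx.cx t
    have c7 := S.sv.pdx.pdx.cx t; have c8 := S.sv.pdx.pdx.pdx.cx t
    have c9 := (S.sv.pow 2).pdt.cx t
    have c10 := (S.rhd htT).c
    have := slice_est (F := fun x => (-2 * (W x * (v x t * pdx (pdx v) x t)) + W x * pdx v x t ^ 2
          + 2 * (W1 x * (v x t * pdx v x t)) - W2 x * v x t ^ 2)
          - (2/3) * (W x * v x t ^ 3) + 2 * γ * (W x * (v x t * (p x t ^ 2 + q x t ^ 2))))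
      (F' := fun x => (-2 * W x * v x t * pdx (pdx (pdx v)) x t + 3 * W1 x * pdx v x t ^ 2 - W3 x * v x t ^ 2)
          - (2/3) * (W1 x * v x t ^ 3 + W x * (3 * v x t ^ 2 * pdx v x t))
          + 2 * γ * (W1 x * (v x t * (p x t ^ 2 + q x t ^ 2)) + W x * (pdx v x t * (p x t ^ 2 + q x t ^ 2)
            + v x t * (2 * p x t * pdx p x t + 2 * q x t * pdx q x t))))
      (f := fun x => W x * pdt (fun x t => v x t ^ 2) x t)
      (g := fun x => W x * v x t ^ 2)
      (B := fun x => C1 * hd p q v x t + C2 * (x ^ 2 * (p x t ^ 2 + q x t ^ 2))) (A := (K + 1) + |γ|) hR0 ?_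
      (by fun_prop) (by fun_prop) (by fun_prop)
      (((S.rhd htT).cmul C1).add ((hrn t htc).cmul C2)).int
      (fun x _ => by have := hd_nn (p := p) (q := q) (v := v) x t; positivity) ?_
    · rw [integral_add ((S.rhd htT).cmul C1).int ((hrn t htc).cmul C2).int, integral_const_mul,
        integral_const_mul] at this
      have hh := mul_le_mul_of_nonneg_left (hK t htc) hC10
      have hh2 := mul_le_mul_of_nonneg_left (hL0 t htc) hC20
      unfold H at hh
      have hτR : τ R = 0 := by simp only [hτ]; rw [div_self (by linarith)]; norm_num
      have z1 : W R = 0 := by simp only [hW, hτR]; ring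
      have z2 : W1 R = 0 := by simp only [hW1, hτR]; ring
      have z3 : W2 R = 0 := by simp only [hW2, hτR]; ring
      have z4 : W 0 = 0 := by simp only [hW]; ring
      simp only [z1, z2, z3, z4, S.v0 t htT] at this
      simp only [hC]
      linarith
    · intro x hx
      exact kdv_flux (hWd x hx.1) (hW1d x hx.1) (hW2d x hx.1) (S.sv.hx x t) (S.sv.pdx.hx x t)
        (S.sv.pdx.pdx.hx x t) (S.sp.hx x t) (S.sq.hx x t)
    · intro x hx
      have h0 : 0 ≤ x / R := div_nonneg hx.1 (by linarith)
      have h1 : x / R ≤ 1 := div_le_one_of_le₀ hx.2 (by linarith)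
      have hx' : 0 ≤ x / r := div_nonneg hx.1 (by linarith)
      have h2 : 0 ≤ τ x := by simp only [hτ]; linarith
      have h3 : τ x ≤ 1 := by simp only [hτ]; linarith
      have h4 : s x ≤ 1 := inv_le_one_of_one_le₀ (by linarith)
      have h5 : 0 ≤ s x := by simp only [hs]; positivity
      have hx0 := hx.1
      have hvt : pdt (fun x t => v x t ^ 2) x t = 2 * v x t * pdt v x t := by
        have h := ((S.sv.ht x t).fun_pow 2).deriv
        simpa [pdt] using h
      rw [hvt, S.ev x t hx0 htT]
      have hw1 : 1 / R ≤ 1 := by rw [div_le_one (by linarith)]; exact hR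
      have he1 : 1 / r ≤ 1 := by rw [div_le_one (by linarith)]; exact hr1
      have hey : 1 / r * (x * s x) ≤ 1 := by linarith [hsx x hx0]
      have hy0 : 0 ≤ x * s x := by positivity
      have hRr : 1 / R = (1 / r) * (1 / r) := by rw [← hrr]; field_simp
      have he0 : 0 ≤ 1 / r := by positivity
      have hwy : 1 / R * (x * s x) ≤ 1 := by
        rw [hRr]
        calc 1 / r * (1 / r) * (x * s x) = 1 / r * (1 / r * (x * s x)) := by ring
          _ ≤ 1 * 1 := by gcongr
          _ = 1 := one_mul _
      have hwy2 : 1 / R * (x * s x) ^ 2 ≤ 1 := by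
        rw [hRr]
        calc 1 / r * (1 / r) * (x * s x) ^ 2 = (1 / r * (x * s x)) ^ 2 := by ring
          _ ≤ 1 := pow_le_one₀ (by positivity) hey
      have hvV : |v x t| ≤ K + 1 := by
        have h6 := (S.v_le htT hx0).trans (hK t htc)
        exact abs_le_of_sq_le_sq (by nlinarith) (by positivity)
      have hnK := (S.n_le htT hx0).trans (hK t htc)
      have hnS : x * (p x t ^ 2 + q x t ^ 2) ≤ S0 := by
        have h6 := S.xn_le htT (hL0 t htc) hx0
        have h7 := hK t htc
        have h8 : 0 ≤ p x t ^ 2 + q x t ^ 2 := by positivity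
        nlinarith
      have hp := ptc (τ := τ x) (y := x * s x) (s := s x) (x := x) (w := 1 / R) (e := 1 / r) (v := v x t)
        (v1 := pdx v x t) (n := p x t ^ 2 + q x t ^ 2) (g := γ) (V := K + 1) (K := K) (S := S0)
        h2 h3 hy0 h5 h4 hx0 rfl (by positivity) hw1 he0 he1 hey hwy hwy2 hvV (by positivity) hnK hnS
      have hB : 9 * pdx v x t ^ 2 + (120 + 4 * (K + 1) + 4 * |γ|) * v x t ^ 2
          + 4 * |γ| * K * (p x t ^ 2 + q x t ^ 2) ≤ C1 * hd p q v x t := by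
        have g0 := abs_nonneg γ
        have k1 : 0 ≤ 4 * |γ| * K := by positivity
        have k2 : 9 * pdx v x t ^ 2 ≤ C1 * pdx v x t ^ 2 := by gcongr; simp only [hC1]; linarith
        have k3 : (120 + 4 * (K + 1) + 4 * |γ|) * v x t ^ 2 ≤ C1 * v x t ^ 2 := by
          gcongr; simp only [hC1]; linarith
        have k4 : 4 * |γ| * K * (p x t ^ 2 + q x t ^ 2) ≤ C1 * (p x t ^ 2 + q x t ^ 2) := by
          gcongr; simp only [hC1]; linarith
        have k5 : 0 ≤ C1 * (pdx p x t ^ 2 + pdx q x t ^ 2) := by positivity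
        unfold hd
        linarith
      have hp' : -3 * W1 x * pdx v x t ^ 2 + W3 x * v x t ^ 2 + (2/3) * W1 x * v x t ^ 3
          - 2 * γ * (W1 x * v x t + W x * pdx v x t) * (p x t ^ 2 + q x t ^ 2)
          ≤ (K + 1 + |γ|) * (W x * v x t ^ 2) + (9 * pdx v x t ^ 2
            + (120 + 4 * (K + 1) + 4 * |γ|) * v x t ^ 2 + 4 * |γ| * K * (p x t ^ 2 + q x t ^ 2)
            + C2 * (x ^ 2 * (p x t ^ 2 + q x t ^ 2))) := hp
      clear hp hC1 hC2 hS0 hlim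
      clear_value C1 C2 S0 W W1 W2 W3
      generalize pdx (pdx (pdx v)) x t = v3 at *
      generalize pdx v x t = v1 at *
      linarith
end


/-- Gronwall constant -/
def cD (α β γ S : ℝ) : ℝ :=
  |α| * (1 + S) + 5 * |β| * S + 6 + 2 * (1 + S) + S + |γ| * (1 + 4 * S) + 4 * S * γ ^ 2
def cE (γ S : ℝ) : ℝ := 45 + 6 * (1 + S) + |γ| * (3 + 12 * S)

theorem two_mul_abs_le {a b c d : ℝ} (hc : 0 ≤ c) (hd : 0 ≤ d) (h : (a * b) ^ 2 ≤ c * d) :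
    2 * |a * b| ≤ c + d := by
  have h1 : (2 * |a * b|) ^ 2 ≤ (c + d) ^ 2 := by
    rw [mul_pow, sq_abs]; nlinarith [sq_nonneg (c - d)]
  exact (le_abs_self _).trans (abs_le_of_sq_le_sq h1 (by positivity))

set_option maxHeartbeats 1000000 in
theorem ptd {α β γ τ w ψ P Q P1 Q1 Z Z1 b δ X r1 r2 s S l μ : ℝ}
    (hτ0 : 0 ≤ τ) (hτ1 : τ ≤ 1) (hw0 : 0 ≤ w) (hw1 : w ≤ 1) (hψ0 : 0 ≤ ψ) (hψ1 : ψ ≤ 1)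
    (hS : 0 ≤ S) (hl : 0 ≤ l) (hμ : 0 ≤ μ) (hlμ : l * μ = 1)
    (hb : b ^ 2 ≤ S * ψ) (hδ : δ ^ 2 ≤ 4 * S * (P ^ 2 + Q ^ 2)) (hX : X ^ 2 ≤ S * ψ * (P ^ 2 + Q ^ 2)) :
    2 * (-3 * w * τ ^ 2) * (Q * P1 - P * Q1) - 2 * τ ^ 3 * ((α * Z + β * δ) * X)
    - 2 * τ ^ 3 * (P * r1 + Q * r2) + 3 * (-3 * w * τ ^ 2 * ψ - τ ^ 3 * ψ ^ 2) * Z1 ^ 2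
    - (-6 * w ^ 3 * ψ - 18 * w ^ 2 * τ * ψ ^ 2 - 18 * w * τ ^ 2 * ψ ^ 3 - 6 * τ ^ 3 * ψ ^ 4) * Z ^ 2
    - 2 * (-3 * w * τ ^ 2 * ψ - τ ^ 3 * ψ ^ 2) * b * Z ^ 2
    - 2 * (τ ^ 3 * ψ) * b * Z * Z1
    + 2 * γ * ((-3 * w * τ ^ 2 * ψ - τ ^ 3 * ψ ^ 2) * Z + τ ^ 3 * ψ * Z1) * δ
    - 2 * (τ ^ 3 * ψ) * Z * s
    ≤ (l + cD α β γ S) * (τ ^ 3 * (P ^ 2 + Q ^ 2) + τ ^ 3 * ψ * Z ^ 2)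
      + (μ * (r1 ^ 2 + r2 ^ 2 + ψ * s ^ 2) + w * cE γ S * (P ^ 2 + Q ^ 2 + P1 ^ 2 + Q1 ^ 2 + Z ^ 2)) := by
  have t2 : τ ^ 2 ≤ 1 := pow_le_one₀ hτ0 hτ1
  have t3 : τ ^ 3 ≤ 1 := pow_le_one₀ hτ0 hτ1
  have t30 : 0 ≤ τ ^ 3 := by positivity
  have q2 : ψ ^ 2 ≤ ψ := by nlinarith
  have q2' : ψ ^ 2 ≤ 1 := pow_le_one₀ hψ0 hψ1
  have q3 : ψ ^ 3 ≤ 1 := pow_le_one₀ hψ0 hψ1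
  have q4 : ψ ^ 4 ≤ ψ := by nlinarith [sq_nonneg ψ]
  have w2 : w ^ 2 ≤ w := by nlinarith
  have w3 : w ^ 3 ≤ w := by nlinarith
  set N := P ^ 2 + Q ^ 2 with hN
  have hN0 : 0 ≤ N := by positivity
  set W := τ ^ 3 * ψ with hW
  have hW0 : 0 ≤ W := by positivity
  have hA := abs_nonneg α
  have hB := abs_nonneg β
  have hG := abs_nonneg γ
  have wt : w * τ ^ 2 ≤ w := mul_le_of_le_one_right hw0 t2
  have wt0 : 0 ≤ w * τ ^ 2 := by positivity
  have Ta : 2 * (-3 * w * τ ^ 2) * (Q * P1 - P * Q1) ≤ 3 * w * (N + P1 ^ 2 + Q1 ^ 2) := by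
    have e : -2 * (Q * P1 - P * Q1) ≤ N + P1 ^ 2 + Q1 ^ 2 := by
      nlinarith [sq_nonneg (Q + P1), sq_nonneg (P - Q1)]
    have h1 := mul_le_mul_of_nonneg_left e wt0
    have h2 := mul_le_mul_of_nonneg_right wt (show 0 ≤ N + P1 ^ 2 + Q1 ^ 2 by positivity)
    linarith
  have Tb1 : 2 * |Z * X| ≤ ψ * Z ^ 2 + S * N := by
    refine two_mul_abs_le (by positivity) (by positivity) ?_
    calc (Z * X) ^ 2 = Z ^ 2 * X ^ 2 := by ring
      _ ≤ Z ^ 2 * (S * ψ * N) := by gcongr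
      _ = ψ * Z ^ 2 * (S * N) := by ring
  have hX' : X ^ 2 ≤ S * N := hX.trans (by
    have : 0 ≤ S * N := by positivity
    nlinarith)
  have Tb2 : 2 * |δ * X| ≤ 4 * S * N + S * N := by
    refine two_mul_abs_le (by positivity) (by positivity) ?_
    rw [mul_pow]; gcongr
  have Tb : - 2 * τ ^ 3 * ((α * Z + β * δ) * X)
      ≤ |α| * (W * Z ^ 2 + S * (τ ^ 3 * N)) + |β| * (5 * S * (τ ^ 3 * N)) := by
    have h1 : -2 * (α * (Z * X)) ≤ |α| * (ψ * Z ^ 2 + S * N) := by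
      calc -2 * (α * (Z * X)) ≤ |-2 * (α * (Z * X))| := le_abs_self _
        _ = |α| * (2 * |Z * X|) := by rw [abs_mul, abs_mul]; norm_num; ring
        _ ≤ _ := by gcongr
    have h2 : -2 * (β * (δ * X)) ≤ |β| * (4 * S * N + S * N) := by
      calc -2 * (β * (δ * X)) ≤ |-2 * (β * (δ * X))| := le_abs_self _
        _ = |β| * (2 * |δ * X|) := by rw [abs_mul, abs_mul]; norm_num; ring
        _ ≤ _ := by gcongr
    have h3 := mul_le_mul_of_nonneg_left (add_le_add h1 h2) t30
    rw [hW]; linarith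
  have Tc : - 2 * τ ^ 3 * (P * r1 + Q * r2) ≤ l * (τ ^ 3 * N) + μ * (r1 ^ 2 + r2 ^ 2) := by
    have h1 : -2 * (P * r1 + Q * r2) ≤ l * N + μ * (r1 ^ 2 + r2 ^ 2) := by
      have k1 : 0 ≤ l * (P + μ * r1) ^ 2 + l * (Q + μ * r2) ^ 2 := by positivity
      have k2 : l * (P + μ * r1) ^ 2 + l * (Q + μ * r2) ^ 2
        = l * N + 2 * (l * μ) * (P * r1 + Q * r2) + (l * μ) * μ * (r1 ^ 2 + r2 ^ 2) := by rw [hN]; ring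
      rw [k2, hlμ] at k1; linarith
    have h2 := mul_le_mul_of_nonneg_left h1 t30
    have h3 : τ ^ 3 * (μ * (r1 ^ 2 + r2 ^ 2)) ≤ μ * (r1 ^ 2 + r2 ^ 2) :=
      mul_le_of_le_one_left (by positivity) t3
    linarith
  set Y := τ ^ 3 * ψ ^ 2 * Z1 ^ 2 with hY
  have Td : 3 * (-3 * w * τ ^ 2 * ψ - τ ^ 3 * ψ ^ 2) * Z1 ^ 2 ≤ -3 * Y := by
    have : 0 ≤ w * τ ^ 2 * ψ * Z1 ^ 2 := by positivity
    rw [hY]; linarith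
  have Te : - (-6 * w ^ 3 * ψ - 18 * w ^ 2 * τ * ψ ^ 2 - 18 * w * τ ^ 2 * ψ ^ 3 - 6 * τ ^ 3 * ψ ^ 4) * Z ^ 2
      ≤ 42 * w * Z ^ 2 + 6 * (W * Z ^ 2) := by
    have k1 : w ^ 3 * ψ ≤ w * 1 := by gcongr
    have k2 : w ^ 2 * τ * ψ ^ 2 ≤ w * 1 * 1 := by gcongr
    have k3 : w * τ ^ 2 * ψ ^ 3 ≤ w * 1 * 1 := by gcongr
    have k4 : τ ^ 3 * ψ ^ 4 ≤ τ ^ 3 * ψ := by gcongr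
    have := mul_le_mul_of_nonneg_right
      (show - (-6 * w ^ 3 * ψ - 18 * w ^ 2 * τ * ψ ^ 2 - 18 * w * τ ^ 2 * ψ ^ 3 - 6 * τ ^ 3 * ψ ^ 4)
        ≤ 42 * w + 6 * W by rw [hW]; linarith) (sq_nonneg Z)
    linarith
  have hb1 : |b| ≤ 1 + S := by
    refine abs_le_of_sq_le_sq ?_ (by positivity)
    have : S * ψ ≤ S := mul_le_of_le_one_right hS hψ1
    nlinarith
  set W1 := -3 * w * τ ^ 2 * ψ - τ ^ 3 * ψ ^ 2 with hW1
  have k1 : w * τ ^ 2 * ψ ≤ w * 1 * 1 := by gcongr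
  have k1' : 0 ≤ w * τ ^ 2 * ψ := by positivity
  have k2 : τ ^ 3 * ψ ^ 2 ≤ τ ^ 3 * ψ := by gcongr
  have k2' : 0 ≤ τ ^ 3 * ψ ^ 2 := by positivity
  have hW1a : |W1| ≤ 3 * w + W := by
    rw [abs_le]; constructor <;> linarith
  have Tf : - 2 * W1 * b * Z ^ 2 ≤ 2 * (1 + S) * (3 * w + W) * Z ^ 2 := by
    refine mul_le_mul_of_nonneg_right ?_ (sq_nonneg Z)
    calc - 2 * W1 * b ≤ |- 2 * W1 * b| := le_abs_self _
      _ = 2 * |b| * |W1| := by rw [abs_mul, abs_mul]; norm_num; ring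
      _ ≤ 2 * (1 + S) * (3 * w + W) := by gcongr
  have Tg : - 2 * W * b * Z * Z1 ≤ Y + S * (W * Z ^ 2) := by
    have h1 : 0 ≤ τ ^ 3 * (ψ * Z1 + b * Z) ^ 2 := by positivity
    have h2 : τ ^ 3 * Z ^ 2 * b ^ 2 ≤ τ ^ 3 * Z ^ 2 * (S * ψ) := by gcongr
    rw [hY, hW]; linarith
  have hZδ : 2 * |Z * δ| ≤ Z ^ 2 + 4 * S * N := by
    refine two_mul_abs_le (by positivity) (by positivity) ?_
    rw [mul_pow]; gcongr
  have Th : 2 * γ * (W1 * Z) * δ ≤ |γ| * (3 * w * (Z ^ 2 + 4 * S * N) + W * Z ^ 2 + 4 * S * (τ ^ 3 * N)) := by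
    have h1 : 2 * γ * (W1 * Z) * δ ≤ |γ| * ((3 * w + W) * (Z ^ 2 + 4 * S * N)) := by
      calc 2 * γ * (W1 * Z) * δ ≤ |2 * γ * (W1 * Z) * δ| := le_abs_self _
        _ = |γ| * (|W1| * (2 * |Z * δ|)) := by simp only [abs_mul]; norm_num; ring
        _ ≤ _ := by gcongr
    have h2 : W * N ≤ τ ^ 3 * N := by
      rw [hW]
      exact mul_le_mul_of_nonneg_right (mul_le_of_le_one_right t30 hψ1) hN0
    have h3 := mul_le_mul_of_nonneg_left h2 (show 0 ≤ |γ| * (4 * S) by positivity)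
    linarith
  have Ti : 2 * γ * (W * Z1) * δ ≤ Y + 4 * S * γ ^ 2 * (τ ^ 3 * N) := by
    have h1 : 0 ≤ τ ^ 3 * (ψ * Z1 - γ * δ) ^ 2 := by positivity
    have h2 : τ ^ 3 * γ ^ 2 * δ ^ 2 ≤ τ ^ 3 * γ ^ 2 * (4 * S * N) := by gcongr
    rw [hY, hW]; linarith
  have Tj : - 2 * W * Z * s ≤ l * (W * Z ^ 2) + μ * (ψ * s ^ 2) := by
    have k1 : 0 ≤ W * (l * (Z + μ * s) ^ 2) := by positivity
    have k2 : W * (l * (Z + μ * s) ^ 2)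
        = W * (l * Z ^ 2 + 2 * (l * μ) * (Z * s) + (l * μ) * μ * s ^ 2) := by ring
    rw [k2, hlμ] at k1
    have k3 : W * (μ * s ^ 2) ≤ ψ * (μ * s ^ 2) :=
      mul_le_mul_of_nonneg_right (by rw [hW]; exact mul_le_of_le_one_left hψ0 t3) (by positivity)
    linarith
  have Y0 : 0 ≤ Y := by positivity
  have z1 : 0 ≤ W * Z ^ 2 := by positivity
  have z2 : 0 ≤ τ ^ 3 * N := by positivity
  have z3 : 0 ≤ w * N := by positivity
  have z4 : 0 ≤ w * (P1 ^ 2 + Q1 ^ 2) := by positivity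
  have z5 : 0 ≤ w * Z ^ 2 := by positivity
  have m1 : |α| * (W * Z ^ 2 + S * (τ ^ 3 * N)) ≤ |α| * (1 + S) * (τ ^ 3 * N + W * Z ^ 2) := by
    have a1 : 0 ≤ |α| * (τ ^ 3 * N) := by positivity
    have a2 : 0 ≤ |α| * S * (W * Z ^ 2) := by positivity
    linarith
  have m2 : |β| * (5 * S * (τ ^ 3 * N)) ≤ 5 * |β| * S * (τ ^ 3 * N + W * Z ^ 2) := by
    have a2 : 0 ≤ |β| * S * (W * Z ^ 2) := by positivity
    linarith
  have m3 : |γ| * (W * Z ^ 2 + 4 * S * (τ ^ 3 * N)) ≤ |γ| * (1 + 4 * S) * (τ ^ 3 * N + W * Z ^ 2) := by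
    have a1 : 0 ≤ |γ| * (τ ^ 3 * N) := by positivity
    have a2 : 0 ≤ |γ| * S * (W * Z ^ 2) := by positivity
    linarith
  have m4 : 4 * S * γ ^ 2 * (τ ^ 3 * N) ≤ 4 * S * γ ^ 2 * (τ ^ 3 * N + W * Z ^ 2) := by
    have a2 : 0 ≤ S * γ ^ 2 * (W * Z ^ 2) := by positivity
    linarith
  have m5 : (6 + 2 * (1 + S) + S) * (W * Z ^ 2) ≤ (6 + 2 * (1 + S) + S) * (τ ^ 3 * N + W * Z ^ 2) := by
    gcongr; linarith
  have m6 : |γ| * (3 * w * (Z ^ 2 + 4 * S * N)) ≤ w * (|γ| * (3 + 12 * S)) * (N + P1 ^ 2 + Q1 ^ 2 + Z ^ 2) := by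
    have a1 : 0 ≤ |γ| * (w * N) := by positivity
    have a2 : 0 ≤ |γ| * S * (w * Z ^ 2) := by positivity
    have a3 : 0 ≤ |γ| * (w * (P1 ^ 2 + Q1 ^ 2)) := by positivity
    have a4 : 0 ≤ |γ| * S * (w * (P1 ^ 2 + Q1 ^ 2)) := by positivity
    linarith
  have m7 : 3 * w * (N + P1 ^ 2 + Q1 ^ 2) + 42 * w * Z ^ 2 + 2 * (1 + S) * (3 * w) * Z ^ 2
      ≤ w * (45 + 6 * (1 + S)) * (N + P1 ^ 2 + Q1 ^ 2 + Z ^ 2) := by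
    have a1 : 0 ≤ S * (w * N) := by positivity
    have a4 : 0 ≤ S * (w * (P1 ^ 2 + Q1 ^ 2)) := by positivity
    linarith
  unfold cD cE
  linarith

theorem cD_nn {α β γ S : ℝ} (hS : 0 ≤ S) : 0 ≤ cD α β γ S := by unfold cD; positivity
theorem cE_nn {γ S : ℝ} (hS : 0 ≤ S) : 0 ≤ cE γ S := by unfold cE; positivity

theorem diff_flux {θ W W1 W2 P Q P1 Q1 Z Z1 Z2 b δ : ℝ → ℝ} {x θ1 W3 P2 Q2 Z3 b1 δ1 γ : ℝ}
    (hθ : HasDerivAt θ θ1 x)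
    (h0 : HasDerivAt W (W1 x) x) (h1 : HasDerivAt W1 (W2 x) x) (h2 : HasDerivAt W2 W3 x)
    (k0 : HasDerivAt Z (Z1 x) x) (k1 : HasDerivAt Z1 (Z2 x) x) (k2 : HasDerivAt Z2 Z3 x)
    (hP : HasDerivAt P (P1 x) x) (hQ : HasDerivAt Q (Q1 x) x)
    (hP1 : HasDerivAt P1 P2 x) (hQ1 : HasDerivAt Q1 Q2 x)
    (hb : HasDerivAt b b1 x) (hδ : HasDerivAt δ δ1 x) :
    HasDerivAt (fun x => -2 * (θ x * (Q x * P1 x - P x * Q1 x))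
      - (-2 * (W x * (Z x * Z2 x)) + W x * Z1 x ^ 2 + 2 * (W1 x * (Z x * Z1 x)) - W2 x * Z x ^ 2)
      + 2 * (W x * (b x * Z x ^ 2)) - 2 * γ * (W x * (Z x * δ x)))
      (-2 * (θ1 * (Q x * P1 x - P x * Q1 x) + θ x * (Q x * P2 - P x * Q2))
      - (-2 * W x * Z x * Z3 + 3 * W1 x * Z1 x ^ 2 - W3 * Z x ^ 2)
      + 2 * (W1 x * (b x * Z x ^ 2) + W x * (b1 * Z x ^ 2 + b x * (2 * Z x * Z1 x)))
      - 2 * γ * (W1 x * (Z x * δ x) + W x * (Z1 x * δ x + Z x * δ1))) x := by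
  refine (((((hθ.fun_mul ((hQ.fun_mul hP1).fun_sub (hP.fun_mul hQ1))).const_mul (-2)).fun_sub
    (lin_flux h0 h1 h2 k0 k1 k2)).fun_add ((h0.fun_mul (hb.fun_mul (sq_hasDeriv k0))).const_mul 2)).fun_sub
    ((h0.fun_mul (k0.fun_mul hδ)).const_mul (2 * γ))).congr_deriv ?_
  ring


set_option maxHeartbeats 4000000 in
theorem diff_est {α β γ : ℝ} {P Q Z b δ : ℝ → ℝ → ℝ} {X : ℝ → ℝ → ℝ} {r1 r2 s : ℝ → ℝ}
    {t0 t1 S K ν ζ l : ℝ} (h01 : t0 ≤ t1) (hS : 0 ≤ S) (hl : 0 < l) (hν : 0 ≤ ν) (hζ : 0 ≤ ζ)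
    (sP : Sm P) (sQ : Sm Q) (sZ : Sm Z) (sb : Sm b) (sδ : Sm δ)
    (hN : ∀ x t, 0 ≤ x → t ∈ Icc t0 t1 → P x t * pdt P x t + Q x t * pdt Q x t
      = Q x t * pdx (pdx P) x t - P x t * pdx (pdx Q) x t + (α * Z x t + β * δ x t) * X x t
        + P x t * r1 x + Q x t * r2 x)
    (hZ : ∀ x t, 0 ≤ x → t ∈ Icc t0 t1 → pdt Z x t = - pdx (pdx (pdx Z)) x t
      - (pdx b x t * Z x t + b x t * pdx Z x t) + γ * pdx δ x t + s x)
    (hP0 : ∀ t ∈ Icc t0 t1, P 0 t = 0) (hQ0 : ∀ t ∈ Icc t0 t1, Q 0 t = 0)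
    (hZ0 : ∀ t ∈ Icc t0 t1, Z 0 t = 0)
    (hb : ∀ x t, 0 ≤ x → t ∈ Icc t0 t1 → b x t ^ 2 ≤ S * psi x)
    (hδ : ∀ x t, 0 ≤ x → t ∈ Icc t0 t1 → δ x t ^ 2 ≤ 4 * S * (P x t ^ 2 + Q x t ^ 2))
    (hX : ∀ x t, 0 ≤ x → t ∈ Icc t0 t1 → X x t ^ 2 ≤ S * psi x * (P x t ^ 2 + Q x t ^ 2))
    (rP : ∀ t ∈ Icc t0 t1, RD fun x => P x t) (rQ : ∀ t ∈ Icc t0 t1, RD fun x => Q x t)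
    (rP1 : ∀ t ∈ Icc t0 t1, RD fun x => pdx P x t) (rQ1 : ∀ t ∈ Icc t0 t1, RD fun x => pdx Q x t)
    (rZ : ∀ t ∈ Icc t0 t1, RD fun x => Z x t)
    (hK : ∀ t ∈ Icc t0 t1, ∫ x in Ioi (0:ℝ), (P x t ^ 2 + Q x t ^ 2 + pdx P x t ^ 2 + pdx Q x t ^ 2
      + Z x t ^ 2) ≤ K)
    (hr1 : RD r1) (hr2 : RD r2) (hs : RD s)
    (hrs : ∫ x in Ioi (0:ℝ), (r1 x ^ 2 + r2 x ^ 2 + psi x * s x ^ 2) ≤ ν)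
    (hz : ∀ t ∈ Icc t0 t1, pdx Z 0 t ^ 2 ≤ ζ) :
    ∫ x in Ioi (0:ℝ), (P x t0 ^ 2 + Q x t0 ^ 2 + psi x * Z x t0 ^ 2) ≤
      Real.exp ((l + cD α β γ S) * (t1 - t0)) *
        ((∫ x in Ioi (0:ℝ), (P x t1 ^ 2 + Q x t1 ^ 2 + psi x * Z x t1 ^ 2)) + (l⁻¹ * ν + ζ) * (t1 - t0)) := by
  set A := l + cD α β γ S with hA
  have hcD : 0 ≤ cD α β γ S := cD_nn hS
  have hcE : 0 ≤ cE γ S := cE_nn hS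
  have hA0 : 0 ≤ A := by positivity
  have iG : ∀ t ∈ Icc t0 t1, IntegrableOn (fun x => P x t ^ 2 + Q x t ^ 2 + psi x * Z x t ^ 2) (Ioi 0) :=
    fun t ht => ((rP t ht).sq.add (rQ t ht).sq).int.add (rZ t ht).sq.psi_int
  have m0 : t0 ∈ Icc t0 t1 := ⟨le_rfl, h01⟩
  have m1 : t1 ∈ Icc t0 t1 := ⟨h01, le_rfl⟩
  have hK0 : 0 ≤ K := (int_nn fun x _ => by positivity).trans (hK t0 m0)
  have hl0 := lin_tendsto (iG t0 m0) 3
  have hl1 := lin_tendsto (iG t1 m1) 3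
  have hinv : Tendsto (fun R : ℝ => 1 / R) atTop (𝓝 0) := by
    simpa using tendsto_inv_atTop_zero (𝕜 := ℝ)
  have hrhs : Tendsto (fun R : ℝ => Real.exp (A * (t1 - t0)) *
      ((∫ x in (0:ℝ)..R, (1 - x / R) ^ 3 * (P x t1 ^ 2 + Q x t1 ^ 2 + psi x * Z x t1 ^ 2))
        + (l⁻¹ * ν + ζ + 1 / R * cE γ S * K) * (t1 - t0))) atTop
      (𝓝 (Real.exp (A * (t1 - t0)) *
        ((∫ x in Ioi (0:ℝ), (P x t1 ^ 2 + Q x t1 ^ 2 + psi x * Z x t1 ^ 2))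
        + (l⁻¹ * ν + ζ + 0 * cE γ S * K) * (t1 - t0)))) :=
    (hl1.add ((((hinv.mul_const _).mul_const _).const_add _).mul_const _)).const_mul _
  rw [zero_mul, zero_mul, add_zero] at hrhs
  refine le_of_tendsto_of_tendsto hl0 hrhs ?_
  filter_upwards [eventually_ge_atTop 1] with R hR
  have hR0 : (0:ℝ) ≤ R := by linarith
  set w := 1 / R with hw
  have hw0 : 0 ≤ w := by positivity
  have hw1 : w ≤ 1 := by rw [hw, div_le_one (by linarith)]; exact hR
  set τ : ℝ → ℝ := fun x => 1 - x / R with hτ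
  have hτd : ∀ x, HasDerivAt τ (-w) x := fun x => tau_hasDeriv R x
  have hτc : ContinuousOn τ (Icc 0 R) := by simp only [hτ]; fun_prop
  have hψd : ∀ x, 0 ≤ x → HasDerivAt psi (-(psi x) ^ 2) x := fun x hx => psi_hasDeriv hx
  have hψc : ContinuousOn psi (Icc 0 R) := psi_contOn.mono fun x hx => hx.1
  set θ : ℝ → ℝ := fun x => τ x ^ 3 with hθ
  set W : ℝ → ℝ := fun x => τ x ^ 3 * psi x with hW
  set W1 : ℝ → ℝ := fun x => -3 * w * τ x ^ 2 * psi x - τ x ^ 3 * psi x ^ 2 with hW1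
  set W2 : ℝ → ℝ := fun x => 6 * w ^ 2 * τ x * psi x + 6 * w * τ x ^ 2 * psi x ^ 2
    + 2 * τ x ^ 3 * psi x ^ 3 with hW2
  set W3 : ℝ → ℝ := fun x => -6 * w ^ 3 * psi x - 18 * w ^ 2 * τ x * psi x ^ 2
    - 18 * w * τ x ^ 2 * psi x ^ 3 - 6 * τ x ^ 3 * psi x ^ 4 with hW3
  have hθd : ∀ x, HasDerivAt θ (-3 * w * τ x ^ 2) x := by
    intro x
    refine ((hτd x).fun_pow 3).congr_deriv ?_
    simp; ring
  have hWd : ∀ x, 0 ≤ x → HasDerivAt W (W1 x) x := by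
    intro x hx
    refine (((hτd x).fun_pow 3).fun_mul (hψd x hx)).congr_deriv ?_
    simp [hW1]; ring
  have hW1d : ∀ x, 0 ≤ x → HasDerivAt W1 (W2 x) x := by
    intro x hx
    refine (((((hτd x).fun_pow 2).const_mul (-3 * w)).fun_mul (hψd x hx)).fun_sub
      (((hτd x).fun_pow 3).fun_mul ((hψd x hx).fun_pow 2))).congr_deriv ?_
    simp [hW2]; ring
  have hW2d : ∀ x, 0 ≤ x → HasDerivAt W2 (W3 x) x := by
    intro x hx
    refine ((((hτd x).const_mul (6 * w ^ 2)).fun_mul (hψd x hx)).fun_add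
      ((((hτd x).fun_pow 2).const_mul (6 * w)).fun_mul ((hψd x hx).fun_pow 2))
      |>.fun_add ((((hτd x).fun_pow 3).const_mul 2).fun_mul ((hψd x hx).fun_pow 3))).congr_deriv ?_
    simp [hW3]; ring
  have hPQd : ∀ x t, pdt (fun x t => P x t ^ 2 + Q x t ^ 2) x t
      = 2 * (P x t * pdt P x t + Q x t * pdt Q x t) := by
    intro x t
    have h := ((sq_hasDeriv (sP.ht x t)).fun_add (sq_hasDeriv (sQ.ht x t))).deriv
    simp only [pdt] at h ⊢; rw [h]; ring
  have hZZd : ∀ x t, pdt (fun x t => Z x t ^ 2) x t = 2 * Z x t * pdt Z x t := by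
    intro x t
    have h := (sq_hasDeriv (sZ.ht x t)).deriv
    simp only [pdt] at h ⊢; rw [h]
  have sN := (sP.pow 2).add (sQ.pow 2)
  have cθ : ContinuousOn θ (Icc 0 R) := by fun_prop
  have cW : ContinuousOn W (Icc 0 R) := by fun_prop
  have ii : ∀ {g : ℝ → ℝ}, ContinuousOn g (Icc 0 R) → IntervalIntegrable g volume 0 R := by
    intro g hg
    exact ContinuousOn.intervalIntegrable (by rwa [uIcc_of_le hR0])
  have esum : ∀ t, ∫ x in (0:ℝ)..R, (1 - x / R) ^ 3 * (P x t ^ 2 + Q x t ^ 2 + psi x * Z x t ^ 2)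
      = (∫ x in (0:ℝ)..R, θ x * (P x t ^ 2 + Q x t ^ 2)) + ∫ x in (0:ℝ)..R, W x * Z x t ^ 2 := by
    intro t
    have c1 := sP.cx t; have c2 := sQ.cx t; have c3 := sZ.cx t
    rw [← intervalIntegral.integral_add (ii (by fun_prop)) (ii (by fun_prop))]
    refine intervalIntegral.integral_congr fun x _ => ?_
    simp only [hθ, hW, hτ]; ring
  have key := gron_back (f := fun t => (∫ x in (0:ℝ)..R, θ x * (P x t ^ 2 + Q x t ^ 2))
      + ∫ x in (0:ℝ)..R, W x * Z x t ^ 2)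
    (f' := fun t => (∫ x in (0:ℝ)..R, θ x * pdt (fun x t => P x t ^ 2 + Q x t ^ 2) x t)
      + ∫ x in (0:ℝ)..R, W x * pdt (fun x t => Z x t ^ 2) x t)
    (a := t0) (b := t1) (A := A) (C := l⁻¹ * ν + ζ + w * cE γ S * K) h01 hA0 (by positivity)
    (fun t _ => (sN.hasDerivAt_int _ R hR0 cθ t).fun_add ((sZ.pow 2).hasDerivAt_int _ R hR0 cW t)) ?_
  · rw [esum, esum]; exact key
  · intro t ht
    have c1 := sP.cx t; have c2 := sQ.cx t
    have c3 := sP.pdx.cx t; have c4 := sQ.pdx.cx t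
    have c3' := sP.pdx.pdx.cx t; have c4' := sQ.pdx.pdx.cx t
    have c5 := sZ.cx t; have c6 := sZ.pdx.cx t
    have c7 := sZ.pdx.pdx.cx t; have c8 := sZ.pdx.pdx.pdx.cx t
    have c9 := (sZ.pow 2).pdt.cx t
    have c10 := sN.pdt.cx t
    have c11 := sb.cx t; have c12 := sb.pdx.cx t
    have c13 := sδ.cx t; have c14 := sδ.pdx.cx t
    have iB1 : IntegrableOn (fun x => l⁻¹ * (r1 x ^ 2 + r2 x ^ 2 + psi x * s x ^ 2)) (Ioi 0) :=
      ((hr1.sq.add hr2.sq).int.add hs.sq.psi_int).const_mul _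
    have iB2 : IntegrableOn (fun x => w * cE γ S * (P x t ^ 2 + Q x t ^ 2 + pdx P x t ^ 2 + pdx Q x t ^ 2
      + Z x t ^ 2)) (Ioi 0) := (((((rP t ht).sq.add (rQ t ht).sq).add (rP1 t ht).sq).add (rQ1 t ht).sq).add
        (rZ t ht).sq).int.const_mul _
    have := slice_est (F := fun x => -2 * (θ x * (Q x t * pdx P x t - P x t * pdx Q x t))
      - (-2 * (W x * (Z x t * pdx (pdx Z) x t)) + W x * pdx Z x t ^ 2 + 2 * (W1 x * (Z x t * pdx Z x t))
        - W2 x * Z x t ^ 2)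
      + 2 * (W x * (b x t * Z x t ^ 2)) - 2 * γ * (W x * (Z x t * δ x t)))
      (F' := fun x => -2 * (-3 * w * τ x ^ 2 * (Q x t * pdx P x t - P x t * pdx Q x t)
          + θ x * (Q x t * pdx (pdx P) x t - P x t * pdx (pdx Q) x t))
      - (-2 * W x * Z x t * pdx (pdx (pdx Z)) x t + 3 * W1 x * pdx Z x t ^ 2 - W3 x * Z x t ^ 2)
      + 2 * (W1 x * (b x t * Z x t ^ 2) + W x * (pdx b x t * Z x t ^ 2 + b x t * (2 * Z x t * pdx Z x t)))
      - 2 * γ * (W1 x * (Z x t * δ x t) + W x * (pdx Z x t * δ x t + Z x t * pdx δ x t)))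
      (f := fun x => -(θ x * pdt (fun x t => P x t ^ 2 + Q x t ^ 2) x t
        + W x * pdt (fun x t => Z x t ^ 2) x t))
      (g := fun x => θ x * (P x t ^ 2 + Q x t ^ 2) + W x * Z x t ^ 2)
      (B := fun x => l⁻¹ * (r1 x ^ 2 + r2 x ^ 2 + psi x * s x ^ 2)
        + w * cE γ S * (P x t ^ 2 + Q x t ^ 2 + pdx P x t ^ 2 + pdx Q x t ^ 2 + Z x t ^ 2)) (A := A) hR0 ?_
      (by fun_prop) (by fun_prop) (by fun_prop) (iB1.add iB2)
      (fun x hx => by have := psi_pos (x := x) (by first | exact hx | exact hx.le); positivity) ?_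
    · rw [integral_add iB1 iB2, integral_const_mul, integral_const_mul, intervalIntegral.integral_neg,
        intervalIntegral.integral_add (ii (by fun_prop)) (ii (by fun_prop)),
        intervalIntegral.integral_add (ii (by fun_prop)) (ii (by fun_prop))] at this
      have hh := mul_le_mul_of_nonneg_left (hK t ht) (show 0 ≤ w * cE γ S by positivity)
      have hh2 := mul_le_mul_of_nonneg_left hrs (show 0 ≤ l⁻¹ by positivity)
      have hτR : τ R = 0 := by simp only [hτ]; rw [div_self (by linarith)]; norm_num
      have z0 : θ R = 0 := by simp only [hθ, hτR]; ring
      have z1 : W R = 0 := by simp only [hW, hτR]; ring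
      have z2 : W1 R = 0 := by simp only [hW1, hτR]; ring
      have z3 : W2 R = 0 := by simp only [hW2, hτR]; ring
      have z4 : W 0 = 1 := by simp [hW, hτ, psi]
      have hzz := hz t ht
      simp only [z0, z1, z2, z3, z4, hP0 t ht, hQ0 t ht, hZ0 t ht] at this ⊢
      linarith
    · intro x hx
      exact diff_flux (hθd x) (hWd x hx.1) (hW1d x hx.1) (hW2d x hx.1) (sZ.hx x t) (sZ.pdx.hx x t)
        (sZ.pdx.pdx.hx x t) (sP.hx x t) (sQ.hx x t) (sP.pdx.hx x t) (sQ.pdx.hx x t) (sb.hx x t) (sδ.hx x t)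
    · intro x hx
      have h0 : 0 ≤ x / R := div_nonneg hx.1 (by linarith)
      have h1 : x / R ≤ 1 := div_le_one_of_le₀ hx.2 (by linarith)
      have h2 : 0 ≤ τ x := by simp only [hτ]; linarith
      have h3 : τ x ≤ 1 := by simp only [hτ]; linarith
      have hx0 := hx.1
      have hp := ptd (α := α) (β := β) (γ := γ) (P1 := pdx P x t) (Q1 := pdx Q x t) (Z := Z x t)
        (Z1 := pdx Z x t) (r1 := r1 x) (r2 := r2 x) (s := s x) h2 h3 hw0 hw1 (psi_pos hx0).le
        (psi_le_one hx0) hS hl.le (inv_nonneg.2 hl.le) (mul_inv_cancel₀ hl.ne') (hb x t hx0 ht) (hδ x t hx0 ht) (hX x t hx0 ht)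
      rw [hPQd, hZZd, hN x t hx0 ht, hZ x t hx0 ht]
      have hp' : 2 * (-3 * w * τ x ^ 2) * (Q x t * pdx P x t - P x t * pdx Q x t)
          - 2 * θ x * ((α * Z x t + β * δ x t) * X x t)
          - 2 * θ x * (P x t * r1 x + Q x t * r2 x) + 3 * W1 x * pdx Z x t ^ 2
          - W3 x * Z x t ^ 2 - 2 * W1 x * b x t * Z x t ^ 2
          - 2 * W x * b x t * Z x t * pdx Z x t
          + 2 * γ * (W1 x * Z x t + W x * pdx Z x t) * δ x t
          - 2 * W x * Z x t * s x
          ≤ A * (θ x * (P x t ^ 2 + Q x t ^ 2) + W x * Z x t ^ 2)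
            + (l⁻¹ * (r1 x ^ 2 + r2 x ^ 2 + psi x * s x ^ 2)
             + w * cE γ S * (P x t ^ 2 + Q x t ^ 2 + pdx P x t ^ 2 + pdx Q x t ^ 2 + Z x t ^ 2)) := hp
      clear hp hl0 hl1 hrhs
      clear_value θ W W1 W2 W3 A w
      generalize pdx (pdx (pdx Z)) x t = v3 at *
      generalize pdx Z x t = v1 at *
      linarith


theorem Sm.pdx_sub {f g : ℝ → ℝ → ℝ} (hf : Sm f) (hg : Sm g) :
    _root_.pdx (fun x t => f x t - g x t) = fun x t => _root_.pdx f x t - _root_.pdx g x t := by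
  funext x t
  exact ((hf.hx x t).fun_sub (hg.hx x t)).deriv
theorem Sm.pdt_sub {f g : ℝ → ℝ → ℝ} (hf : Sm f) (hg : Sm g) :
    _root_.pdt (fun x t => f x t - g x t) = fun x t => _root_.pdt f x t - _root_.pdt g x t := by
  funext x t
  exact ((hf.ht x t).fun_sub (hg.ht x t)).deriv

/-- Approximate solution with residual on a time slab. -/
structure Sl (α β γ t0 t1 K S : ℝ) (p q v : ℝ → ℝ → ℝ) (r1 r2 s : ℝ → ℝ) : Prop where
  sp : Sm p
  sq : Sm q
  sv : Sm v
  ep : ∀ x t, 0 ≤ x → t ∈ Icc t0 t1 → pdt p x t = - pdx (pdx q) x t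
    + (α * v x t + β * (p x t ^ 2 + q x t ^ 2)) * q x t - r1 x
  eq : ∀ x t, 0 ≤ x → t ∈ Icc t0 t1 → pdt q x t = pdx (pdx p) x t
    - (α * v x t + β * (p x t ^ 2 + q x t ^ 2)) * p x t - r2 x
  ev : ∀ x t, 0 ≤ x → t ∈ Icc t0 t1 → pdt v x t = - pdx (pdx (pdx v)) x t - v x t * pdx v x t
    + γ * (2 * p x t * pdx p x t + 2 * q x t * pdx q x t) - s x
  p0 : ∀ t ∈ Icc t0 t1, p 0 t = 0
  q0 : ∀ t ∈ Icc t0 t1, q 0 t = 0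
  v0 : ∀ t ∈ Icc t0 t1, v 0 t = 0
  rp : ∀ t ∈ Icc t0 t1, RD fun x => p x t
  rq : ∀ t ∈ Icc t0 t1, RD fun x => q x t
  rv : ∀ t ∈ Icc t0 t1, RD fun x => v x t
  rp1 : ∀ t ∈ Icc t0 t1, RD fun x => pdx p x t
  rq1 : ∀ t ∈ Icc t0 t1, RD fun x => pdx q x t
  hK : ∀ t ∈ Icc t0 t1, ∫ x in Ioi (0:ℝ), (p x t ^ 2 + q x t ^ 2 + pdx p x t ^ 2 + pdx q x t ^ 2
      + v x t ^ 2) ≤ K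
  hn : ∀ x t, 0 ≤ x → t ∈ Icc t0 t1 → (1 + x) * (p x t ^ 2 + q x t ^ 2) ≤ S
  hv : ∀ x t, 0 ≤ x → t ∈ Icc t0 t1 → (1 + x) * v x t ^ 2 ≤ S

theorem psi_bd {x a S : ℝ} (hx : 0 ≤ x) (h : (1 + x) * a ≤ S) : a ≤ S * psi x := by
  have h1 := mul_le_mul_of_nonneg_right h (psi_pos hx).le
  have h2 := psi_mul hx
  calc a = (1 + x) * psi x * a := by rw [h2, one_mul]
    _ = (1 + x) * a * psi x := by ring
    _ ≤ _ := h1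

set_option maxHeartbeats 1000000 in
theorem Sl.cmp {α β γ t0 t1 K S ν ζ l : ℝ} {p1 q1 v1 p2 q2 v2 : ℝ → ℝ → ℝ} {r1 r2 s : ℝ → ℝ}
    (A : Sl α β γ t0 t1 K S p1 q1 v1 (fun _ => 0) (fun _ => 0) (fun _ => 0))
    (B : Sl α β γ t0 t1 K S p2 q2 v2 r1 r2 s)
    (h01 : t0 ≤ t1) (hS : 0 ≤ S) (hl : 0 < l) (hν : 0 ≤ ν) (hζ : 0 ≤ ζ)
    (hr1 : RD r1) (hr2 : RD r2) (hs : RD s)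
    (hrs : ∫ x in Ioi (0:ℝ), (r1 x ^ 2 + r2 x ^ 2 + psi x * s x ^ 2) ≤ ν)
    (hz : ∀ t ∈ Icc t0 t1, (pdx v1 0 t - pdx v2 0 t) ^ 2 ≤ ζ) :
    ∫ x in Ioi (0:ℝ), ((p1 x t0 - p2 x t0) ^ 2 + (q1 x t0 - q2 x t0) ^ 2 + psi x * (v1 x t0 - v2 x t0) ^ 2) ≤
      Real.exp ((l + cD α β γ S) * (t1 - t0)) *
        ((∫ x in Ioi (0:ℝ), ((p1 x t1 - p2 x t1) ^ 2 + (q1 x t1 - q2 x t1) ^ 2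
          + psi x * (v1 x t1 - v2 x t1) ^ 2)) + (l⁻¹ * ν + ζ) * (t1 - t0)) := by
  have ep1 := A.sp.pdx_sub B.sp
  have eq1 := A.sq.pdx_sub B.sq
  have ev1 := A.sv.pdx_sub B.sv
  have hb : Sm (fun x t => (1/2) * (v1 x t + v2 x t)) := (A.sv.add B.sv).cmul _
  have eb : ∀ x t, pdx (fun x t => (1/2) * (v1 x t + v2 x t)) x t = (1/2) * (pdx v1 x t + pdx v2 x t) :=
    fun x t => (((A.sv.hx x t).fun_add (B.sv.hx x t)).const_mul (1/2)).deriv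
  have sδ : Sm (fun x t => (p1 x t ^ 2 + q1 x t ^ 2) - (p2 x t ^ 2 + q2 x t ^ 2)) :=
    ((A.sp.pow 2).add (A.sq.pow 2)).sub ((B.sp.pow 2).add (B.sq.pow 2))
  have eδ : ∀ x t, pdx (fun x t => (p1 x t ^ 2 + q1 x t ^ 2) - (p2 x t ^ 2 + q2 x t ^ 2)) x t
      = (2 * p1 x t * pdx p1 x t + 2 * q1 x t * pdx q1 x t)
       - (2 * p2 x t * pdx p2 x t + 2 * q2 x t * pdx q2 x t) := fun x t =>
    (((sq_hasDeriv (A.sp.hx x t)).fun_add (sq_hasDeriv (A.sq.hx x t))).fun_sub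
      ((sq_hasDeriv (B.sp.hx x t)).fun_add (sq_hasDeriv (B.sq.hx x t)))).deriv
  refine diff_est (P := fun x t => p1 x t - p2 x t) (Q := fun x t => q1 x t - q2 x t)
    (Z := fun x t => v1 x t - v2 x t) (b := fun x t => (1/2) * (v1 x t + v2 x t))
    (δ := fun x t => (p1 x t ^ 2 + q1 x t ^ 2) - (p2 x t ^ 2 + q2 x t ^ 2))
    (X := fun x t => (p1 x t - p2 x t) * q2 x t - (q1 x t - q2 x t) * p2 x t)
    (K := 4 * K) (r1 := r1) (r2 := r2) (s := s)
    h01 hS hl hν hζ (A.sp.sub B.sp) (A.sq.sub B.sq) (A.sv.sub B.sv) hb sδ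
    ?_ ?_ ?_ ?_ ?_ ?_ ?_ ?_ ?_ ?_ ?_ ?_ ?_ ?_ hr1 hr2 hs hrs ?_
  · intro x t hx ht
    rw [ep1, eq1, A.sp.pdx.pdx_sub B.sp.pdx, A.sq.pdx.pdx_sub B.sq.pdx, A.sp.pdt_sub B.sp, A.sq.pdt_sub B.sq]
    simp only [A.ep x t hx ht, A.eq x t hx ht, B.ep x t hx ht, B.eq x t hx ht]
    ring
  · intro x t hx ht
    rw [ev1, A.sv.pdx.pdx_sub B.sv.pdx, A.sv.pdx.pdx.pdx_sub B.sv.pdx.pdx, A.sv.pdt_sub B.sv, eδ, eb]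
    simp only [A.ev x t hx ht, B.ev x t hx ht]
    ring
  · intro t ht; simp only [A.p0 t ht, B.p0 t ht, sub_self]
  · intro t ht; simp only [A.q0 t ht, B.q0 t ht, sub_self]
  · intro t ht; simp only [A.v0 t ht, B.v0 t ht, sub_self]
  · intro x t hx ht
    have h1 := psi_bd hx (A.hv x t hx ht)
    have h2 := psi_bd hx (B.hv x t hx ht)
    nlinarith [sq_nonneg (v1 x t - v2 x t)]
  · intro x t hx ht
    have h1 := psi_bd hx (A.hn x t hx ht)
    have h2 := psi_bd hx (B.hn x t hx ht)
    have h3 : S * psi x ≤ S := mul_le_of_le_one_right hS (psi_le_one hx)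
    generalize p1 x t = a at *
    generalize q1 x t = b at *
    generalize p2 x t = c at *
    generalize q2 x t = d at *
    have e1 : (a ^ 2 + b ^ 2 - (c ^ 2 + d ^ 2)) ^ 2
      ≤ ((a - c) ^ 2 + (b - d) ^ 2) * ((a + c) ^ 2 + (b + d) ^ 2) := by
      nlinarith [sq_nonneg ((a - c) * (b + d) - (b - d) * (a + c))]
    have e2 : (a + c) ^ 2 + (b + d) ^ 2 ≤ 4 * S := by
      nlinarith [sq_nonneg (a - c), sq_nonneg (b - d)]
    have e3 := mul_le_mul_of_nonneg_left e2 (show 0 ≤ (a - c) ^ 2 + (b - d) ^ 2 by positivity)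
    linarith
  · intro x t hx ht
    have h2 := psi_bd hx (B.hn x t hx ht)
    generalize p1 x t = a at *
    generalize q1 x t = b at *
    generalize p2 x t = c at *
    generalize q2 x t = d at *
    have e1 : ((a - c) * d - (b - d) * c) ^ 2
      ≤ ((a - c) ^ 2 + (b - d) ^ 2) * (c ^ 2 + d ^ 2) := by
      nlinarith [sq_nonneg ((a - c) * c + (b - d) * d)]
    have e3 := mul_le_mul_of_nonneg_left h2 (show 0 ≤ (a - c) ^ 2 + (b - d) ^ 2 by positivity)
    linarith
  · intro t ht; exact (A.rp t ht).sub (B.rp t ht)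
  · intro t ht; exact (A.rq t ht).sub (B.rq t ht)
  · intro t ht; rw [ep1]; exact (A.rp1 t ht).sub (B.rp1 t ht)
  · intro t ht; rw [eq1]; exact (A.rq1 t ht).sub (B.rq1 t ht)
  · intro t ht; exact (A.rv t ht).sub (B.rv t ht)
  · intro t ht
    rw [ep1, eq1]
    have iA := (((((A.rp t ht).sq.add (A.rq t ht).sq).add (A.rp1 t ht).sq).add (A.rq1 t ht).sq).add
        (A.rv t ht).sq).int
    have iB := (((((B.rp t ht).sq.add (B.rq t ht).sq).add (B.rp1 t ht).sq).add (B.rq1 t ht).sq).add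
        (B.rv t ht).sq).int
    have h1 := A.hK t ht
    have h2 := B.hK t ht
    have h3 : ∫ x in Ioi (0:ℝ), ((p1 x t - p2 x t) ^ 2 + (q1 x t - q2 x t) ^ 2
        + (pdx p1 x t - pdx p2 x t) ^ 2 + (pdx q1 x t - pdx q2 x t) ^ 2 + (v1 x t - v2 x t) ^ 2)
        ≤ ∫ x in Ioi (0:ℝ), (2 * (p1 x t ^ 2 + q1 x t ^ 2 + pdx p1 x t ^ 2 + pdx q1 x t ^ 2
      + v1 x t ^ 2) + 2 * (p2 x t ^ 2 + q2 x t ^ 2 + pdx p2 x t ^ 2 + pdx q2 x t ^ 2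
      + v2 x t ^ 2)) := by
      refine int_mono ((((((A.rp t ht).sub (B.rp t ht)).sq.add ((A.rq t ht).sub (B.rq t ht)).sq).add
        ((A.rp1 t ht).sub (B.rp1 t ht)).sq).add ((A.rq1 t ht).sub (B.rq1 t ht)).sq).add
        ((A.rv t ht).sub (B.rv t ht)).sq).int ((iA.const_mul 2).add (iB.const_mul 2)) fun x _ => ?_
      nlinarith [sq_nonneg (p1 x t + p2 x t), sq_nonneg (q1 x t + q2 x t), sq_nonneg (pdx p1 x t + pdx p2 x t),
        sq_nonneg (pdx q1 x t + pdx q2 x t), sq_nonneg (v1 x t + v2 x t)]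
    rw [integral_add (iA.const_mul 2) (iB.const_mul 2), integral_const_mul, integral_const_mul] at h3
    simp only at h3 ⊢
    linarith
  · intro t ht; rw [ev1]; exact hz t ht


section
variable {α β γ T : ℝ} {p q v : ℝ → ℝ → ℝ}

theorem Sol.cK (S : Sol α β γ T p q v) {t : ℝ} (ht : t ∈ Icc 0 T) :
    ∫ x in Ioi (0:ℝ), (p x t ^ 2 + q x t ^ 2 + pdx p x t ^ 2 + pdx q x t ^ 2 + v x t ^ 2) ≤ H p q v t := by
  unfold H
  refine int_mono (((((S.rp t ht).sq.add (S.rq t ht).sq).add (S.rp1 t ht).sq).add (S.rq1 t ht).sq).add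
        (S.rv t ht).sq).int (S.rhd ht).int fun x _ => ?_
  unfold hd
  nlinarith [sq_nonneg (pdx v x t)]

theorem Sol.shiftSl (S : Sol α β γ T p q v) {c d K S0 : ℝ} (hc : 0 ≤ c) (hd' : d ≤ T)
    (hK : ∀ t ∈ Icc c d, H p q v t ≤ K)
    (hn : ∀ x t, 0 ≤ x → t ∈ Icc c d → (1 + x) * (p x t ^ 2 + q x t ^ 2) ≤ S0)
    (hv : ∀ x t, 0 ≤ x → t ∈ Icc c d → (1 + x) * v x t ^ 2 ≤ S0) {a b h : ℝ} (ha : c ≤ a + h)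
    (hb : b + h ≤ d) :
    Sl α β γ a b K S0 (fun x t => p x (t + h)) (fun x t => q x (t + h)) (fun x t => v x (t + h))
      (fun _ => 0) (fun _ => 0) (fun _ => 0) := by
  have m : ∀ t ∈ Icc a b, t + h ∈ Icc c d := fun t ht => ⟨by linarith [ht.1], by linarith [ht.2]⟩
  have mT : ∀ t ∈ Icc a b, t + h ∈ Icc 0 T := fun t ht =>
    ⟨by linarith [(m t ht).1], by linarith [(m t ht).2]⟩
  have ed : ∀ (f : ℝ → ℝ → ℝ) x t, pdt (fun x t => f x (t + h)) x t = pdt f x (t + h) := by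
    intro f x t
    exact deriv_comp_add_const (fun s => f x s) h t
  exact {
    sp := S.sp.shift h
    sq := S.sq.shift h
    sv := S.sv.shift h
    ep := fun x t hx ht => by rw [ed, S.ep x _ hx (mT t ht), sub_zero]; rfl
    eq := fun x t hx ht => by rw [ed, S.eq x _ hx (mT t ht), sub_zero]; rfl
    ev := fun x t hx ht => by rw [ed, S.ev x _ hx (mT t ht), sub_zero]; rfl
    p0 := fun t ht => S.p0 _ (mT t ht)
    q0 := fun t ht => S.q0 _ (mT t ht)
    v0 := fun t ht => S.v0 _ (mT t ht)
    rp := fun t ht => S.rp _ (mT t ht)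
    rq := fun t ht => S.rq _ (mT t ht)
    rv := fun t ht => S.rv _ (mT t ht)
    rp1 := fun t ht => S.rp1 _ (mT t ht)
    rq1 := fun t ht => S.rq1 _ (mT t ht)
    hK := fun t ht => (S.cK (mT t ht)).trans (hK _ (m t ht))
    hn := fun x t hx ht => hn x _ hx (m t ht)
    hv := fun x t hx ht => hv x _ hx (m t ht) }

theorem Sol.freezeSl (S : Sol α β γ T p q v) {c d K S0 : ℝ} (hc : 0 ≤ c) (hcd : c ≤ d) (hd' : d ≤ T)
    (hK : ∀ t ∈ Icc c d, H p q v t ≤ K)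
    (hn : ∀ x t, 0 ≤ x → t ∈ Icc c d → (1 + x) * (p x t ^ 2 + q x t ^ 2) ≤ S0)
    (hv : ∀ x t, 0 ≤ x → t ∈ Icc c d → (1 + x) * v x t ^ 2 ≤ S0) {a b : ℝ} :
    Sl α β γ a b K S0 (fun x _ => p x d) (fun x _ => q x d) (fun x _ => v x d)
      (fun x => pdt p x d) (fun x => pdt q x d) (fun x => pdt v x d) := by
  have m : d ∈ Icc c d := ⟨hcd, le_rfl⟩
  have mT : d ∈ Icc 0 T := ⟨by linarith, hd'⟩
  have ed : ∀ (f : ℝ → ℝ → ℝ) x t, pdt (fun x _ => f x d) x t = 0 := by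
    intro f x t
    exact deriv_const _ _
  have ex : ∀ (f : ℝ → ℝ → ℝ), pdx (fun x _ => f x d) = fun x _ => pdx f x d := fun f => rfl
  exact {
    sp := S.sp.freeze d
    sq := S.sq.freeze d
    sv := S.sv.freeze d
    ep := fun x t hx ht => by rw [ed, S.ep x _ hx mT, ex, ex]; ring
    eq := fun x t hx ht => by rw [ed, S.eq x _ hx mT, ex, ex]; ring
    ev := fun x t hx ht => by rw [ed, S.ev x _ hx mT, ex, ex, ex, ex, ex]; ring
    p0 := fun t ht => S.p0 _ mT
    q0 := fun t ht => S.q0 _ mT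
    v0 := fun t ht => S.v0 _ mT
    rp := fun t ht => S.rp _ mT
    rq := fun t ht => S.rq _ mT
    rv := fun t ht => S.rv _ mT
    rp1 := fun t ht => S.rp1 _ mT
    rq1 := fun t ht => S.rq1 _ mT
    hK := fun t ht => (S.cK mT).trans (hK _ m)
    hn := fun x t hx ht => hn x _ hx m
    hv := fun x t hx ht => hv x _ hx m }

theorem cpt_bd {f : ℝ → ℝ} (hf : Continuous f) (a b : ℝ) : ∃ C, 0 ≤ C ∧ ∀ t ∈ Icc a b, |f t| ≤ C := by
  obtain ⟨C, hC⟩ := isCompact_Icc.exists_bound_of_continuousOn (s := Icc a b) hf.continuousOn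
  exact ⟨max C 0, le_max_right _ _, fun t ht => (hC t ht).trans (le_max_left _ _)⟩

theorem lip_bd {f : ℝ → ℝ → ℝ} (hf : Sm f) (x T : ℝ) : ∃ C, 0 ≤ C ∧ ∀ a ∈ Icc 0 T, ∀ b ∈ Icc 0 T,
    ∀ h, |b - a| ≤ h → (f x b - f x a) ^ 2 ≤ C ^ 2 * h ^ 2 := by
  obtain ⟨C, hC0, hC⟩ := cpt_bd (hf.pdt.ct x) 0 T
  refine ⟨C, hC0, fun a ha b hb h hh => ?_⟩
  have := (convex_Icc (0:ℝ) T).norm_image_sub_le_of_norm_hasDerivWithin_le (f := fun t => f x t)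
    (f' := fun t => pdt f x t) (C := C) (fun t _ => (hf.ht x t).hasDerivWithinAt) hC ha hb
  rw [Real.norm_eq_abs, Real.norm_eq_abs] at this
  have h2 : |f x b - f x a| ≤ C * h := this.trans (by gcongr)
  rw [← sq_abs, ← mul_pow]
  gcongr

set_option maxHeartbeats 1000000 in
theorem Sol.dt_bd (S : Sol α β γ T p q v) {c d K : ℝ} (hc : 0 ≤ c) (hcd : c ≤ d) (hd' : d ≤ T)
    (hK : ∀ t ∈ Icc c d, H p q v t ≤ K) :
    ∃ L, ∀ t ∈ Icc c d, ∫ x in Ioi (0:ℝ), (pdt p x t ^ 2 + pdt q x t ^ 2 + psi x * pdt v x t ^ 2) ≤ L := by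
  obtain ⟨L0, hL0⟩ := S.x2n hc hd' hK
  obtain ⟨L1, hL1⟩ := S.x2v hc hd' hK
  obtain ⟨C1, hC10, hC1⟩ := lip_bd S.sv.pdx 0 T
  have hcT : ∀ t ∈ Icc c d, t ∈ Icc 0 T := fun t ht => ⟨hc.trans ht.1, ht.2.trans hd'⟩
  have md : d ∈ Icc c d := ⟨hcd, le_rfl⟩
  have hK0 : 0 ≤ K := (H_nn d).trans (hK d md)
  have hL00 : 0 ≤ L0 := (int_nn fun x _ => by positivity).trans (hL0 d md)
  have hL10 : 0 ≤ L1 := (int_nn fun x _ => by positivity).trans (hL1 d md)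
  set S0 := 3 * K + 2 * L0 + 2 * L1 with hS0
  have hS00 : 0 ≤ S0 := by positivity
  have hn : ∀ x t, 0 ≤ x → t ∈ Icc c d → (1 + x) * (p x t ^ 2 + q x t ^ 2) ≤ S0 := fun x t hx ht => by
    have := S.xn_le (hcT t ht) (hL0 t ht) hx
    linarith [hK t ht]
  have hv : ∀ x t, 0 ≤ x → t ∈ Icc c d → (1 + x) * v x t ^ 2 ≤ S0 := fun x t hx ht => by
    have := S.xv_le (hcT t ht) (hL1 t ht) hx
    linarith [hK t ht]
  set ν := ∫ x in Ioi (0:ℝ), (pdt p x d ^ 2 + pdt q x d ^ 2 + psi x * pdt v x d ^ 2) with hν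
  have hν0 : 0 ≤ ν := int_nn fun x hx => by have := psi_pos hx; positivity
  have hT : 0 ≤ T := by linarith
  have hcD : 0 ≤ cD α β γ S0 := cD_nn hS00
  set E1 := Real.exp (1 + cD α β γ S0 * T) * (ν + C1 ^ 2 * T) with hE1
  have hE10 : 0 ≤ E1 := by positivity
  set E2 := Real.exp ((1 + cD α β γ S0) * T) * (E1 + C1 ^ 2 * T) with hE2
  have hE20 : 0 ≤ E2 := by positivity
  have step1 : ∀ h, 0 < h → c ≤ d - h →
      ∫ x in Ioi (0:ℝ), ((p x (d - h) - p x d) ^ 2 + (q x (d - h) - q x d) ^ 2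
        + psi x * (v x (d - h) - v x d) ^ 2) ≤ E1 * h ^ 2 := by
    intro h hh hch
    have hhT : h ≤ T := by linarith
    have A := S.shiftSl hc hd' hK hn hv (a := d - h) (b := d) (h := 0) (by linarith) (by linarith)
    have B := S.freezeSl hc hcd hd' hK hn hv (a := d - h) (b := d)
    have := A.cmp B (ν := ν) (ζ := C1 ^ 2 * h ^ 2) (l := h⁻¹) (by linarith) hS00 (by positivity) hν0
      (by positivity) (S.rpt d (hcT d md)) (S.rqt d (hcT d md)) (S.rvt d (hcT d md)) le_rfl ?_
    · simp only [add_zero, sub_self, inv_inv] at this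
      refine this.trans ?_
      have e1 : d - (d - h) = h := by ring
      rw [e1]
      have e2 : (h⁻¹ + cD α β γ S0) * h = 1 + cD α β γ S0 * h := by field_simp
      rw [e2]
      have e3 : (∫ x in Ioi (0:ℝ), ((0:ℝ) ^ 2 + 0 ^ 2 + psi x * 0 ^ 2)) = 0 := by simp
      rw [e3, zero_add]
      have e4 : (h * ν + C1 ^ 2 * h ^ 2) * h = (ν + C1 ^ 2 * h) * h ^ 2 := by ring
      rw [e4, hE1, mul_assoc]
      gcongr
    · intro t ht
      have := hC1 d (hcT d md) t (hcT t ⟨hch.trans ht.1, ht.2⟩) h (by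
        rw [abs_le]; constructor <;> linarith [ht.1, ht.2])
      have e : ∀ y, pdx (fun x t => v x (t + 0)) y t = pdx v y t := fun y => by simp
      rw [e]; exact this
  have step2 : ∀ t ∈ Icc c d, ∀ h, 0 < h → t ≤ d - h →
      ∫ x in Ioi (0:ℝ), ((p x t - p x (t + h)) ^ 2 + (q x t - q x (t + h)) ^ 2
        + psi x * (v x t - v x (t + h)) ^ 2) ≤ E2 * h ^ 2 := by
    intro t ht h hh hth
    have A := S.shiftSl hc hd' hK hn hv (a := t) (b := d - h) (h := 0) (by linarith [ht.1]) (by linarith)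
    have B := S.shiftSl hc hd' hK hn hv (a := t) (b := d - h) (h := h) (by linarith [ht.1]) (by linarith)
    have rd0 : RD fun _ => (0:ℝ) := by simpa using (S.rp d (hcT d md)).cmul 0
    have := A.cmp B (ν := 0) (ζ := C1 ^ 2 * h ^ 2) (l := 1) hth hS00 (by positivity) le_rfl
      (by positivity) rd0 rd0 rd0 (by simp) ?_
    · simp only [add_zero, sub_add_cancel, mul_zero, zero_add] at this
      refine this.trans ?_
      have hs := step1 h hh (ht.1.trans hth)
      have e1 : d - h - t ≤ T := by linarith [ht.1]
      have e0 : 0 ≤ d - h - t := by linarith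
      have e5 : (0:ℝ) ≤ ∫ x in Ioi (0:ℝ), ((p x (d - h) - p x d) ^ 2 + (q x (d - h) - q x d) ^ 2
        + psi x * (v x (d - h) - v x d) ^ 2) := int_nn fun x hx => by have := psi_pos hx; positivity
      calc _ ≤ Real.exp ((1 + cD α β γ S0) * T) * (E1 * h ^ 2 + C1 ^ 2 * h ^ 2 * T) := by gcongr
        _ = E2 * h ^ 2 := by rw [hE2]; ring
    · intro s hs
      have m1 : s ∈ Icc c d := ⟨ht.1.trans hs.1, by linarith [hs.2]⟩
      have m2 : s + h ∈ Icc c d := ⟨by linarith [hs.1, ht.1], by linarith [hs.2]⟩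
      have := hC1 (s + h) (hcT _ m2) s (hcT s m1) h (by
        rw [abs_le]; constructor <;> linarith)
      have e : ∀ y, pdx (fun x t => v x (t + 0)) y s = pdx v y s := fun y => by simp
      rw [e]; exact this
  refine ⟨max E2 ν, fun t ht => ?_⟩
  rcases eq_or_lt_of_le ht.2 with rfl | htd
  · exact le_max_right _ _
  refine le_trans ?_ (le_max_left _ _)
  have htT := hcT t ht
  have hdt : 0 < d - t := by linarith
  have hhn : ∀ n : ℕ, 0 < (d - t) / ((n:ℝ) + 1) := fun n => by positivity
  have hhn2 : ∀ n : ℕ, (d - t) / ((n:ℝ) + 1) ≤ d - t := fun n =>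
    div_le_self (by linarith) (by linarith [Nat.cast_nonneg (α := ℝ) n])
  have hh0 : Tendsto (fun n : ℕ => (d - t) / ((n:ℝ) + 1)) atTop (𝓝 0) := by
    have := (tendsto_one_div_add_atTop_nhds_zero_nat (𝕜 := ℝ)).const_mul (d - t)
    simpa [div_eq_mul_inv] using this
  have mh : ∀ n : ℕ, t + (d - t) / ((n:ℝ) + 1) ∈ Icc 0 T := fun n =>
    ⟨by linarith [hhn n, htT.1], by linarith [hhn2 n]⟩
  have iF : ∀ h, t + h ∈ Icc 0 T → IntegrableOn (fun x => (p x t - p x (t + h)) ^ 2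
      + (q x t - q x (t + h)) ^ 2 + psi x * (v x t - v x (t + h)) ^ 2) (Ioi 0) := fun h m =>
    (((S.rp t htT).sub (S.rp _ m)).sq.add ((S.rq t htT).sub (S.rq _ m)).sq).int.add
      ((S.rv t htT).sub (S.rv _ m)).sq.psi_int
  have key : ∀ {f : ℝ → ℝ → ℝ}, Sm f → ∀ x, Tendsto (fun n : ℕ => (((d - t) / ((n:ℝ) + 1))⁻¹) ^ 2
      * (f x t - f x (t + (d - t) / ((n:ℝ) + 1))) ^ 2) atTop (𝓝 (pdt f x t ^ 2)) := by
    intro f hf x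
    have h1 := (hasDerivAt_iff_tendsto_slope_zero.1 (hf.ht x t)).comp
      (tendsto_nhdsWithin_iff.2 ⟨hh0, Eventually.of_forall fun n => (hhn n).ne'⟩)
    have h2 := h1.pow 2
    refine h2.congr fun n => ?_
    simp only [Function.comp, smul_eq_mul]
    ring
  refine fatou (f := fun (n : ℕ) x => (((d - t) / ((n:ℝ) + 1))⁻¹) ^ 2 *
    ((p x t - p x (t + (d - t) / ((n:ℝ) + 1))) ^ 2
      + (q x t - q x (t + (d - t) / ((n:ℝ) + 1))) ^ 2
      + psi x * (v x t - v x (t + (d - t) / ((n:ℝ) + 1))) ^ 2)) (fun n => (iF _ (mh n)).const_mul _)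
    (((S.rpt t htT).sq.add (S.rqt t htT).sq).int.add (S.rvt t htT).sq.psi_int) ?_ ?_ ?_
  · intro n x hx
    have := psi_pos hx
    positivity
  · intro x hx
    refine (((key S.sp x).add (key S.sq x)).add ((key S.sv x).const_mul (psi x))).congr fun n => ?_
    ring
  · intro n
    rw [integral_const_mul]
    have := step2 t ht _ (hhn n) (by linarith [hhn2 n])
    have h3 := hhn n
    calc _ ≤ (((d - t) / ((n:ℝ) + 1))⁻¹) ^ 2 * (E2 * ((d - t) / ((n:ℝ) + 1)) ^ 2) := by gcongr
      _ = E2 := by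
        generalize (d - t) / ((n:ℝ) + 1) = h at *
        field_simp
end


section
variable {α β γ T : ℝ} {p q v : ℝ → ℝ → ℝ}

theorem psi_lim : Tendsto psi atTop (𝓝 0) := by
  unfold psi
  exact tendsto_inv_atTop_zero.comp (tendsto_atTop_add_const_left _ _ tendsto_id)

theorem ptf {γ ψ p q p1 q1 v v1 v2 vt K : ℝ} (hψ0 : 0 ≤ ψ) (hψ1 : ψ ≤ 1) (hK : 0 ≤ K) (hv : |v| ≤ K + 1)
    (hn : p ^ 2 + q ^ 2 ≤ K) :
    (1/2) * (ψ * v2 ^ 2) ≤ (-ψ ^ 2 * (v1 * v2) + ψ * (v2 * v2 + v1 * (-vt - v * v1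
      + γ * (2 * p * p1 + 2 * q * q1)))) + 0 * 0
      + ((1/2) * (ψ * vt ^ 2) + (K + 2 + |γ| * (2 + K)) * (p ^ 2 + q ^ 2 + p1 ^ 2 + q1 ^ 2 + v ^ 2 + v1 ^ 2)) := by
  have g0 := abs_nonneg γ
  have a1 : ψ * (ψ * v1 * v2) ≤ (1/2) * (ψ * v2 ^ 2) + (1/2) * v1 ^ 2 := by
    have h1 : 0 ≤ ψ * (v2 - ψ * v1) ^ 2 := by positivity
    have h2 : ψ ^ 3 * v1 ^ 2 ≤ v1 ^ 2 := mul_le_of_le_one_left (by positivity) (pow_le_one₀ hψ0 hψ1)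
    linarith
  have a2 : ψ * (v1 * vt) ≤ (1/2) * (ψ * vt ^ 2) + (1/2) * v1 ^ 2 := by
    have h1 : 0 ≤ ψ * (v1 - vt) ^ 2 := by positivity
    have h2 : ψ * v1 ^ 2 ≤ v1 ^ 2 := mul_le_of_le_one_left (by positivity) hψ1
    linarith
  have a3 : ψ * (v * v1 ^ 2) ≤ (K + 1) * v1 ^ 2 := by
    calc ψ * (v * v1 ^ 2) ≤ 1 * ((K + 1) * v1 ^ 2) := by
          have := le_of_abs_le hv
          have h3 : v * v1 ^ 2 ≤ (K + 1) * v1 ^ 2 := by gcongr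
          have h4 : 0 ≤ (K + 1) * v1 ^ 2 := by positivity
          nlinarith
      _ = _ := one_mul _
  have a4 : -(ψ * (v1 * (γ * (2 * p * p1 + 2 * q * q1)))) ≤ |γ| * (2 * v1 ^ 2 + K * (p1 ^ 2 + q1 ^ 2)) := by
    have h1 : |v1 * (2 * p * p1 + 2 * q * q1)| ≤ 2 * v1 ^ 2 + K * (p1 ^ 2 + q1 ^ 2) := by
      have k1 : p ^ 2 * p1 ^ 2 ≤ K * p1 ^ 2 := by
        gcongr; nlinarith [sq_nonneg q]
      have k2 : q ^ 2 * q1 ^ 2 ≤ K * q1 ^ 2 := by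
        gcongr; nlinarith [sq_nonneg p]
      rw [abs_le]; constructor <;> nlinarith [sq_nonneg (v1 - p * p1), sq_nonneg (v1 - q * q1),
        sq_nonneg (v1 + p * p1), sq_nonneg (v1 + q * q1)]
    calc _ ≤ |-(ψ * (v1 * (γ * (2 * p * p1 + 2 * q * q1))))| := le_abs_self _
      _ = ψ * (|γ| * |v1 * (2 * p * p1 + 2 * q * q1)|) := by
        rw [abs_neg, abs_mul, abs_of_nonneg hψ0, ← abs_mul]; congr 2; ring
      _ ≤ 1 * (|γ| * (2 * v1 ^ 2 + K * (p1 ^ 2 + q1 ^ 2))) := by gcongr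
      _ = _ := one_mul _
  have b1 : (K + 2) * v1 ^ 2 ≤ (K + 2) * (p ^ 2 + q ^ 2 + p1 ^ 2 + q1 ^ 2 + v ^ 2 + v1 ^ 2) := by
    gcongr; nlinarith [sq_nonneg p, sq_nonneg q, sq_nonneg p1, sq_nonneg q1, sq_nonneg v]
  have b2 : |γ| * (2 * v1 ^ 2 + K * (p1 ^ 2 + q1 ^ 2))
      ≤ |γ| * ((2 + K) * (p ^ 2 + q ^ 2 + p1 ^ 2 + q1 ^ 2 + v ^ 2 + v1 ^ 2)) := by
    gcongr
    have : 0 ≤ (2 + K) * (p ^ 2 + q ^ 2 + v ^ 2) := by positivity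
    have : 0 ≤ K * v1 ^ 2 := by positivity
    have : 0 ≤ p1 ^ 2 + q1 ^ 2 := by positivity
    nlinarith
  linarith

set_option maxHeartbeats 1000000 in
theorem Sol.v2_bd (S : Sol α β γ T p q v) {c d K : ℝ} (hc : 0 ≤ c) (hcd : c ≤ d) (hd' : d ≤ T)
    (hK : ∀ t ∈ Icc c d, H p q v t ≤ K) :
    ∃ L, ∀ t ∈ Icc c d, ∫ x in Ioi (0:ℝ), psi x * pdx (pdx v) x t ^ 2 ≤ L := by
  obtain ⟨L0, hL0⟩ := S.dt_bd hc hcd hd' hK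
  obtain ⟨C0, hC00, hC0⟩ := cpt_bd (f := fun t => pdx v 0 t * pdx (pdx v) 0 t)
    ((S.sv.pdx.ct 0).mul (S.sv.pdx.pdx.ct 0)) 0 T
  have hcT : ∀ t ∈ Icc c d, t ∈ Icc 0 T := fun t ht => ⟨hc.trans ht.1, ht.2.trans hd'⟩
  have hK0 : 0 ≤ K := (H_nn c).trans (hK c ⟨le_rfl, hcd⟩)
  have g0 := abs_nonneg γ
  set C := K + 2 + |γ| * (2 + K) with hC
  have hCn : 0 ≤ C := by positivity
  refine ⟨2 * (C0 + (L0 + C * K)), fun t ht => ?_⟩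
  have htT := hcT t ht
  have i1 : IntegrableOn (fun x => (1/2) * (psi x * pdx (pdx v) x t ^ 2)) (Ioi 0) :=
    (S.rv2 t htT).sq.psi_int.const_mul _
  have j1 : IntegrableOn (fun x => (1/2) * (psi x * pdt v x t ^ 2)) (Ioi 0) :=
    (S.rvt t htT).sq.psi_int.const_mul _
  have j2 : IntegrableOn (fun x => C * hd p q v x t) (Ioi 0) := (S.rhd htT).int.const_mul _
  have lim1 := intervalIntegral_tendsto_integral_Ioi 0 i1 tendsto_id
  have lim2 : Tendsto (fun R => psi R * (pdx v R t * pdx (pdx v) R t) - psi 0 * (pdx v 0 t * pdx (pdx v) 0 t)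
      + 0 * (∫ x in (0:ℝ)..R, (0:ℝ)) + ∫ x in Ioi (0:ℝ), ((1/2) * (psi x * pdt v x t ^ 2) + C * hd p q v x t)) atTop
      (𝓝 (0 * (0 * 0) - psi 0 * (pdx v 0 t * pdx (pdx v) 0 t)
      + 0 + ∫ x in Ioi (0:ℝ), ((1/2) * (psi x * pdt v x t ^ 2) + C * hd p q v x t))) := by
    have h0 : Tendsto (fun R : ℝ => (0:ℝ) * (∫ _ in (0:ℝ)..R, (0:ℝ))) atTop (𝓝 0) := by simp
    exact (((psi_lim.mul ((S.rv1 t htT).lim.mul (S.rv2 t htT).lim)).sub_const _).add h0).add_const _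
  have := le_of_tendsto_of_tendsto lim1 lim2 ?_
  · rw [integral_const_mul, integral_add j1 j2, integral_const_mul, integral_const_mul] at this
    have e1 : psi 0 = 1 := by simp [psi]
    rw [e1] at this
    have h1 := neg_le_of_abs_le (hC0 t htT)
    have h2 : ∫ x in Ioi (0:ℝ), psi x * pdt v x t ^ 2 ≤ L0 := by
      refine le_trans ?_ (hL0 t ht)
      refine int_mono (S.rvt t htT).sq.psi_int (((S.rpt t htT).sq.add (S.rqt t htT).sq).int.add
        (S.rvt t htT).sq.psi_int) fun x _ => ?_
      nlinarith [sq_nonneg (pdt p x t), sq_nonneg (pdt q x t)]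
    have h3 : 0 ≤ ∫ x in Ioi (0:ℝ), psi x * pdt v x t ^ 2 := int_nn fun x hx => by
      have := psi_pos hx; positivity
    have h4 := mul_le_mul_of_nonneg_left (hK t ht) hCn
    unfold H at h4
    linarith
  · filter_upwards [eventually_ge_atTop 0] with R hR
    have hψc : ContinuousOn psi (Icc 0 R) := psi_contOn.mono fun x hx => hx.1
    have c1 := S.sp.cx t; have c2 := S.sq.cx t
    have c5 := S.sv.cx t; have c6 := S.sv.pdx.cx t
    have c7 := S.sv.pdx.pdx.cx t; have c8 := S.sv.pdx.pdx.pdx.cx t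
    refine slice_est (F := fun x => psi x * (pdx v x t * pdx (pdx v) x t))
      (F' := fun x => -psi x ^ 2 * (pdx v x t * pdx (pdx v) x t) + psi x * (pdx (pdx v) x t * pdx (pdx v) x t
        + pdx v x t * pdx (pdx (pdx v)) x t)) (g := fun _ => 0) (A := 0) hR ?_ (by fun_prop) ?_ (by fun_prop)
      (j1.add j2) ?_ ?_
    · intro x hx
      exact (psi_hasDeriv hx.1).fun_mul ((S.sv.pdx.hx x t).fun_mul (S.sv.pdx.pdx.hx x t))
    · show ContinuousOn (fun x => (1/2) * (psi x * pdx (pdx v) x t ^ 2)) _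
      fun_prop
    · intro x hx
      have := psi_pos hx
      have := hd_nn (p := p) (q := q) (v := v) x t
      positivity
    · intro x hx
      have hvV : |v x t| ≤ K + 1 := by
        have h6 := (S.v_le htT hx.1).trans (hK t ht)
        exact abs_le_of_sq_le_sq (by nlinarith) (by positivity)
      have := ptf (γ := γ) (p1 := pdx p x t) (q1 := pdx q x t) (v1 := pdx v x t) (v2 := pdx (pdx v) x t)
        (vt := pdt v x t) (psi_pos hx.1).le (psi_le_one hx.1) hK0 hvV ((S.n_le htT hx.1).trans (hK t ht))
      have e := S.ev x t hx.1 htT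
      have e' : pdx (pdx (pdx v)) x t = -pdt v x t - v x t * pdx v x t
        + γ * (2 * p x t * pdx p x t + 2 * q x t * pdx q x t) := by linarith
      rw [e']
      exact this
end


/-- dominating density for fluxes -/
def bd (p q v : ℝ → ℝ → ℝ) (x t : ℝ) : ℝ :=
  hd p q v x t + (pdt p x t ^ 2 + pdt q x t ^ 2 + psi x * pdt v x t ^ 2) + psi x * pdx (pdx v) x t ^ 2

/-- mass -/
def mf (p q : ℝ → ℝ → ℝ) (t : ℝ) : ℝ := ∫ x in Ioi (0:ℝ), (p x t ^ 2 + q x t ^ 2)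
/-- momentum density -/
def qd (κ : ℝ) (p q v : ℝ → ℝ → ℝ) (x t : ℝ) : ℝ :=
  κ * v x t ^ 2 + 2 * (q x t * pdx p x t - p x t * pdx q x t)
def Qf (κ : ℝ) (p q v : ℝ → ℝ → ℝ) (t : ℝ) : ℝ := ∫ x in Ioi (0:ℝ), qd κ p q v x t
/-- energy density -/
def ed (α β κ : ℝ) (p q v : ℝ → ℝ → ℝ) (x t : ℝ) : ℝ :=
  pdx p x t ^ 2 + pdx q x t ^ 2 + α * (v x t * (p x t ^ 2 + q x t ^ 2))
    + (β / 2) * (p x t ^ 2 + q x t ^ 2) ^ 2 + κ * ((1/2) * pdx v x t ^ 2 - (1/6) * v x t ^ 3)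
def Ef (α β κ : ℝ) (p q v : ℝ → ℝ → ℝ) (t : ℝ) : ℝ := ∫ x in Ioi (0:ℝ), ed α β κ p q v x t

def qflux (β κ : ℝ) (p q v : ℝ → ℝ → ℝ) (x t : ℝ) : ℝ :=
  κ * (-2 * (v x t * pdx (pdx v) x t) + pdx v x t ^ 2 - (2/3) * v x t ^ 3)
   + 2 * (q x t * pdt p x t - p x t * pdt q x t) + 2 * (pdx p x t ^ 2 + pdx q x t ^ 2)
   - β * (p x t ^ 2 + q x t ^ 2) ^ 2
def eflux (γ κ : ℝ) (p q v : ℝ → ℝ → ℝ) (x t : ℝ) : ℝ :=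
  2 * (pdx p x t * pdt p x t + pdx q x t * pdt q x t)
   + κ * (pdx v x t * pdt v x t + (1/2) * (pdx (pdx v) x t + (1/2) * v x t ^ 2 - γ * (p x t ^ 2 + q x t ^ 2)) ^ 2)

section
variable {α β γ T κ : ℝ} {p q v : ℝ → ℝ → ℝ}

theorem bd_ge {x t : ℝ} (hx : 0 ≤ x) : hd p q v x t ≤ bd p q v x t := by
  have := psi_pos hx
  unfold bd
  have : 0 ≤ (pdt p x t ^ 2 + pdt q x t ^ 2 + psi x * pdt v x t ^ 2) := by positivity
  have : 0 ≤ psi x * pdx (pdx v) x t ^ 2 := by positivity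
  linarith

theorem Sol.bd_int (S : Sol α β γ T p q v) {t : ℝ} (ht : t ∈ Icc 0 T) :
    IntegrableOn (fun x => bd p q v x t) (Ioi 0) :=
  ((S.rhd ht).int.add (((S.rpt t ht).sq.add (S.rqt t ht).sq).int.add (S.rvt t ht).sq.psi_int)).add
    (S.rv2 t ht).sq.psi_int

theorem Sol.bd_bd (S : Sol α β γ T p q v) {c d K : ℝ} (hc : 0 ≤ c) (hcd : c ≤ d) (hd' : d ≤ T)
    (hK : ∀ t ∈ Icc c d, H p q v t ≤ K) :
    ∃ L, ∀ t ∈ Icc c d, ∫ x in Ioi (0:ℝ), bd p q v x t ≤ L := by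
  obtain ⟨L0, hL0⟩ := S.dt_bd hc hcd hd' hK
  obtain ⟨L1, hL1⟩ := S.v2_bd hc hcd hd' hK
  refine ⟨K + L0 + L1, fun t ht => ?_⟩
  have htT : t ∈ Icc 0 T := ⟨hc.trans ht.1, ht.2.trans hd'⟩
  have i1 := (S.rhd htT).int
  have i2 : IntegrableOn (fun x => pdt p x t ^ 2 + pdt q x t ^ 2 + psi x * pdt v x t ^ 2) (Ioi 0) :=
    ((S.rpt t htT).sq.add (S.rqt t htT).sq).int.add (S.rvt t htT).sq.psi_int
  have i12 : IntegrableOn (fun x => hd p q v x t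
    + (pdt p x t ^ 2 + pdt q x t ^ 2 + psi x * pdt v x t ^ 2)) (Ioi 0) := i1.add i2
  unfold bd
  rw [integral_add i12 (S.rv2 t htT).sq.psi_int, integral_add i1 i2]
  have h1 := hK t ht
  unfold H at h1
  linarith [hL0 t ht, hL1 t ht]

theorem Sol.j_le {x t : ℝ} : |2 * (q x t * pdx p x t - p x t * pdx q x t)| ≤ hd p q v x t := by
  unfold hd
  rw [abs_le]; constructor <;> nlinarith [sq_nonneg (q x t + pdx p x t), sq_nonneg (p x t - pdx q x t),
    sq_nonneg (q x t - pdx p x t), sq_nonneg (p x t + pdx q x t), sq_nonneg (v x t), sq_nonneg (pdx v x t)]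

theorem Sol.j_sm (S : Sol α β γ T p q v) : Sm (fun x t => 2 * (q x t * pdx p x t - p x t * pdx q x t)) :=
  ((S.sq.mul S.sp.pdx).sub (S.sp.mul S.sq.pdx)).cmul 2

theorem Sol.rn (S : Sol α β γ T p q v) {t : ℝ} (ht : t ∈ Icc 0 T) : RD fun x => p x t ^ 2 + q x t ^ 2 :=
  (S.rp t ht).sq.add (S.rq t ht).sq

theorem Sol.cons_m (S : Sol α β γ T p q v) {c d K : ℝ} (hc : 0 ≤ c) (hcd : c ≤ d) (hd' : d ≤ T)
    (hK : ∀ t ∈ Icc c d, H p q v t ≤ K) : mf p q d = mf p q c := by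
  have hcT : ∀ t ∈ Icc c d, t ∈ Icc 0 T := fun t ht => ⟨hc.trans ht.1, ht.2.trans hd'⟩
  have := (CL (ρ := fun x t => p x t ^ 2 + q x t ^ 2)
    (Φ := fun x t => 2 * (q x t * pdx p x t - p x t * pdx q x t)) (σ := fun _ _ => 0)
    (B := hd p q v) S.n_sm S.j_sm (Sm.const 0) hcd
    (fun x t hx ht => by
      rw [S.nt hx (hcT t ht), add_zero]
      exact ((S.jx x t).const_mul 2).deriv.symm)
    (fun t ht => (S.rn (hcT t ht)).int) (fun t ht => (S.rhd (hcT t ht)).int) hK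
    (fun x t hx ht => by
      have := hd_nn (p := p) (q := q) (v := v) x t
      refine (Sol.j_le (v := v)).trans ?_
      nlinarith)
    (fun x t hx ht => by simpa using hd_nn (p := p) (q := q) (v := v) x t)).2
  have h0 : ∫ t in c..d, ((∫ x in Ioi (0:ℝ), (0:ℝ)) - 2 * (q 0 t * pdx p 0 t - p 0 t * pdx q 0 t)) = 0 := by
    rw [intervalIntegral.integral_congr (g := fun _ => 0)]
    · simp
    · intro t ht
      rw [uIcc_of_le hcd] at ht
      simp [S.p0 t (hcT t ht), S.q0 t (hcT t ht)]
  rw [h0] at this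
  unfold mf
  linarith

theorem Sol.cons_M (S : Sol α β γ T p q v) {c d K : ℝ} (hc : 0 ≤ c) (hcd : c ≤ d) (hd' : d ≤ T)
    (hK : ∀ t ∈ Icc c d, H p q v t ≤ K) :
    IntervalIntegrable (fun t => ∫ x in Ioi (0:ℝ), -(2 * (q x t * pdx p x t - p x t * pdx q x t))) volume c d ∧
    (∫ x in Ioi (0:ℝ), x * (p x d ^ 2 + q x d ^ 2)) - (∫ x in Ioi (0:ℝ), x * (p x c ^ 2 + q x c ^ 2))
     = ∫ t in c..d, ∫ x in Ioi (0:ℝ), -(2 * (q x t * pdx p x t - p x t * pdx q x t)) := by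
  have hcT : ∀ t ∈ Icc c d, t ∈ Icc 0 T := fun t ht => ⟨hc.trans ht.1, ht.2.trans hd'⟩
  have := CL (ρ := fun x t => x * (p x t ^ 2 + q x t ^ 2))
    (Φ := fun x t => x * (2 * (q x t * pdx p x t - p x t * pdx q x t)))
    (σ := fun x t => -(2 * (q x t * pdx p x t - p x t * pdx q x t)))
    (B := hd p q v) (Sm.fst.mul S.n_sm) (Sm.fst.mul S.j_sm) S.j_sm.neg hcd
    (fun x t hx ht => by
      have e1 : pdt (fun x t => x * (p x t ^ 2 + q x t ^ 2)) x t
        = x * pdt (fun x t => (p x t ^ 2 + q x t ^ 2)) x t := ((S.n_sm.ht x t).const_mul x).deriv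
      have e2 := ((hasDerivAt_id' x).fun_mul ((S.jx x t).const_mul 2)).deriv
      rw [e1, S.nt hx (hcT t ht)]
      simp only [pdx] at e2 ⊢
      rw [e2]; ring)
    (fun t ht => (S.rn (hcT t ht)).xmul.int) (fun t ht => (S.rhd (hcT t ht)).int) hK
    (fun x t hx ht => by
      have h1 := hd_nn (p := p) (q := q) (v := v) x t
      have h2 := (Sol.j_le (p := p) (q := q) (v := v) (x := x) (t := t))
      rw [abs_mul, abs_of_nonneg hx]
      nlinarith)
    (fun x t hx ht => by rw [abs_neg]; exact Sol.j_le)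
  simpa using this

theorem Sol.qd_sm (S : Sol α β γ T p q v) : Sm (qd κ p q v) := ((S.sv.pow 2).cmul κ).add S.j_sm
theorem Sol.qd_rd (S : Sol α β γ T p q v) {t : ℝ} (ht : t ∈ Icc 0 T) : RD fun x => qd κ p q v x t :=
  ((S.rv t ht).sq.cmul κ).add ((((S.rq t ht).mul (S.rp1 t ht)).sub ((S.rp t ht).mul (S.rq1 t ht))).cmul 2)
theorem Sol.ed_sm (S : Sol α β γ T p q v) : Sm (ed α β κ p q v) :=
  (((((S.sp.pdx.pow 2).add (S.sq.pdx.pow 2)).add ((S.sv.mul S.n_sm).cmul α)).add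
    ((S.n_sm.pow 2).cmul (β/2))).add ((((S.sv.pdx.pow 2).cmul (1/2)).sub ((S.sv.pow 3).cmul (1/6))).cmul κ))
theorem Sol.ed_rd (S : Sol α β γ T p q v) {t : ℝ} (ht : t ∈ Icc 0 T) : RD fun x => ed α β κ p q v x t :=
  (((((S.rp1 t ht).sq.add (S.rq1 t ht).sq).add (((S.rv t ht).mul (S.rn ht)).cmul α)).add
    ((S.rn ht).sq.cmul (β/2))).add ((((S.rv1 t ht).sq.cmul (1/2)).sub ((S.rv t ht).cube.cmul (1/6))).cmul κ))
theorem Sol.qflux_sm (S : Sol α β γ T p q v) : Sm (qflux β κ p q v) :=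
  ((((((S.sv.mul S.sv.pdx.pdx).cmul (-2)).add (S.sv.pdx.pow 2)).sub ((S.sv.pow 3).cmul (2/3))).cmul κ).add
    (((S.sq.mul S.sp.pdt).sub (S.sp.mul S.sq.pdt)).cmul 2)).add
    (((S.sp.pdx.pow 2).add (S.sq.pdx.pow 2)).cmul 2) |>.sub ((S.n_sm.pow 2).cmul β)
theorem Sol.eflux_sm (S : Sol α β γ T p q v) : Sm (eflux γ κ p q v) :=
  (((S.sp.pdx.mul S.sp.pdt).add (S.sq.pdx.mul S.sq.pdt)).cmul 2).add
    (((S.sv.pdx.mul S.sv.pdt).add (((S.sv.pdx.pdx.add ((S.sv.pow 2).cmul (1/2))).sub (S.n_sm.cmul γ)).pow 2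
      |>.cmul (1/2))).cmul κ)

theorem cube_hasDeriv {f : ℝ → ℝ} {x f' : ℝ} (h : HasDerivAt f f' x) :
    HasDerivAt (fun x => f x ^ 3) (3 * f x ^ 2 * f') x := (h.fun_pow 3).congr_deriv (by simp)

theorem Sol.qd_eq (S : Sol α β γ T p q v) (hκ : κ * γ = α) {x t : ℝ} (hx : 0 ≤ x) (ht : t ∈ Icc 0 T) :
    pdt (qd κ p q v) x t = pdx (qflux β κ p q v) x t := by
  have e1 : pdt (qd κ p q v) x t = _ := (((sq_hasDeriv (S.sv.ht x t)).const_mul κ).fun_add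
    ((((S.sq.ht x t).fun_mul (S.sp.pdx.ht x t)).fun_sub ((S.sp.ht x t).fun_mul (S.sq.pdx.ht x t))).const_mul 2)).deriv
  have hn := (sq_hasDeriv (S.sp.hx x t)).fun_add (sq_hasDeriv (S.sq.hx x t))
  have e2 : pdx (qflux β κ p q v) x t = _ :=
    (((((((S.sv.hx x t).fun_mul (S.sv.pdx.pdx.hx x t)).const_mul (-2)).fun_add
      (sq_hasDeriv (S.sv.pdx.hx x t))).fun_sub ((cube_hasDeriv (S.sv.hx x t)).const_mul (2/3))).const_mul κ).fun_add
    ((((S.sq.hx x t).fun_mul (S.sp.pdt.hx x t)).fun_sub ((S.sp.hx x t).fun_mul (S.sq.pdt.hx x t))).const_mul 2)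
    |>.fun_add (((sq_hasDeriv (S.sp.pdx.hx x t)).fun_add (sq_hasDeriv (S.sq.pdx.hx x t))).const_mul 2)
    |>.fun_sub ((sq_hasDeriv hn).const_mul β)).deriv
  rw [e1, e2, S.sp.comm, S.sq.comm]
  have h1 := S.ep x t hx ht
  have h2 := S.eq x t hx ht
  have h3 := S.ev x t hx ht
  have h1' : pdx (pdx q) x t = -pdt p x t + (α * v x t + β * (p x t ^ 2 + q x t ^ 2)) * q x t := by linarith
  have h2' : pdx (pdx p) x t = pdt q x t + (α * v x t + β * (p x t ^ 2 + q x t ^ 2)) * p x t := by linarith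
  rw [h3, h1', h2', ← hκ]
  ring

theorem Sol.ed_eq (S : Sol α β γ T p q v) (hκ : κ * γ = α) {x t : ℝ} (hx : 0 ≤ x) (ht : t ∈ Icc 0 T) :
    pdt (ed α β κ p q v) x t = pdx (eflux γ κ p q v) x t := by
  have hn := (sq_hasDeriv (S.sp.hx x t)).fun_add (sq_hasDeriv (S.sq.hx x t))
  have hnt := (sq_hasDeriv (S.sp.ht x t)).fun_add (sq_hasDeriv (S.sq.ht x t))
  have e1 : pdt (ed α β κ p q v) x t = _ :=
    ((((sq_hasDeriv (S.sp.pdx.ht x t)).fun_add (sq_hasDeriv (S.sq.pdx.ht x t))).fun_add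
      (((S.sv.ht x t).fun_mul hnt).const_mul α)).fun_add ((sq_hasDeriv hnt).const_mul (β/2))
     |>.fun_add ((((sq_hasDeriv (S.sv.pdx.ht x t)).const_mul (1/2)).fun_sub
       ((cube_hasDeriv (S.sv.ht x t)).const_mul (1/6))).const_mul κ)).deriv
  have e2 : pdx (eflux γ κ p q v) x t = _ :=
    (((((S.sp.pdx.hx x t).fun_mul (S.sp.pdt.hx x t)).fun_add ((S.sq.pdx.hx x t).fun_mul (S.sq.pdt.hx x t))).const_mul 2).fun_add
    ((((S.sv.pdx.hx x t).fun_mul (S.sv.pdt.hx x t)).fun_add ((sq_hasDeriv (((S.sv.pdx.pdx.hx x t).fun_add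
      ((sq_hasDeriv (S.sv.hx x t)).const_mul (1/2))).fun_sub (hn.const_mul γ))).const_mul (1/2))).const_mul κ)).deriv
  rw [e1, e2, S.sp.comm, S.sq.comm, S.sv.comm]
  have h1 := S.ep x t hx ht
  have h2 := S.eq x t hx ht
  have h3 := S.ev x t hx ht
  have h1' : pdx (pdx q) x t = -pdt p x t + (α * v x t + β * (p x t ^ 2 + q x t ^ 2)) * q x t := by linarith
  have h2' : pdx (pdx p) x t = pdt q x t + (α * v x t + β * (p x t ^ 2 + q x t ^ 2)) * p x t := by linarith
  have h3' : pdx (pdx (pdx v)) x t = -pdt v x t - v x t * pdx v x t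
        + γ * (2 * p x t * pdx p x t + 2 * q x t * pdx q x t) := by linarith
  rw [h3', h1', h2', ← hκ]
  ring
end


section
variable {α β γ T κ : ℝ} {p q v : ℝ → ℝ → ℝ}

/-- pointwise comparisons with the weighted dominating density -/
theorem bd_facts (x t : ℝ) (hx : 0 ≤ x) :
    0 ≤ bd p q v x t ∧ bd p q v x t ≤ (1 + x) * bd p q v x t ∧
    pdx (pdx v) x t ^ 2 + pdt v x t ^ 2 + v x t ^ 2 + pdx v x t ^ 2 ≤ (1 + x) * bd p q v x t ∧
    p x t ^ 2 + q x t ^ 2 + (pdx p x t ^ 2 + pdx q x t ^ 2) + (pdt p x t ^ 2 + pdt q x t ^ 2)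
      + v x t ^ 2 + pdx v x t ^ 2 ≤ (1 + x) * bd p q v x t := by
  have h0 : 0 ≤ bd p q v x t := (hd_nn x t).trans (bd_ge hx)
  have h1 : bd p q v x t ≤ (1 + x) * bd p q v x t := by nlinarith
  have hp := psi_mul hx
  have hp0 := psi_pos hx
  refine ⟨h0, h1, ?_, ?_⟩
  · have e : (1 + x) * bd p q v x t = (1 + x) * (p x t ^ 2 + q x t ^ 2 + pdx p x t ^ 2 + pdx q x t ^ 2
      + pdt p x t ^ 2 + pdt q x t ^ 2) + (1 + x) * (v x t ^ 2 + pdx v x t ^ 2)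
      + ((1 + x) * psi x) * (pdt v x t ^ 2 + pdx (pdx v) x t ^ 2) := by
      unfold bd hd; ring
    rw [e, hp]
    have : 0 ≤ (1 + x) * (p x t ^ 2 + q x t ^ 2 + pdx p x t ^ 2 + pdx q x t ^ 2
      + pdt p x t ^ 2 + pdt q x t ^ 2) := by positivity
    have : 0 ≤ x * (v x t ^ 2 + pdx v x t ^ 2) := by positivity
    linarith
  · refine le_trans ?_ h1
    unfold bd hd
    have : 0 ≤ psi x * pdt v x t ^ 2 := by positivity
    have : 0 ≤ psi x * pdx (pdx v) x t ^ 2 := by positivity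
    linarith

theorem qflux_arith {κ β K z p q v px qx pt qt vx w : ℝ} (hκ : 0 ≤ κ) (hK : 0 ≤ K)
    (hn : p ^ 2 + q ^ 2 ≤ K) (hv : v ^ 2 ≤ K) (h1 : w ^ 2 + v ^ 2 + vx ^ 2 ≤ z)
    (h2 : p ^ 2 + q ^ 2 + (px ^ 2 + qx ^ 2) + (pt ^ 2 + qt ^ 2) ≤ z) :
    |κ * (-2 * (v * w) + vx ^ 2 - (2/3) * v ^ 3) + 2 * (q * pt - p * qt) + 2 * (px ^ 2 + qx ^ 2)
      - β * (p ^ 2 + q ^ 2) ^ 2| ≤ (κ * (3 + K) + 3 + |β| * K) * z := by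
  have a1 : |-2 * (v * w) + vx ^ 2 - (2/3) * v ^ 3| ≤ (3 + K) * z := by
    have hv3 : |v ^ 3| ≤ (K + 1) * v ^ 2 := by
      have : |v| ≤ K + 1 := abs_le.2 ⟨by nlinarith, by nlinarith⟩
      rw [show v ^ 3 = v * v ^ 2 by ring, abs_mul, abs_of_nonneg (sq_nonneg v)]
      exact mul_le_mul_of_nonneg_right this (sq_nonneg v)
    have : (K + 1) * v ^ 2 ≤ (K + 1) * z := by
      apply mul_le_mul_of_nonneg_left _ (by linarith); nlinarith [sq_nonneg w, sq_nonneg vx]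
    have h3 := abs_le.1 hv3
    rw [abs_le]
    constructor <;> nlinarith [sq_nonneg (v + w), sq_nonneg (v - w), sq_nonneg vx, sq_nonneg v, sq_nonneg w]
  have a2 : |2 * (q * pt - p * qt)| ≤ z := by
    rw [abs_le]
    constructor <;> nlinarith [sq_nonneg (q + pt), sq_nonneg (q - pt), sq_nonneg (p - qt), sq_nonneg (p + qt),
      sq_nonneg px, sq_nonneg qx]
  have a3 : |2 * (px ^ 2 + qx ^ 2)| ≤ 2 * z := by
    rw [abs_of_nonneg (by positivity)]
    nlinarith [sq_nonneg p, sq_nonneg q, sq_nonneg pt, sq_nonneg qt]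
  have a4 : |β * (p ^ 2 + q ^ 2) ^ 2| ≤ |β| * K * z := by
    rw [abs_mul, mul_assoc, abs_of_nonneg (sq_nonneg (p ^ 2 + q ^ 2))]
    apply mul_le_mul_of_nonneg_left _ (abs_nonneg β)
    rw [sq]
    apply mul_le_mul hn _ (by positivity) hK
    nlinarith [sq_nonneg px, sq_nonneg qx, sq_nonneg pt, sq_nonneg qt]
  have a5 : |κ * (-2 * (v * w) + vx ^ 2 - (2/3) * v ^ 3)| ≤ κ * ((3 + K) * z) := by
    rw [abs_mul, abs_of_nonneg hκ]; exact mul_le_mul_of_nonneg_left a1 hκ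
  rw [abs_le] at *
  constructor <;> linarith [a5.1, a5.2, a2.1, a2.2, a3.1, a3.2, a4.1, a4.2]

theorem eflux_arith {κ γ K z p q v px qx pt qt vx vt w : ℝ} (hκ : 0 ≤ κ) (hK : 0 ≤ K)
    (hn : p ^ 2 + q ^ 2 ≤ K) (hv : v ^ 2 ≤ K) (h1 : w ^ 2 + vt ^ 2 + v ^ 2 + vx ^ 2 ≤ z)
    (h2 : p ^ 2 + q ^ 2 + (px ^ 2 + qx ^ 2) + (pt ^ 2 + qt ^ 2) ≤ z) :
    |2 * (px * pt + qx * qt) + κ * (vx * vt + (1/2) * (w + (1/2) * v ^ 2 - γ * (p ^ 2 + q ^ 2)) ^ 2)|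
      ≤ (1 + κ * (3 + 2 * K + 2 * γ ^ 2 * K)) * z := by
  have hz : 0 ≤ z := le_trans (by positivity) h2
  have a2 : |2 * (px * pt + qx * qt)| ≤ z := by
    rw [abs_le]
    constructor <;> nlinarith [sq_nonneg (px + pt), sq_nonneg (px - pt), sq_nonneg (qx - qt), sq_nonneg (qx + qt),
      sq_nonneg p, sq_nonneg q]
  have hv4 : (v ^ 2) ^ 2 ≤ K * z := by
    rw [sq]; apply mul_le_mul hv _ (by positivity) hK
    nlinarith [sq_nonneg w, sq_nonneg vt, sq_nonneg vx]
  have hn2 : (p ^ 2 + q ^ 2) ^ 2 ≤ K * z := by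
    rw [sq]; apply mul_le_mul hn _ (by positivity) hK
    nlinarith [sq_nonneg px, sq_nonneg qx, sq_nonneg pt, sq_nonneg qt]
  have hg : (γ * (p ^ 2 + q ^ 2)) ^ 2 ≤ γ ^ 2 * (K * z) := by
    rw [mul_pow]; exact mul_le_mul_of_nonneg_left hn2 (sq_nonneg γ)
  have hs : (w + (1/2) * v ^ 2 - γ * (p ^ 2 + q ^ 2)) ^ 2 ≤ 3 * (w ^ 2 + (v ^ 2) ^ 2 + (γ * (p ^ 2 + q ^ 2)) ^ 2) := by
    set a := v ^ 2
    set b := γ * (p ^ 2 + q ^ 2)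
    nlinarith [sq_nonneg (w - (1/2) * a), sq_nonneg (w + b), sq_nonneg ((1/2) * a + b), sq_nonneg a]
  have hw : w ^ 2 ≤ z := by nlinarith [sq_nonneg v, sq_nonneg vt, sq_nonneg vx]
  have a1 : |vx * vt + (1/2) * (w + (1/2) * v ^ 2 - γ * (p ^ 2 + q ^ 2)) ^ 2| ≤ (3 + 2 * K + 2 * γ ^ 2 * K) * z := by
    have hs0 := sq_nonneg (w + (1/2) * v ^ 2 - γ * (p ^ 2 + q ^ 2))
    have hKz : 0 ≤ K * z := by positivity
    have hgKz : 0 ≤ γ ^ 2 * (K * z) := by positivity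
    have b1 : vx * vt ≤ z := by nlinarith [sq_nonneg (vx - vt), sq_nonneg v, sq_nonneg w]
    have b2 : -z ≤ vx * vt := by nlinarith [sq_nonneg (vx + vt), sq_nonneg v, sq_nonneg w]
    rw [abs_le]
    constructor <;> linarith [sq_nonneg v, sq_nonneg w, sq_nonneg vx, sq_nonneg vt]
  have a5 : |κ * (vx * vt + (1/2) * (w + (1/2) * v ^ 2 - γ * (p ^ 2 + q ^ 2)) ^ 2)|
      ≤ κ * ((3 + 2 * K + 2 * γ ^ 2 * K) * z) := by
    rw [abs_mul, abs_of_nonneg hκ]; exact mul_le_mul_of_nonneg_left a1 hκ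
  refine (abs_add_le _ _).trans ?_
  linarith

theorem Sol.cons_Q (S : Sol α β γ T p q v) (hκ : κ * γ = α) (hκ0 : 0 ≤ κ) {c d K : ℝ} (hc : 0 ≤ c) (hcd : c ≤ d)
    (hd' : d ≤ T) (hK : ∀ t ∈ Icc c d, H p q v t ≤ K) :
    Qf κ p q v d - Qf κ p q v c = ∫ t in c..d, - qflux β κ p q v 0 t := by
  have hcT : ∀ t ∈ Icc c d, t ∈ Icc 0 T := fun t ht => ⟨hc.trans ht.1, ht.2.trans hd'⟩
  have hK0 : 0 ≤ K := (H_nn c).trans (hK c ⟨le_rfl, hcd⟩)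
  obtain ⟨L, hL⟩ := S.bd_bd hc hcd hd' hK
  have hC0 : 0 ≤ κ * (3 + K) + 3 + |β| * K := by positivity
  have := (CL (ρ := qd κ p q v) (Φ := qflux β κ p q v) (σ := fun _ _ => 0)
    (B := fun x t => (κ * (3 + K) + 3 + |β| * K) * bd p q v x t) (L := (κ * (3 + K) + 3 + |β| * K) * L)
    S.qd_sm S.qflux_sm (Sm.const 0) hcd
    (fun x t hx ht => by rw [S.qd_eq hκ hx (hcT t ht), add_zero])
    (fun t ht => (S.qd_rd (hcT t ht)).int) (fun t ht => (S.bd_int (hcT t ht)).const_mul _)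
    (fun t ht => by rw [integral_const_mul]; exact mul_le_mul_of_nonneg_left (hL t ht) hC0)
    (fun x t hx ht => by
      obtain ⟨f1, f2, f3, f4⟩ := bd_facts (p := p) (q := q) (v := v) x t hx
      have := qflux_arith (β := β) (z := (1 + x) * bd p q v x t) hκ0 hK0
        ((S.n_le (hcT t ht) hx).trans (hK t ht)) ((S.v_le (hcT t ht) hx).trans (hK t ht))
        (w := pdx (pdx v) x t) (vx := pdx v x t) (px := pdx p x t) (qx := pdx q x t) (pt := pdt p x t) (qt := pdt q x t)
        (by nlinarith [sq_nonneg (pdt v x t)])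
        (by nlinarith [sq_nonneg (v x t), sq_nonneg (pdx v x t)])
      rw [show (1 + x) * ((κ * (3 + K) + 3 + |β| * K) * bd p q v x t)
        = (κ * (3 + K) + 3 + |β| * K) * ((1 + x) * bd p q v x t) by ring]
      exact this)
    (fun x t hx ht => by
      have := (bd_facts (p := p) (q := q) (v := v) x t hx).1
      simp only [abs_zero]; positivity)).2
  simpa [Qf] using this

theorem Sol.cons_E (S : Sol α β γ T p q v) (hκ : κ * γ = α) (hκ0 : 0 ≤ κ) {c d K : ℝ} (hc : 0 ≤ c) (hcd : c ≤ d)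
    (hd' : d ≤ T) (hK : ∀ t ∈ Icc c d, H p q v t ≤ K) :
    Ef α β κ p q v d - Ef α β κ p q v c = ∫ t in c..d, - eflux γ κ p q v 0 t := by
  have hcT : ∀ t ∈ Icc c d, t ∈ Icc 0 T := fun t ht => ⟨hc.trans ht.1, ht.2.trans hd'⟩
  have hK0 : 0 ≤ K := (H_nn c).trans (hK c ⟨le_rfl, hcd⟩)
  obtain ⟨L, hL⟩ := S.bd_bd hc hcd hd' hK
  have hC0 : 0 ≤ 1 + κ * (3 + 2 * K + 2 * γ ^ 2 * K) := by positivity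
  have := (CL (ρ := ed α β κ p q v) (Φ := eflux γ κ p q v) (σ := fun _ _ => 0)
    (B := fun x t => (1 + κ * (3 + 2 * K + 2 * γ ^ 2 * K)) * bd p q v x t)
    (L := (1 + κ * (3 + 2 * K + 2 * γ ^ 2 * K)) * L)
    S.ed_sm S.eflux_sm (Sm.const 0) hcd
    (fun x t hx ht => by rw [S.ed_eq hκ hx (hcT t ht), add_zero])
    (fun t ht => (S.ed_rd (hcT t ht)).int) (fun t ht => (S.bd_int (hcT t ht)).const_mul _)
    (fun t ht => by rw [integral_const_mul]; exact mul_le_mul_of_nonneg_left (hL t ht) hC0)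
    (fun x t hx ht => by
      obtain ⟨f1, f2, f3, f4⟩ := bd_facts (p := p) (q := q) (v := v) x t hx
      have := eflux_arith (γ := γ) (z := (1 + x) * bd p q v x t) hκ0 hK0
        ((S.n_le (hcT t ht) hx).trans (hK t ht)) ((S.v_le (hcT t ht) hx).trans (hK t ht))
        (w := pdx (pdx v) x t) (vx := pdx v x t) (vt := pdt v x t) (px := pdx p x t) (qx := pdx q x t)
        (pt := pdt p x t) (qt := pdt q x t) f3
        (by nlinarith [sq_nonneg (v x t), sq_nonneg (pdx v x t)])
      rw [show (1 + x) * ((1 + κ * (3 + 2 * K + 2 * γ ^ 2 * K)) * bd p q v x t)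
        = (1 + κ * (3 + 2 * K + 2 * γ ^ 2 * K)) * ((1 + x) * bd p q v x t) by ring]
      exact this)
    (fun x t hx ht => by
      have := (bd_facts (p := p) (q := q) (v := v) x t hx).1
      simp only [abs_zero]; positivity)).2
  simpa [Ef] using this

theorem Sol.Q_mono (S : Sol α β γ T p q v) (hκ : κ * γ = α) (hκ0 : 0 ≤ κ) {c d K : ℝ} (hc : 0 ≤ c) (hcd : c ≤ d)
    (hd' : d ≤ T) (hK : ∀ t ∈ Icc c d, H p q v t ≤ K) : Qf κ p q v d ≤ Qf κ p q v c := by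
  have h := S.cons_Q hκ hκ0 hc hcd hd' hK
  have : 0 ≤ ∫ t in c..d, qflux β κ p q v 0 t := by
    apply intervalIntegral.integral_nonneg hcd
    intro t ht
    have htT : t ∈ Icc 0 T := ⟨hc.trans ht.1, ht.2.trans hd'⟩
    unfold qflux
    rw [S.p0 t htT, S.q0 t htT, S.v0 t htT]
    have : 0 ≤ κ * pdx v 0 t ^ 2 := by positivity
    nlinarith [sq_nonneg (pdx p 0 t), sq_nonneg (pdx q 0 t)]
  rw [intervalIntegral.integral_neg] at h
  linarith

theorem flux_int {f : ℝ → ℝ} {C c d T : ℝ} (hC0 : 0 ≤ C) (hC : ∀ t ∈ Icc 0 T, |f t| ≤ C) (hc : 0 ≤ c) (hcd : c ≤ d)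
    (hd' : d ≤ T) : |∫ t in c..d, - f t| ≤ C * T := by
  have := intervalIntegral.norm_integral_le_of_norm_le_const (a := c) (b := d) (f := fun t => - f t) (C := C)
    (fun t ht => by
      rw [uIoc_of_le hcd] at ht
      rw [norm_neg]; exact hC t ⟨hc.trans ht.1.le, ht.2.trans hd'⟩)
  rw [Real.norm_eq_abs, abs_of_nonneg (by linarith : 0 ≤ d - c)] at this
  nlinarith

/-- Q and E vary by a bounded amount over good intervals -/
theorem Sol.QE_var (S : Sol α β γ T p q v) (hκ : κ * γ = α) (hκ0 : 0 ≤ κ) :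
    ∃ C, 0 ≤ C ∧ ∀ c d K : ℝ, 0 ≤ c → c ≤ d → d ≤ T → (∀ t ∈ Icc c d, H p q v t ≤ K) →
      |Qf κ p q v d - Qf κ p q v c| ≤ C ∧ |Ef α β κ p q v d - Ef α β κ p q v c| ≤ C := by
  obtain ⟨C1, h1, hC1⟩ := cpt_bd ((S.qflux_sm (κ := κ)).ct 0) 0 T
  obtain ⟨C2, h2, hC2⟩ := cpt_bd ((S.eflux_sm (κ := κ)).ct 0) 0 T
  refine ⟨(C1 + C2) * |T|, by positivity, fun c d K hc hcd hd' hK => ?_⟩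
  have hT : 0 ≤ T := hc.trans (hcd.trans hd')
  rw [S.cons_Q hκ hκ0 hc hcd hd' hK, S.cons_E hκ hκ0 hc hcd hd' hK, abs_of_nonneg hT]
  have := flux_int h1 hC1 hc hcd hd'
  have := flux_int h2 hC2 hc hcd hd'
  constructor <;> nlinarith
end


set_option maxHeartbeats 2000000 in
theorem coer_arith (A B κ m0 q0 e0 : ℝ) (hA : 0 ≤ A) (hB : 0 ≤ B) (hκ : 0 < κ) (hm : 0 ≤ m0) (hq : 0 ≤ q0) :
    ∃ C : ℝ, ∀ a b e I1 I2 I3 : ℝ, 0 ≤ a → 0 ≤ b → 0 ≤ e →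
      (∀ δ, 0 < δ → κ * b ≤ q0 + m0 / δ + δ * a) →
      (∀ η, 0 < η → I2 ≤ m0 * (m0 / η + η * a)) →
      (I1 ≤ b + I2) →
      (∀ ω μ, 0 < ω → 0 < μ → I3 ≤ ω * b + (b / μ + μ * e) * b / ω) →
      a + κ / 2 * e ≤ e0 + A * I1 + B * I2 + κ * I3 → a + b + e ≤ C := by
  obtain ⟨C1, hC1⟩ : ∃ C1, C1 = (q0 + m0 + 1) / κ := ⟨_, rfl⟩
  have hC1p : 0 < C1 := by rw [hC1]; positivity
  obtain ⟨ε, hε⟩ : ∃ ε, ε = 1 / (4 * (1 + κ * C1)) := ⟨_, rfl⟩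
  have hεp : 0 < ε := by rw [hε]; positivity
  have hε1 : κ * ε * C1 + ε ≤ 1 / 4 + ε ∧ ε ≤ 1 / 4 := by
    have h1 : 0 < κ * C1 := by positivity
    have h2 : ε * (4 * (1 + κ * C1)) = 1 := by rw [hε]; field_simp
    constructor <;> nlinarith
  obtain ⟨η, hη⟩ : ∃ η, η = 1 / (4 * (1 + (A + B) * m0)) := ⟨_, rfl⟩
  have hηp : 0 < η := by rw [hη]; positivity
  have hη1 : (A + B) * m0 * η ≤ 1 / 4 := by
    have h2 : η * (4 * (1 + (A + B) * m0)) = 1 := by rw [hη]; field_simp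
    nlinarith
  obtain ⟨D, hD⟩ : ∃ D, D = A * C1 + κ * (C1 ^ 3 / ε ^ 3) := ⟨_, rfl⟩
  have hD0 : 0 ≤ D := by rw [hD]; positivity
  obtain ⟨D', hD'⟩ : ∃ D', D' = (A + B) * m0 * (m0 / η) := ⟨_, rfl⟩
  obtain ⟨F, hF⟩ : ∃ F, F = 4 * (e0 + D' + D ^ 2 + 1) := ⟨_, rfl⟩
  refine ⟨F + C1 * (1 + F) + F / κ, fun a b e I1 I2 I3 ha hb he h1 h2 h3 h4 h5 => ?_⟩
  obtain ⟨s, hs⟩ : ∃ s, s = Real.sqrt (1 + a) := ⟨_, rfl⟩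
  have hs2 : s ^ 2 = 1 + a := by rw [hs]; exact Real.sq_sqrt (by linarith)
  have hs0 : 0 ≤ s := by rw [hs]; exact Real.sqrt_nonneg _
  have hs1 : 1 ≤ s := by nlinarith
  have hsp : 0 < s := by linarith
  have hb1 : b ≤ C1 * s := by
    have := h1 (1 / s) (by positivity)
    have e1 : m0 / (1 / s) = m0 * s := by field_simp
    have e2 : 1 / s * a ≤ s := by
      rw [div_mul_eq_mul_div, one_mul, div_le_iff₀ hsp]; nlinarith
    rw [e1] at this
    rw [hC1, div_mul_eq_mul_div, le_div_iff₀ hκ]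
    nlinarith
  have hI2 := h2 η hηp
  have hI3 : I3 ≤ ε * C1 * s ^ 2 + C1 ^ 3 / ε ^ 3 * s + ε * e := by
    have := h4 (ε * s) (ε ^ 2 / C1) (by positivity) (by positivity)
    have e1 : ε * s * b ≤ ε * C1 * s ^ 2 := by
      have : ε * s * b ≤ ε * s * (C1 * s) := mul_le_mul_of_nonneg_left hb1 (by positivity)
      nlinarith
    have e2 : (b / (ε ^ 2 / C1) + ε ^ 2 / C1 * e) * b / (ε * s)
       ≤ (C1 * s / (ε ^ 2 / C1) + ε ^ 2 / C1 * e) * (C1 * s) / (ε * s) := by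
      gcongr
    have e3 : (C1 * s / (ε ^ 2 / C1) + ε ^ 2 / C1 * e) * (C1 * s) / (ε * s)
       = C1 ^ 3 / ε ^ 3 * s + ε * e := by field_simp
    linarith
  have hAI : A * I1 ≤ A * (C1 * s + I2) := mul_le_mul_of_nonneg_left (by linarith) hA
  have hABI : (A + B) * I2 ≤ (A + B) * (m0 * (m0 / η + η * a)) := mul_le_mul_of_nonneg_left hI2 (by positivity)
  have hκI : κ * I3 ≤ κ * (ε * C1 * s ^ 2 + C1 ^ 3 / ε ^ 3 * s + ε * e) := mul_le_mul_of_nonneg_left hI3 hκ.le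
  have k1 : (A + B) * (m0 * (m0 / η + η * a)) ≤ D' + 1 / 4 * a := by
    have := mul_le_mul_of_nonneg_right hη1 ha
    rw [hD', show (A + B) * (m0 * (m0 / η + η * a)) = (A + B) * m0 * (m0 / η) + (A + B) * m0 * η * a by ring]
    linarith
  have k2 : κ * (ε * C1 * s ^ 2) ≤ 1 / 4 * (1 + a) := by
    rw [hs2, show κ * (ε * C1 * (1 + a)) = (κ * ε * C1) * (1 + a) by ring]
    exact mul_le_mul_of_nonneg_right (by linarith [hε1.1]) (by linarith)
  have k3 : κ * (ε * e) ≤ κ * e / 4 := by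
    have : ε * e ≤ 1 / 4 * e := mul_le_mul_of_nonneg_right hε1.2 he
    nlinarith
  have k4 : D * s ≤ s ^ 2 / 4 + D ^ 2 := by nlinarith [sq_nonneg (s / 2 - D)]
  have k5 : D * s = A * (C1 * s) + κ * (C1 ^ 3 / ε ^ 3 * s) := by rw [hD]; ring
  have hfin : a / 4 + κ * e / 4 ≤ F / 4 := by
    have z1 : e0 + A * I1 + B * I2 + κ * I3 ≤ e0 + A * (C1 * s) + (A + B) * I2 + κ * I3 := by linarith
    have z2 : κ * I3 ≤ κ * (ε * C1 * s ^ 2) + κ * (C1 ^ 3 / ε ^ 3 * s) + κ * (ε * e) := by linarith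
    rw [hF]; linarith
  have hκe : 0 ≤ κ * e := by positivity
  have haF : a ≤ F := by linarith
  have heF : e ≤ F / κ := by rw [le_div_iff₀ hκ]; linarith
  have hsF : s ≤ 1 + F := by nlinarith
  have : b ≤ C1 * (1 + F) := hb1.trans (mul_le_mul_of_nonneg_left hsF hC1p.le)
  linarith

section
variable {α β γ T κ : ℝ} {p q v : ℝ → ℝ → ℝ}

theorem Sol.n_sup (S : Sol α β γ T p q v) {t : ℝ} (ht : t ∈ Icc 0 T) {η : ℝ} (hη : 0 < η) {x : ℝ} (hx : 0 ≤ x) :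
    p x t ^ 2 + q x t ^ 2 ≤ mf p q t / η + η * ∫ x in Ioi (0:ℝ), (pdx p x t ^ 2 + pdx q x t ^ 2) := by
  have c1 := (S.rp t ht).c; have c2 := (S.rq t ht).c
  have c3 := (S.rp1 t ht).c; have c4 := (S.rq1 t ht).c
  have i1 := ((S.rn ht).cmul η⁻¹).int
  have i2 := (((S.rp1 t ht).sq.add (S.rq1 t ht).sq).cmul η).int
  have := ftc_le (F := fun x => p x t ^ 2 + q x t ^ 2)
    (F' := fun x => 2 * p x t * pdx p x t + 2 * q x t * pdx q x t)
    (B := fun x => η⁻¹ * (p x t ^ 2 + q x t ^ 2) + η * (pdx p x t ^ 2 + pdx q x t ^ 2))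
    (fun x _ => (((sq_hasDeriv (S.sp.hx x t)).fun_add (sq_hasDeriv (S.sq.hx x t))).congr_deriv (by ring)))
    (by fun_prop) (i1.add i2) (fun x _ => by positivity)
    (fun x _ => by
      have key : ∀ a b : ℝ, 2 * a * b ≤ η⁻¹ * a ^ 2 + η * b ^ 2 := fun a b => by
        have e : η⁻¹ * a ^ 2 + η * b ^ 2 - 2 * a * b = η⁻¹ * (a - η * b) ^ 2 := by field_simp; ring
        have : 0 ≤ η⁻¹ * (a - η * b) ^ 2 := by positivity
        linarith
      have := key (p x t) (pdx p x t); have := key (q x t) (pdx q x t)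
      linarith) x hx
  rw [integral_add i1 i2, integral_const_mul, integral_const_mul] at this
  simp only [S.p0 t ht, S.q0 t ht] at this
  unfold mf
  rw [div_eq_inv_mul]
  linarith

theorem Sol.v_sup (S : Sol α β γ T p q v) {t : ℝ} (ht : t ∈ Icc 0 T) {η : ℝ} (hη : 0 < η) {x : ℝ} (hx : 0 ≤ x) :
    v x t ^ 2 ≤ (∫ x in Ioi (0:ℝ), v x t ^ 2) / η + η * ∫ x in Ioi (0:ℝ), pdx v x t ^ 2 := by
  have c1 := (S.rv t ht).c; have c3 := (S.rv1 t ht).c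
  have i1 := ((S.rv t ht).sq.cmul η⁻¹).int
  have i2 := ((S.rv1 t ht).sq.cmul η).int
  have := ftc_le (F := fun x => v x t ^ 2)
    (F' := fun x => 2 * v x t * pdx v x t)
    (B := fun x => η⁻¹ * v x t ^ 2 + η * pdx v x t ^ 2)
    (fun x _ => (sq_hasDeriv (S.sv.hx x t)).congr_deriv (by ring))
    (by fun_prop) (i1.add i2) (fun x _ => by positivity)
    (fun x _ => by
      have e : η⁻¹ * v x t ^ 2 + η * pdx v x t ^ 2 - 2 * v x t * pdx v x t = η⁻¹ * (v x t - η * pdx v x t) ^ 2 := by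
        field_simp; ring
      have : 0 ≤ η⁻¹ * (v x t - η * pdx v x t) ^ 2 := by positivity
      linarith) x hx
  rw [integral_add i1 i2, integral_const_mul, integral_const_mul] at this
  simp only [S.v0 t ht] at this
  rw [div_eq_inv_mul]
  linarith

theorem Sol.H_split (S : Sol α β γ T p q v) {t : ℝ} (ht : t ∈ Icc 0 T) :
    H p q v t = mf p q t + ((∫ x in Ioi (0:ℝ), (pdx p x t ^ 2 + pdx q x t ^ 2))
      + (∫ x in Ioi (0:ℝ), v x t ^ 2) + ∫ x in Ioi (0:ℝ), pdx v x t ^ 2) := by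
  have i1 := (S.rn ht).int
  have i2 := ((S.rp1 t ht).sq.add (S.rq1 t ht).sq).int
  have i3 := (S.rv t ht).sq.int
  have i4 := (S.rv1 t ht).sq.int
  unfold mf H
  have i23 : IntegrableOn (fun x => pdx p x t ^ 2 + pdx q x t ^ 2 + v x t ^ 2) (Ioi 0) := i2.add i3
  have i234 : IntegrableOn (fun x => pdx p x t ^ 2 + pdx q x t ^ 2 + v x t ^ 2 + pdx v x t ^ 2) (Ioi 0) :=
    i23.add i4
  rw [← integral_add i2 i3, ← integral_add i23 i4, ← integral_add i1 i234]
  congr 1; ext x; simp only [hd]; ring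

theorem Sol.coer (S : Sol α β γ T p q v) (hκ : 0 < κ) (m0 q0 e0 : ℝ) (hm : 0 ≤ m0) (hq : 0 ≤ q0) :
    ∃ C, ∀ t ∈ Icc 0 T, mf p q t ≤ m0 → |Qf κ p q v t| ≤ q0 → Ef α β κ p q v t ≤ e0 → H p q v t ≤ C := by
  obtain ⟨C, hC⟩ := coer_arith |α| |β| κ m0 q0 e0 (abs_nonneg _) (abs_nonneg _) hκ hm hq
  refine ⟨m0 + C, fun t ht h1 h2 h3 => ?_⟩
  have rn := S.rn ht
  have ra := (S.rp1 t ht).sq.add (S.rq1 t ht).sq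
  have rb := (S.rv t ht).sq
  have re := (S.rv1 t ht).sq
  have rj := (((S.rq t ht).mul (S.rp1 t ht)).sub ((S.rp t ht).mul (S.rq1 t ht))).cmul 2
  have r1 := (S.rv t ht).mul rn
  have r3 := (S.rv t ht).cube
  have hmf : 0 ≤ mf p q t := int_nn fun x _ => by positivity
  have ha : 0 ≤ ∫ x in Ioi (0:ℝ), (pdx p x t ^ 2 + pdx q x t ^ 2) := int_nn fun x _ => by positivity
  have hb : 0 ≤ ∫ x in Ioi (0:ℝ), v x t ^ 2 := int_nn fun x _ => by positivity
  have he : 0 ≤ ∫ x in Ioi (0:ℝ), pdx v x t ^ 2 := int_nn fun x _ => by positivity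
  rw [S.H_split ht]
  refine add_le_add h1 (hC _ _ _ (∫ x in Ioi (0:ℝ), |v x t * (p x t ^ 2 + q x t ^ 2)|)
    (∫ x in Ioi (0:ℝ), (p x t ^ 2 + q x t ^ 2) ^ 2) (∫ x in Ioi (0:ℝ), |v x t ^ 3|) ha hb he ?_ ?_ ?_ ?_ ?_)
  · intro δ hδ
    have e1 : Qf κ p q v t = κ * (∫ x in Ioi (0:ℝ), v x t ^ 2)
        + ∫ x in Ioi (0:ℝ), 2 * (q x t * pdx p x t - p x t * pdx q x t) := by
      unfold Qf qd
      rw [integral_add (rb.cmul κ).int rj.int, integral_const_mul]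
    have e2 : ∫ x in Ioi (0:ℝ), -(2 * (q x t * pdx p x t - p x t * pdx q x t))
        ≤ ∫ x in Ioi (0:ℝ), (δ⁻¹ * (p x t ^ 2 + q x t ^ 2) + δ * (pdx p x t ^ 2 + pdx q x t ^ 2)) := by
      refine int_mono rj.neg.int ((rn.cmul δ⁻¹).int.add (ra.cmul δ).int) fun x _ => ?_
      have e : δ⁻¹ * (p x t ^ 2 + q x t ^ 2) + δ * (pdx p x t ^ 2 + pdx q x t ^ 2)
        + 2 * (q x t * pdx p x t - p x t * pdx q x t)
        = δ⁻¹ * ((q x t + δ * pdx p x t) ^ 2 + (p x t - δ * pdx q x t) ^ 2) := by field_simp; ring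
      have : 0 ≤ δ⁻¹ * ((q x t + δ * pdx p x t) ^ 2 + (p x t - δ * pdx q x t) ^ 2) := by positivity
      linarith
    rw [integral_add (rn.cmul δ⁻¹).int (ra.cmul δ).int, integral_const_mul, integral_const_mul, integral_neg] at e2
    have e3 : δ⁻¹ * mf p q t ≤ m0 / δ := by
      rw [div_eq_inv_mul]; exact mul_le_mul_of_nonneg_left h1 (by positivity)
    unfold mf at e3
    have := (abs_le.1 h2).2
    linarith
  · intro η hη
    have e1 : ∫ x in Ioi (0:ℝ), (p x t ^ 2 + q x t ^ 2) ^ 2 ≤ ∫ x in Ioi (0:ℝ),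
        (mf p q t / η + η * ∫ x in Ioi (0:ℝ), (pdx p x t ^ 2 + pdx q x t ^ 2)) * (p x t ^ 2 + q x t ^ 2) := by
      refine int_mono rn.sq.int (rn.cmul _).int fun x hx => ?_
      rw [pow_two (p x t ^ 2 + q x t ^ 2)]
      exact mul_le_mul_of_nonneg_right (S.n_sup ht hη hx) (by positivity)
    rw [integral_const_mul] at e1
    refine e1.trans ?_
    rw [mul_comm]
    change mf p q t * _ ≤ _
    gcongr
  · rw [← integral_add rb.int rn.sq.int]
    refine int_mono r1.int.abs (rb.int.add rn.sq.int) fun x _ => ?_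
    rw [abs_le]
    constructor <;> nlinarith [sq_nonneg (v x t + (p x t ^ 2 + q x t ^ 2)), sq_nonneg (v x t - (p x t ^ 2 + q x t ^ 2)),
      sq_nonneg (v x t), sq_nonneg (p x t ^ 2 + q x t ^ 2)]
  · intro ω μ hω hμ
    have hM : 0 ≤ ((∫ x in Ioi (0:ℝ), v x t ^ 2) / μ + μ * ∫ x in Ioi (0:ℝ), pdx v x t ^ 2) := by positivity
    set M := ((∫ x in Ioi (0:ℝ), v x t ^ 2) / μ + μ * ∫ x in Ioi (0:ℝ), pdx v x t ^ 2) with hMdef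
    have e1 : ∫ x in Ioi (0:ℝ), |v x t ^ 3| ≤ ∫ x in Ioi (0:ℝ), (ω + M / ω) * v x t ^ 2 := by
      refine int_mono r3.int.abs (rb.cmul _).int fun x hx => ?_
      rw [show v x t ^ 3 = v x t * v x t ^ 2 by ring, abs_mul, abs_of_nonneg (sq_nonneg (v x t))]
      refine mul_le_mul_of_nonneg_right ?_ (sq_nonneg _)
      have hs := S.v_sup ht hμ hx
      rw [← hMdef, ← sq_abs] at hs
      have h4 : |v x t| * ω ≤ ω ^ 2 + M := by nlinarith [sq_nonneg (|v x t| - ω), abs_nonneg (v x t)]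
      have : ω + M / ω = (ω ^ 2 + M) / ω := by field_simp
      rw [this, le_div_iff₀ hω]; exact h4
    rw [integral_const_mul] at e1
    refine e1.trans (le_of_eq ?_)
    ring
  · have i1 := ra.int
    have i4 := (re.cmul (κ / 2)).int
    have j1 := r1.int.abs.const_mul |α|
    have j2 := (rn.sq.cmul |β|).int
    have j3 := r3.int.abs.const_mul κ
    have e1 : ∫ x in Ioi (0:ℝ), ((pdx p x t ^ 2 + pdx q x t ^ 2) + κ / 2 * pdx v x t ^ 2)
       ≤ ∫ x in Ioi (0:ℝ), (ed α β κ p q v x t + |α| * |v x t * (p x t ^ 2 + q x t ^ 2)|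
         + |β| * (p x t ^ 2 + q x t ^ 2) ^ 2 + κ * |v x t ^ 3|) := by
      refine int_mono (i1.add i4) ((((S.ed_rd ht).int.add j1).add j2).add j3) fun x _ => ?_
      unfold ed
      have a1 : -(|α| * |v x t * (p x t ^ 2 + q x t ^ 2)|) ≤ α * (v x t * (p x t ^ 2 + q x t ^ 2)) := by
        rw [← abs_mul]; exact neg_abs_le _
      have a2 : -(|β| * (p x t ^ 2 + q x t ^ 2) ^ 2) ≤ (β / 2) * (p x t ^ 2 + q x t ^ 2) ^ 2 := by
        have := neg_abs_le β
        have := abs_nonneg β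
        have h := sq_nonneg (p x t ^ 2 + q x t ^ 2)
        nlinarith
      have a3 : κ * v x t ^ 3 ≤ κ * |v x t ^ 3| := mul_le_mul_of_nonneg_left (le_abs_self _) hκ.le
      have a4 : 0 ≤ κ * |v x t ^ 3| := by positivity
      linarith
    have k1 : IntegrableOn (fun x => ed α β κ p q v x t + |α| * |v x t * (p x t ^ 2 + q x t ^ 2)|) (Ioi 0) :=
      (S.ed_rd ht).int.add j1
    have k2 : IntegrableOn (fun x => ed α β κ p q v x t + |α| * |v x t * (p x t ^ 2 + q x t ^ 2)|
      + |β| * (p x t ^ 2 + q x t ^ 2) ^ 2) (Ioi 0) := k1.add j2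
    rw [integral_add i1 i4, integral_add k2 j3,
      integral_add k1 j2, integral_add (S.ed_rd ht).int j1, integral_const_mul,
      integral_const_mul, integral_const_mul, integral_const_mul] at e1
    unfold Ef at h3
    linarith

/-- conversely the conserved quantities are controlled by H -/
theorem Sol.QE_le (S : Sol α β γ T p q v) (hκ : 0 < κ) (N : ℝ) :
    ∃ C, 0 ≤ C ∧ ∀ t ∈ Icc 0 T, H p q v t ≤ N →
      mf p q t ≤ C ∧ |Qf κ p q v t| ≤ C ∧ |Ef α β κ p q v t| ≤ C := by
  set N' := max N 0 with hN'
  have hN0 : 0 ≤ N' := le_max_right _ _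
  set D := 2 + κ + |α| * (N' + 1) + |β| * N' + κ * (N' + 1) with hD
  have hD0 : 0 ≤ D := by positivity
  refine ⟨D * N', by positivity, fun t ht hH => ?_⟩
  have hH' : H p q v t ≤ N' := hH.trans (le_max_left _ _)
  have hI := (S.rhd ht).int
  have key : ∀ f : ℝ → ℝ, RD f → (∀ x, 0 ≤ x → |f x| ≤ D * hd p q v x t) →
      |∫ x in Ioi (0:ℝ), f x| ≤ D * N' := by
    intro f hf h
    calc |∫ x in Ioi (0:ℝ), f x| ≤ ∫ x in Ioi (0:ℝ), |f x| := abs_integral_le_integral_abs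
      _ ≤ ∫ x in Ioi (0:ℝ), D * hd p q v x t := int_mono hf.int.abs (hI.const_mul D) h
      _ = D * H p q v t := integral_const_mul _ _
      _ ≤ D * N' := mul_le_mul_of_nonneg_left hH' hD0
  have hDge : 1 + κ ≤ D ∧ 1 ≤ D := by
    have : 0 ≤ |α| * (N' + 1) + |β| * N' + κ * (N' + 1) := by positivity
    constructor <;> linarith
  refine ⟨(le_abs_self _).trans (key _ (S.rn ht) fun x hx => ?_), key _ (S.qd_rd ht) fun x hx => ?_,
    key _ (S.ed_rd ht) fun x hx => ?_⟩
  · have : p x t ^ 2 + q x t ^ 2 ≤ hd p q v x t := by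
      unfold hd; nlinarith [sq_nonneg (v x t), sq_nonneg (pdx v x t), sq_nonneg (pdx p x t), sq_nonneg (pdx q x t)]
    rw [abs_of_nonneg (by positivity)]
    have := hd_nn (p := p) (q := q) (v := v) x t
    nlinarith [hDge.2]
  · unfold qd
    refine (abs_add_le _ _).trans ?_
    have h1 := Sol.j_le (p := p) (q := q) (v := v) (x := x) (t := t)
    have h2 : |κ * v x t ^ 2| ≤ κ * hd p q v x t := by
      rw [abs_of_nonneg (by positivity)]
      refine mul_le_mul_of_nonneg_left ?_ hκ.le
      unfold hd; nlinarith [sq_nonneg (p x t), sq_nonneg (q x t), sq_nonneg (pdx v x t), sq_nonneg (pdx p x t), sq_nonneg (pdx q x t)]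
    have := hd_nn (p := p) (q := q) (v := v) x t
    nlinarith [hDge.1]
  · have hn := (S.n_le ht hx).trans hH'
    have hv := (S.v_le ht hx).trans hH'
    have hva : |v x t| ≤ N' + 1 := abs_le.2 ⟨by nlinarith, by nlinarith⟩
    have hnn : 0 ≤ p x t ^ 2 + q x t ^ 2 := by positivity
    have b1 : |α * (v x t * (p x t ^ 2 + q x t ^ 2))| ≤ |α| * (N' + 1) * (p x t ^ 2 + q x t ^ 2) := by
      rw [abs_mul, abs_mul, abs_of_nonneg hnn, mul_assoc]
      gcongr
    have b2 : |(β / 2) * (p x t ^ 2 + q x t ^ 2) ^ 2| ≤ |β| * N' * (p x t ^ 2 + q x t ^ 2) := by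
      rw [abs_mul, abs_of_nonneg (sq_nonneg (p x t ^ 2 + q x t ^ 2)), abs_div, abs_two, mul_assoc]
      have : (p x t ^ 2 + q x t ^ 2) ^ 2 ≤ N' * (p x t ^ 2 + q x t ^ 2) := by nlinarith
      have h0 := abs_nonneg β
      calc |β| / 2 * (p x t ^ 2 + q x t ^ 2) ^ 2 ≤ |β| * (p x t ^ 2 + q x t ^ 2) ^ 2 := by
            gcongr; linarith
        _ ≤ _ := by gcongr
    have b3 : |v x t ^ 3| ≤ (N' + 1) * v x t ^ 2 := by
      rw [show v x t ^ 3 = v x t * v x t ^ 2 by ring, abs_mul, abs_of_nonneg (sq_nonneg (v x t))]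
      exact mul_le_mul_of_nonneg_right hva (sq_nonneg _)
    have b4 : |κ * ((1/2) * pdx v x t ^ 2 - (1/6) * v x t ^ 3)| ≤ κ * (pdx v x t ^ 2 + (N' + 1) * v x t ^ 2) := by
      rw [abs_mul, abs_of_pos hκ]
      refine mul_le_mul_of_nonneg_left ?_ hκ.le
      have := abs_le.1 b3
      have h5 := sq_nonneg (pdx v x t)
      have h6 : 0 ≤ (N' + 1) * v x t ^ 2 := by positivity
      rw [abs_le]; constructor <;> linarith [this.1, this.2]
    have tot : |ed α β κ p q v x t| ≤ (pdx p x t ^ 2 + pdx q x t ^ 2) + |α| * (N' + 1) * (p x t ^ 2 + q x t ^ 2)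
      + |β| * N' * (p x t ^ 2 + q x t ^ 2) + κ * (pdx v x t ^ 2 + (N' + 1) * v x t ^ 2) := by
      unfold ed
      refine (abs_add_le _ _).trans (add_le_add ((abs_add_le _ _).trans (add_le_add ((abs_add_le _ _).trans
        (add_le_add ?_ b1)) b2)) b4)
      rw [abs_of_nonneg (by positivity)]
    refine tot.trans ?_
    have e : D * hd p q v x t - ((pdx p x t ^ 2 + pdx q x t ^ 2) + |α| * (N' + 1) * (p x t ^ 2 + q x t ^ 2)
      + |β| * N' * (p x t ^ 2 + q x t ^ 2) + κ * (pdx v x t ^ 2 + (N' + 1) * v x t ^ 2))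
      = (2 + κ + κ * (N' + 1)) * (p x t ^ 2 + q x t ^ 2)
        + (D - 1) * (pdx p x t ^ 2 + pdx q x t ^ 2)
        + (2 + κ + |α| * (N' + 1) + |β| * N') * v x t ^ 2
        + (D - κ) * pdx v x t ^ 2 := by
      rw [hD]; unfold hd; ring
    have f1 : 0 ≤ D - 1 := by linarith [hDge.2]
    have f2 : 0 ≤ D - κ := by linarith [hDge.1]
    have : 0 ≤ (2 + κ + κ * (N' + 1)) * (p x t ^ 2 + q x t ^ 2)
        + (D - 1) * (pdx p x t ^ 2 + pdx q x t ^ 2)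
        + (2 + κ + |α| * (N' + 1) + |β| * N') * v x t ^ 2
        + (D - κ) * pdx v x t ^ 2 := by positivity
    linarith
end


section
variable {α β γ T κ : ℝ} {p q v : ℝ → ℝ → ℝ}

theorem Sol.anchor (S : Sol α β γ T p q v) (hκ : κ * γ = α) (hκ0 : 0 < κ) (N : ℝ) :
    ∃ C, ∀ c d K : ℝ, 0 ≤ c → d ≤ T → (∀ t ∈ Icc c d, H p q v t ≤ K) → ∀ s ∈ Icc c d, H p q v s ≤ N →
      ∀ r ∈ Icc c d, H p q v r ≤ C := by
  obtain ⟨C0, hC00, hC0⟩ := S.QE_var hκ hκ0.le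
  obtain ⟨C1, hC10, hC1⟩ := S.QE_le hκ0 N
  obtain ⟨C, hC⟩ := S.coer hκ0 C1 (C1 + C0) (C1 + C0) hC10 (by linarith)
  refine ⟨C, fun c d K hc hd' hK s hs hN r hr => ?_⟩
  have hsT : s ∈ Icc 0 T := ⟨hc.trans hs.1, hs.2.trans hd'⟩
  have hrT : r ∈ Icc 0 T := ⟨hc.trans hr.1, hr.2.trans hd'⟩
  obtain ⟨a1, a2, a3⟩ := hC1 s hsT hN
  rw [abs_le] at a2 a3
  rcases le_total r s with h | h
  · have hK' : ∀ t ∈ Icc r s, H p q v t ≤ K := fun t ht => hK t ⟨hr.1.trans ht.1, ht.2.trans hs.2⟩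
    obtain ⟨b1, b2⟩ := hC0 r s K hrT.1 h hsT.2 hK'
    have b3 := S.cons_m hrT.1 h hsT.2 hK'
    rw [abs_le] at b1 b2
    refine hC r hrT (by linarith) (abs_le.2 ⟨?_, ?_⟩) ?_ <;> linarith
  · have hK' : ∀ t ∈ Icc s r, H p q v t ≤ K := fun t ht => hK t ⟨hs.1.trans ht.1, ht.2.trans hr.2⟩
    obtain ⟨b1, b2⟩ := hC0 s r K hsT.1 h hrT.2 hK'
    have b3 := S.cons_m hsT.1 h hrT.2 hK'
    rw [abs_le] at b1 b2
    refine hC r hrT (by linarith) (abs_le.2 ⟨?_, ?_⟩) ?_ <;> linarith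

theorem Sol.step_left (S : Sol α β γ T p q v) (hκ : κ * γ = α) (hκ0 : 0 < κ) (N : ℝ) :
    ∃ C, ∀ c d : ℝ, 0 ≤ c → c < d → d ≤ T → (∀ d' < d, ∃ K, ∀ t ∈ Icc c d', H p q v t ≤ K) →
      H p q v d ≤ N → H p q v c ≤ C := by
  obtain ⟨C, hC⟩ := S.anchor hκ hκ0 N
  refine ⟨C, fun c d hc hcd hd' hG hN => ?_⟩
  obtain ⟨C2, hC2⟩ := S.anchor hκ hκ0 (H p q v c)
  refine hC c d (max C2 (H p q v d)) hc hd' (fun t ht => ?_) d ⟨hcd.le, le_rfl⟩ hN c ⟨le_rfl, hcd.le⟩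
  rcases eq_or_lt_of_le ht.2 with h | h
  · rw [h]; exact le_max_right _ _
  · obtain ⟨K, hK⟩ := hG t h
    exact (hC2 c t K hc (h.le.trans hd') hK c ⟨le_rfl, ht.1⟩ le_rfl t ⟨ht.1, le_rfl⟩).trans (le_max_left _ _)

theorem Sol.step_right (S : Sol α β γ T p q v) (hκ : κ * γ = α) (hκ0 : 0 < κ) (N : ℝ) :
    ∃ C, ∀ c d : ℝ, 0 ≤ c → c < d → d ≤ T → (∀ c', c < c' → ∃ K, ∀ t ∈ Icc c' d, H p q v t ≤ K) →
      H p q v c ≤ N → H p q v d ≤ C := by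
  obtain ⟨C, hC⟩ := S.anchor hκ hκ0 N
  refine ⟨C, fun c d hc hcd hd' hG hN => ?_⟩
  obtain ⟨C2, hC2⟩ := S.anchor hκ hκ0 (H p q v d)
  refine hC c d (max C2 (H p q v c)) hc hd' (fun t ht => ?_) c ⟨le_rfl, hcd.le⟩ hN d ⟨hcd.le, le_rfl⟩
  rcases eq_or_lt_of_le ht.1 with h | h
  · rw [← h]; exact le_max_right _ _
  · obtain ⟨K, hK⟩ := hG t h
    exact (hC2 t d K (hc.trans h.le) hd' hK d ⟨ht.2, le_rfl⟩ le_rfl t ⟨le_rfl, ht.2⟩).trans (le_max_left _ _)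

/-- local boundedness -/
def LB (h : ℝ → ℝ) (T t : ℝ) : Prop := ∃ ε > 0, ∃ K : ℝ, ∀ s ∈ Icc 0 T, |s - t| < ε → h s ≤ K

theorem LB_open (h : ℝ → ℝ) (T : ℝ) : IsOpen {t | LB h T t} := by
  rw [Metric.isOpen_iff]
  rintro t ⟨ε, hε, K, hK⟩
  refine ⟨ε / 2, by positivity, fun s hs => ⟨ε / 2, by positivity, K, fun r hr hrs => hK r hr ?_⟩⟩
  rw [Metric.mem_ball, Real.dist_eq] at hs
  have : r - t = (r - s) + (s - t) := by ring
  rw [this]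
  exact (abs_add_le _ _).trans_lt (by linarith)

theorem LB_cpt {h : ℝ → ℝ} {T c d : ℝ} (hc : 0 ≤ c) (hd' : d ≤ T) (hL : ∀ t ∈ Icc c d, LB h T t) :
    ∃ K, ∀ t ∈ Icc c d, h t ≤ K := by
  refine (isCompact_Icc (a := c) (b := d)).induction_on
    (p := fun s => ∃ K, ∀ t ∈ s ∩ Icc c d, h t ≤ K) ?_ ?_ ?_ ?_ |>.imp fun K hK t ht => hK t ⟨ht, ht⟩
  · exact ⟨0, fun t ht => by simp at ht⟩
  · rintro s s' hs ⟨K, hK⟩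
    exact ⟨K, fun t ht => hK t ⟨hs ht.1, ht.2⟩⟩
  · rintro s s' ⟨K, hK⟩ ⟨K', hK'⟩
    refine ⟨max K K', fun t ht => ?_⟩
    rcases ht.1 with h1 | h1
    · exact (hK t ⟨h1, ht.2⟩).trans (le_max_left _ _)
    · exact (hK' t ⟨h1, ht.2⟩).trans (le_max_right _ _)
  · intro t ht
    obtain ⟨ε, hε, K, hK⟩ := hL t ht
    refine ⟨Metric.ball t ε, mem_nhdsWithin_of_mem_nhds (Metric.ball_mem_nhds t hε), K, fun s hs => ?_⟩
    exact hK s ⟨hc.trans hs.2.1, hs.2.2.trans hd'⟩ (by simpa [Real.dist_eq] using hs.1)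

theorem baire_bd {h : ℝ → ℝ} {T : ℝ} (hT : 0 ≤ T)
    (hcl : ∀ N : ℝ, IsClosed {t | t ∈ Icc 0 T ∧ h t ≤ N})
    (hl : ∀ N : ℝ, ∃ C, ∀ c d : ℝ, 0 ≤ c → c < d → d ≤ T → (∀ d' < d, ∃ K, ∀ t ∈ Icc c d', h t ≤ K) →
      h d ≤ N → h c ≤ C)
    (hr : ∀ N : ℝ, ∃ C, ∀ c d : ℝ, 0 ≤ c → c < d → d ≤ T → (∀ c', c < c' → ∃ K, ∀ t ∈ Icc c' d, h t ≤ K) →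
      h c ≤ N → h d ≤ C) :
    ∃ K, ∀ t ∈ Icc 0 T, h t ≤ K := by
  apply LB_cpt le_rfl le_rfl
  by_contra hcon
  push Not at hcon
  obtain ⟨t0, ht0, hbad⟩ := hcon
  set B : Set ℝ := Icc 0 T ∩ {t | LB h T t}ᶜ with hB
  have hBc : IsClosed B := isClosed_Icc.inter (LB_open h T).isClosed_compl
  have hBk : IsCompact B := isCompact_Icc.inter_right (LB_open h T).isClosed_compl
  have : Nonempty B := ⟨⟨t0, ht0, hbad⟩⟩
  have : CompleteSpace B := hBc.completeSpace_coe
  obtain ⟨n, b, hb⟩ := nonempty_interior_of_iUnion_of_closed (X := B) (f := fun n : ℕ => {b : B | h b ≤ n})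
    (fun n => by
      have := (hcl n).preimage (continuous_subtype_val (p := (· ∈ B)))
      convert this using 1
      ext b
      simp only [mem_setOf_eq, mem_preimage]
      exact ⟨fun h => ⟨b.2.1, h⟩, fun h => h.2⟩)
    (by
      ext b
      simp only [mem_iUnion, mem_setOf_eq, mem_univ, iff_true]
      exact exists_nat_ge (h b))
  rw [mem_interior_iff_mem_nhds, Metric.mem_nhds_iff] at hb
  obtain ⟨ε, hε, hball⟩ := hb
  have hnear : ∀ s ∈ B, |s - b| < ε → h s ≤ n := fun s hs hsb =>
    hball (show (⟨s, hs⟩ : B) ∈ Metric.ball b ε by simpa [Subtype.dist_eq, Real.dist_eq] using hsb)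
  obtain ⟨C1, hC1⟩ := hl n
  obtain ⟨C2, hC2⟩ := hr n
  refine b.2.2 ⟨ε, hε, max (n : ℝ) (max C1 C2), fun s hs hsb => ?_⟩
  by_cases hsB : s ∈ B
  · exact (hnear s hsB hsb).trans (le_max_left _ _)
  rw [abs_lt] at hsb
  have hgood : ∀ c d, 0 ≤ c → d ≤ T → (∀ t ∈ Icc c d, t ∉ B) → ∃ K, ∀ t ∈ Icc c d, h t ≤ K := by
    intro c d hc hd' hn
    apply LB_cpt hc hd'
    intro t ht
    by_contra hh
    exact hn t ht ⟨⟨hc.trans ht.1, ht.2.trans hd'⟩, hh⟩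
  rcases lt_trichotomy s b with hlt | heq | hlt
  · have hne : (B ∩ Icc s b).Nonempty := ⟨b, b.2, hlt.le, le_rfl⟩
    have hk : IsCompact (B ∩ Icc s b) := hBk.inter_right isClosed_Icc
    have hm := hk.sInf_mem hne
    set d := sInf (B ∩ Icc s b) with hd
    have hsd : s < d := lt_of_le_of_ne hm.2.1 fun he => hsB (he ▸ hm.1)
    refine (hC1 s d hs.1 hsd hm.1.1.2 (fun d' hd' => ?_) ?_).trans ((le_max_left _ _).trans (le_max_right _ _))
    · refine hgood s d' hs.1 (hd'.le.trans hm.1.1.2) fun t ht htB => ?_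
      have : d ≤ t := csInf_le hk.bddBelow ⟨htB, ht.1, (ht.2.trans hd'.le).trans hm.2.2⟩
      linarith [ht.2]
    · exact hnear d hm.1 (abs_lt.2 ⟨by linarith [hm.2.1], by linarith [hm.2.2]⟩)
  · exact absurd (heq ▸ b.2) hsB
  · have hne : (B ∩ Icc b s).Nonempty := ⟨b, b.2, le_rfl, hlt.le⟩
    have hk : IsCompact (B ∩ Icc b s) := hBk.inter_right isClosed_Icc
    have hm := hk.sSup_mem hne
    set c := sSup (B ∩ Icc b s) with hc
    have hsc : c < s := lt_of_le_of_ne hm.2.2 fun he => hsB (he ▸ hm.1)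
    refine (hC2 c s hm.1.1.1 hsc hs.2 (fun c' hc' => ?_) ?_).trans ((le_max_right _ _).trans (le_max_right _ _))
    · refine hgood c' s (hm.1.1.1.trans hc'.le) hs.2 fun t ht htB => ?_
      have : t ≤ c := le_csSup hk.bddAbove ⟨htB, (hm.2.1.trans hc'.le).trans ht.1, ht.2⟩
      linarith [ht.1]
    · exact hnear c hm.1 (abs_lt.2 ⟨by linarith [hm.2.1], by linarith [hm.2.2]⟩)

theorem Sol.closed (S : Sol α β γ T p q v) (N : ℝ) : IsClosed {t | t ∈ Icc 0 T ∧ H p q v t ≤ N} := by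
  rw [← isSeqClosed_iff_isClosed]
  intro s t hs hst
  have htT : t ∈ Icc 0 T := isClosed_Icc.mem_of_tendsto hst (Eventually.of_forall fun n => (hs n).1)
  refine ⟨htT, ?_⟩
  refine fatou (f := fun n x => hd p q v x (s n)) (fun n => (S.rhd (hs n).1).int) (S.rhd htT).int
    (fun n x _ => hd_nn x _) (fun x _ => ?_) (fun n => (hs n).2)
  have c1 := S.sp.ct x; have c2 := S.sq.ct x; have c3 := S.sv.ct x
  have c4 := S.sp.pdx.ct x; have c5 := S.sq.pdx.ct x; have c6 := S.sv.pdx.ct x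
  have : Continuous (fun t => hd p q v x t) := by unfold hd; fun_prop
  exact (this.tendsto t).comp hst

theorem Sol.good (S : Sol α β γ T p q v) (hT : 0 ≤ T) (hκ : κ * γ = α) (hκ0 : 0 < κ) :
    ∃ K, ∀ t ∈ Icc 0 T, H p q v t ≤ K :=
  baire_bd hT S.closed (S.step_left hκ hκ0) (S.step_right hκ hκ0)

theorem Sol.main (S : Sol α β γ T p q v) (hT : 0 ≤ T) (hκ : κ * γ = α) (hκ0 : 0 < κ) {t : ℝ} (ht : t ∈ Icc 0 T) :
    -Qf κ p q v 0 * t + (∫ x in Ioi (0:ℝ), x * (p x 0 ^ 2 + q x 0 ^ 2))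
      ≤ ∫ x in Ioi (0:ℝ), x * (p x t ^ 2 + q x t ^ 2) := by
  obtain ⟨K, hK⟩ := S.good hT hκ hκ0
  obtain ⟨h1, h2⟩ := S.cons_M le_rfl ht.1 ht.2 (fun s hs => hK s ⟨hs.1, hs.2.trans ht.2⟩)
  have h3 : ∫ s in (0:ℝ)..t, (-Qf κ p q v 0) ≤
      ∫ s in (0:ℝ)..t, ∫ x in Ioi (0:ℝ), -(2 * (q x s * pdx p x s - p x s * pdx q x s)) := by
    apply intervalIntegral.integral_mono_on ht.1 (by simp) h1
    intro s hs
    have hsT : s ∈ Icc 0 T := ⟨hs.1, hs.2.trans ht.2⟩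
    have hQ := S.Q_mono hκ hκ0.le le_rfl hs.1 hsT.2 (fun r hr => hK r ⟨hr.1, hr.2.trans hsT.2⟩)
    have rj := (((S.rq s hsT).mul (S.rp1 s hsT)).sub ((S.rp s hsT).mul (S.rq1 s hsT))).cmul 2
    have e1 : Qf κ p q v s = κ * (∫ x in Ioi (0:ℝ), v x s ^ 2)
        + ∫ x in Ioi (0:ℝ), 2 * (q x s * pdx p x s - p x s * pdx q x s) := by
      unfold Qf qd
      rw [integral_add ((S.rv s hsT).sq.cmul κ).int rj.int, integral_const_mul]
    have hb : 0 ≤ κ * ∫ x in Ioi (0:ℝ), v x s ^ 2 := mul_nonneg hκ0.le (int_nn fun x _ => by positivity)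
    rw [integral_neg]
    linarith
  rw [intervalIntegral.integral_const, smul_eq_mul] at h3
  linarith
end


theorem RD.of_decay {f : ℝ → ℝ → ℝ} {E : Type*} [NormedAddCommGroup E] {g : ℝ → ℝ → E} {T : ℝ}
    (hg : RapidDecayPos g T) (hf : Sm f) (h : ∀ x t, |f x t| ≤ ‖g x t‖) :
    ∀ t ∈ Icc 0 T, RD fun x => f x t := by
  intro t ht
  refine ⟨hf.cx t, fun n => ?_⟩
  refine squeeze_zero_norm (fun x => ?_) (hg n t ht)
  rw [norm_mul, norm_pow, Real.norm_eq_abs, Real.norm_eq_abs]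
  exact mul_le_mul_of_nonneg_left (h x t) (by positivity)

section
variable {u : ℝ → ℝ → ℂ}

theorem re_sm (hu : ContDiff ℝ (⊤ : ℕ∞) (fun p : ℝ × ℝ => u p.1 p.2)) : Sm (fun x t => (u x t).re) :=
  Complex.reCLM.contDiff.comp hu
theorem im_sm (hu : ContDiff ℝ (⊤ : ℕ∞) (fun p : ℝ × ℝ => u p.1 p.2)) : Sm (fun x t => (u x t).im) :=
  Complex.imCLM.contDiff.comp hu

theorem u_eq : u = fun x t => ((u x t).re : ℂ) + ((u x t).im : ℂ) * Complex.I := by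
  funext x t; exact (Complex.re_add_im _).symm

theorem pdx_c {p q : ℝ → ℝ → ℝ} (hp : Sm p) (hq : Sm q) :
    pdx (fun x t => (p x t : ℂ) + (q x t : ℂ) * Complex.I)
      = fun x t => ((pdx p x t : ℝ) : ℂ) + ((pdx q x t : ℝ) : ℂ) * Complex.I := by
  funext x t
  exact ((hp.hx x t).ofReal_comp.fun_add ((hq.hx x t).ofReal_comp.mul_const Complex.I)).deriv

theorem pdt_c {p q : ℝ → ℝ → ℝ} (hp : Sm p) (hq : Sm q) :
    pdt (fun x t => (p x t : ℂ) + (q x t : ℂ) * Complex.I)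
      = fun x t => ((pdt p x t : ℝ) : ℂ) + ((pdt q x t : ℝ) : ℂ) * Complex.I := by
  funext x t
  exact ((hp.ht x t).ofReal_comp.fun_add ((hq.ht x t).ofReal_comp.mul_const Complex.I)).deriv

theorem abs_re_c (a b : ℝ) : |a| ≤ ‖(a : ℂ) + (b : ℂ) * Complex.I‖ := by
  simpa using Complex.abs_re_le_norm ((a : ℂ) + (b : ℂ) * Complex.I)
theorem abs_im_c (a b : ℝ) : |b| ≤ ‖(a : ℂ) + (b : ℂ) * Complex.I‖ := by
  simpa using Complex.abs_im_le_norm ((a : ℂ) + (b : ℂ) * Complex.I)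
theorem norm_sq_c (a b : ℝ) : ‖(a : ℂ) + (b : ℂ) * Complex.I‖ ^ 2 = a ^ 2 + b ^ 2 := by
  rw [Complex.sq_norm, Complex.normSq_add_mul_I]

theorem mk_sol {α β γ T : ℝ} {p q v : ℝ → ℝ → ℝ} (hp : Sm p) (hq : Sm q) (hv : Sm v)
    (hu : u = fun x t => (p x t : ℂ) + (q x t : ℂ) * Complex.I)
    (hNLS : ∀ x t : ℝ, 0 ≤ x → t ∈ Icc 0 T → NLSeq α β u v x t)
    (hKdV : ∀ x t : ℝ, 0 ≤ x → t ∈ Icc 0 T → KdVeq γ u v x t)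
    (hdecay : DecayPos u v T)
    (hbcu : ∀ t ∈ Icc (0:ℝ) T, u 0 t = 0)
    (hbcv : ∀ t ∈ Icc (0:ℝ) T, v 0 t = 0) : Sol α β γ T p q v := by
  subst hu
  obtain ⟨d1, d2, d3, d4, d5, d6, d7, d8, d9⟩ := hdecay
  rw [pdx_c hp hq] at d2 d3
  rw [pdt_c hp hq] at d4
  have hN : ∀ x t : ℝ, 0 ≤ x → t ∈ Icc 0 T → pdx (pdx p) x t - pdt q x t
      = α * p x t * v x t + β * p x t * (p x t ^ 2 + q x t ^ 2) ∧ pdx (pdx q) x t + pdt p x t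
      = α * q x t * v x t + β * q x t * (p x t ^ 2 + q x t ^ 2) := by
    intro x t hx ht
    have h := hNLS x t hx ht
    unfold NLSeq at h
    rw [pdx_c hp hq, pdx_c hp.pdx hq.pdx, pdt_c hp hq, ← Complex.ofReal_pow, norm_sq_c] at h
    have h1 := congrArg Complex.re h
    have h2 := congrArg Complex.im h
    simp only [Complex.add_re, Complex.add_im, Complex.mul_re, Complex.mul_im, Complex.ofReal_re, Complex.ofReal_im,
      Complex.I_re, Complex.I_im] at h1 h2
    constructor <;> linarith
  have h0 : ∀ t ∈ Icc 0 T, p 0 t = 0 ∧ q 0 t = 0 := by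
    intro t ht
    have h := hbcu t ht
    have h1 := congrArg Complex.re h
    have h2 := congrArg Complex.im h
    simp at h1 h2
    exact ⟨h1, h2⟩
  exact {
    sp := hp, sq := hq, sv := hv
    ep := fun x t hx ht => by linarith [(hN x t hx ht).2]
    eq := fun x t hx ht => by linarith [(hN x t hx ht).1]
    ev := fun x t hx ht => by
      have h := hKdV x t hx ht
      unfold KdVeq at h
      simp only [norm_sq_c] at h
      rw [((sq_hasDeriv (hp.hx x t)).fun_add (sq_hasDeriv (hq.hx x t))).deriv] at h
      linarith
    p0 := fun t ht => (h0 t ht).1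
    q0 := fun t ht => (h0 t ht).2
    v0 := hbcv
    rp := RD.of_decay d1 hp fun x t => abs_re_c _ _
    rp1 := RD.of_decay d2 hp.pdx fun x t => abs_re_c _ _
    rpt := RD.of_decay d4 hp.pdt fun x t => abs_re_c _ _
    rq := RD.of_decay d1 hq fun x t => abs_im_c _ _
    rq1 := RD.of_decay d2 hq.pdx fun x t => abs_im_c _ _
    rqt := RD.of_decay d4 hq.pdt fun x t => abs_im_c _ _
    rv := RD.of_decay d5 hv fun x t => le_rfl
    rv1 := RD.of_decay d6 hv.pdx fun x t => le_rfl
    rv2 := RD.of_decay d7 hv.pdx.pdx fun x t => le_rfl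
    rv3 := RD.of_decay d8 hv.pdx.pdx.pdx fun x t => le_rfl
    rvt := RD.of_decay d9 hv.pdt fun x t => le_rfl }
end

theorem weighted_mass_growth_right_halfline
    (α β γ T : ℝ) (hγ : γ ≠ 0) (hT : 0 < T)
    (u : ℝ → ℝ → ℂ) (v : ℝ → ℝ → ℝ)
    (hu : ContDiff ℝ (⊤ : ℕ∞) (fun p : ℝ × ℝ => u p.1 p.2))
    (hv : ContDiff ℝ (⊤ : ℕ∞) (fun p : ℝ × ℝ => v p.1 p.2))
    (hNLS : ∀ x t : ℝ, 0 ≤ x → t ∈ Icc 0 T → NLSeq α β u v x t)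
    (hKdV : ∀ x t : ℝ, 0 ≤ x → t ∈ Icc 0 T → KdVeq γ u v x t)
    (hdecay : DecayPos u v T)
    (hbcu : ∀ t ∈ Icc (0:ℝ) T, u 0 t = 0)
    (hbcv : ∀ t ∈ Icc (0:ℝ) T, v 0 t = 0)
    (hαγ : 0 < α * γ)
    (hQ0 : (∫ x in Ioi (0:ℝ),
        (α / γ * (v x 0) ^ 2 + 2 * (u x 0 * (starRingEnd ℂ) (pdx u x 0)).im)) < 0)
    :
    ∀ t ∈ Icc (0:ℝ) T,
      (∫ x in Ioi (0:ℝ), x * ‖u x t‖ ^ 2)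
        ≥ |∫ x in Ioi (0:ℝ),
              (α / γ * (v x 0) ^ 2 + 2 * (u x 0 * (starRingEnd ℂ) (pdx u x 0)).im)| * t
          + (∫ x in Ioi (0:ℝ), x * ‖u x 0‖ ^ 2) := by
  have hp := re_sm hu
  have hq := im_sm hu
  have hvs : Sm v := hv
  have S := mk_sol (α := α) (β := β) (γ := γ) hp hq hvs u_eq hNLS hKdV hdecay hbcu hbcv
  have hκ : α / γ * γ = α := div_mul_cancel₀ α hγ
  have hκ0 : 0 < α / γ := by
    have : α / γ = (α * γ) / γ ^ 2 := by field_simp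
    rw [this]; positivity
  intro t ht
  have key := S.main hT.le hκ hκ0 ht
  have hux : ∀ x t, pdx u x t = ((pdx (fun x t => (u x t).re) x t : ℝ) : ℂ)
      + ((pdx (fun x t => (u x t).im) x t : ℝ) : ℂ) * Complex.I := by
    intro x t
    conv_lhs => rw [u_eq (u := u)]
    rw [pdx_c hp hq]
  have hQ : (∫ x in Ioi (0:ℝ),
        (α / γ * (v x 0) ^ 2 + 2 * (u x 0 * (starRingEnd ℂ) (pdx u x 0)).im))
      = Qf (α / γ) (fun x t => (u x t).re) (fun x t => (u x t).im) v 0 := by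
    unfold Qf qd
    congr 1
    ext x
    rw [hux]
    simp [Complex.mul_im]
    ring
  have hM : ∀ s, (∫ x in Ioi (0:ℝ), x * ‖u x s‖ ^ 2)
      = ∫ x in Ioi (0:ℝ), x * ((u x s).re ^ 2 + (u x s).im ^ 2) := by
    intro s
    congr 1
    ext x
    rw [Complex.sq_norm, Complex.normSq_apply]
    ring
  rw [hM, hM, hQ]
  rw [hQ] at hQ0
  rw [abs_of_neg hQ0]
  exact key
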